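/- Let f ∈ R_9 satisfy conditions (C1)–(C4) and let A = R[W]/(Wⁿ + f), where R[W] = R^[1] and n ≥ 2 is an integer with n ∉ 3ℤ. Let 𝔊 be the ℕ-grading of A defined by declaring x ∈ A_{3n}, y ∈ A_{2n}, z ∈ A_n and w ∈ A_9 (w being the image of W), and let T(𝔊) be the subtorus of Aut_k(A) determined by 𝔊. Then Aut_k(A) = T(𝔊), and this group is isomorphic to k*. -/

import Mathlib

open MvPolynomial

set_option synthInstance.maxHeartbeats 400000
set_option maxHeartbeats 1000000

noncomputable section

/-- The grading weights `(3, 2, 1)` for the variables `x = X 0`, `y = X 1`, `z = X 2`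
of `R = k[x,y,z]`. -/
def w3 : Fin 3 → ℕ := ![3, 2, 1]

/-- `S` is a regular local ring: a Noetherian local ring whose maximal ideal (equivalently,
its Jacobson radical) can be generated by Krull-dimension many elements. -/
def IsRegLocalRing (S : Type*) [CommRing S] : Prop :=
  IsNoetherianRing S ∧ IsLocalRing S ∧
    ∃ s : Finset S, Ideal.span (s : Set S) = (⊥ : Ideal S).jacobson ∧
      (s.card : WithBot (WithTop ℕ)) = ringKrullDim S

/-- The scheme `Proj ℬ` has at least two singular points, i.e. two distinct points whose
local rings (the stalks of the structure sheaf) are not regular local rings. -/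
def ProjHasTwoSingularPoints (k : Type) [Field k] {A : Type} [CommRing A] [Algebra k A]
    (ℬ : ℕ → Submodule k A) [GradedAlgebra ℬ] : Prop :=
  ∃ x y : AlgebraicGeometry.Proj ℬ, x ≠ y ∧
    ¬ IsRegLocalRing ((AlgebraicGeometry.Proj ℬ).presheaf.stalk x) ∧
    ¬ IsRegLocalRing ((AlgebraicGeometry.Proj ℬ).presheaf.stalk y)

/-- Condition (C2): the projective curve `Proj (R/fR)` has at least two singular points.
Here the grading on `R/fR` is the (unique) `ℕ`-grading `ℬ` induced by the weighted grading of
`R = k[x,y,z]` with weights `(3,2,1)` via the quotient map. -/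
def CondC2 (k : Type) [Field k] (f : MvPolynomial (Fin 3) k) : Prop :=
  ∃ (ℬ : ℕ → Submodule k (MvPolynomial (Fin 3) k ⧸ Ideal.span {f}))
    (inst : GradedAlgebra ℬ),
    (∀ (i : ℕ) (r : MvPolynomial (Fin 3) k), r.IsWeightedHomogeneous w3 i →
      Ideal.Quotient.mk (Ideal.span {f}) r ∈ ℬ i) ∧
    @ProjHasTwoSingularPoints k _ _ _ _ ℬ inst

/-- Conditions (C3) and (C4): `f(x,y,0) = x (p x² + q y³)` with `p, q ∈ k*`, and
`f_z(x,y,0) = y (r x² + s y³)` with `r, s ∈ k` such that `det (3p r; q s) = 3ps - qr ≠ 0`. -/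
def CondC3C4 (k : Type) [Field k] (f : MvPolynomial (Fin 3) k) : Prop :=
  ∃ p q r s : k, p ≠ 0 ∧ q ≠ 0 ∧
    aeval ![X 0, X 1, 0] f = X 0 * (C p * X 0 ^ 2 + C q * X 1 ^ 3) ∧
    aeval ![X 0, X 1, 0] (pderiv 2 f) = X 1 * (C r * X 0 ^ 2 + C s * X 1 ^ 3) ∧
    3 * p * s - q * r ≠ 0

/-- The ideal `(Wⁿ + f)` of `R[W] = k[x,y,z,W]`, where the polynomial ring `R[W]` in one
variable `W = X 3` over `R = k[x,y,z]` is modelled as `MvPolynomial (Fin 4) k`. -/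
abbrev relIdealPlus (k : Type) [Field k] (f : MvPolynomial (Fin 3) k) (n : ℕ) :
    Ideal (MvPolynomial (Fin 4) k) :=
  Ideal.span {(X 3 : MvPolynomial (Fin 4) k) ^ n + rename Fin.castSucc f}

/-- The ring `R[W]/(Wⁿ + f)`. -/
abbrev QuotRingPlus (k : Type) [Field k] (f : MvPolynomial (Fin 3) k) (n : ℕ) : Type :=
  MvPolynomial (Fin 4) k ⧸ relIdealPlus k f n

/-- The images of the generators `x, y, z, w` in `R[W]/(Wⁿ + f)`. -/
def genPlus (k : Type) [Field k] (f : MvPolynomial (Fin 3) k) (n : ℕ) (i : Fin 4) :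
    QuotRingPlus k f n :=
  Ideal.Quotient.mk (relIdealPlus k f n) (X i)

/-- `α` belongs to the subtorus `T(𝔊)` of `Aut_k(A)` determined by the `ℕ`-grading `𝔊` of
`A = R[W]/(Wⁿ + f)` in which `x ∈ A_{3n}`, `y ∈ A_{2n}`, `z ∈ A_n`, `w ∈ A_9`:
`α` acts on the homogeneous generators by `t^{deg}` for some `t ∈ k*`. -/
def InTorusPlus (k : Type) [Field k] (f : MvPolynomial (Fin 3) k) (n : ℕ)
    (α : QuotRingPlus k f n ≃ₐ[k] QuotRingPlus k f n) : Prop :=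
  ∃ t : kˣ,
    α (genPlus k f n 0) = (t : k) ^ (3 * n) • genPlus k f n 0 ∧
    α (genPlus k f n 1) = (t : k) ^ (2 * n) • genPlus k f n 1 ∧
    α (genPlus k f n 2) = (t : k) ^ n • genPlus k f n 2 ∧
    α (genPlus k f n 3) = (t : k) ^ 9 • genPlus k f n 3


set_option linter.all false
set_option linter.unusedSimpArgs false
set_option linter.unusedSectionVars false


/-- Locally nilpotent derivation. -/
def IsLND {k A : Type} [Field k] [CommRing A] [Algebra k A] (D : Derivation k A A) : Prop :=
  ∀ a, ∃ N : ℕ, D^[N] a = 0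

section LND
variable {k A : Type} [Field k] [CharZero k] [CommRing A] [Algebra k A] (D : Derivation k A A)

lemma iter_add (N : ℕ) (a b : A) : D^[N] (a + b) = D^[N] a + D^[N] b := by
  induction N generalizing a b with
  | zero => rfl
  | succ N ih => simp [ih]

lemma iter_smul (N : ℕ) (c : k) (a : A) : D^[N] (c • a) = c • D^[N] a := by
  induction N generalizing a with
  | zero => rfl
  | succ N ih => simp [ih]

lemma iter_zero (N : ℕ) : D^[N] (0 : A) = 0 := by
  induction N with
  | zero => rfl
  | succ N ih => simp [ih]

lemma iter_zero_of_le {N M : ℕ} {a : A} (h : D^[N] a = 0) (hNM : N ≤ M) : D^[M] a = 0 := by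
  obtain ⟨c, rfl⟩ := Nat.exists_eq_add_of_le' hNM
  rw [Function.iterate_add_apply, h, iter_zero]

lemma iter_mul (N : ℕ) (a b : A) : D^[N] (a * b) =
    ∑ ij ∈ Finset.HasAntidiagonal.antidiagonal N, N.choose ij.1 • (D^[ij.1] a * D^[ij.2] b) := by
  induction N with
  | zero => simp
  | succ N ih =>
    rw [Finset.sum_antidiagonal_choose_succ_nsmul (M := A) (fun i j => D^[i] a * D^[j] b) N]
    rw [Function.iterate_succ_apply', ih, map_sum, ← Finset.sum_add_distrib]
    refine Finset.sum_congr rfl fun ij hij => ?_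
    have h2 : N.choose ij.2 = N.choose ij.1 := by
      rw [← Nat.choose_symm_of_eq_add (Finset.HasAntidiagonal.mem_antidiagonal.1 hij).symm]
    simp only [Function.iterate_succ_apply', map_nsmul, Derivation.leibniz, smul_eq_mul, h2, smul_add]
    congr 2
    ring

/-- exponential map. -/
def expPoly (hD : IsLND D) (a : A) : Polynomial A :=
  ∑ i ∈ Finset.range (Classical.choose (hD a)), Polynomial.monomial i ((i.factorial : k)⁻¹ • D^[i] a)

lemma coeff_expPoly (hD : IsLND D) (a : A) (i : ℕ) :
    (expPoly D hD a).coeff i = (i.factorial : k)⁻¹ • D^[i] a := by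
  unfold expPoly
  simp only [Polynomial.finsetSum_coeff, Polynomial.coeff_monomial]
  rw [Finset.sum_ite_eq']
  split_ifs with h
  · rfl
  · rw [iter_zero_of_le D (Classical.choose_spec (hD a)) (by simpa using h), smul_zero]

/-- exponential ring hom. -/
def expHom (hD : IsLND D) : A →+* Polynomial A where
  toFun := expPoly D hD
  map_zero' := by ext i; simp [coeff_expPoly, iter_zero]
  map_one' := by
    ext i; rw [coeff_expPoly]
    cases i with
    | zero => simp
    | succ i => simp [iter_zero, Polynomial.coeff_one]
  map_add' a b := by ext i; simp [coeff_expPoly, iter_add]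
  map_mul' a b := by
    ext i
    rw [coeff_expPoly, Polynomial.coeff_mul, iter_mul, Finset.smul_sum]
    refine Finset.sum_congr rfl fun ij hij => ?_
    rw [coeff_expPoly, coeff_expPoly, smul_mul_smul_comm, ← Nat.cast_smul_eq_nsmul k, smul_smul]
    congr 1
    rw [Finset.HasAntidiagonal.mem_antidiagonal] at hij
    have h := Nat.add_choose_mul_factorial_mul_factorial ij.1 ij.2
    rw [hij] at h
    rw [← Nat.choose_symm_of_eq_add hij.symm] at h
    have h1 : (ij.1.factorial : k) ≠ 0 := by exact_mod_cast ij.1.factorial_ne_zero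
    have h2 : (ij.2.factorial : k) ≠ 0 := by exact_mod_cast ij.2.factorial_ne_zero
    have h3 : (i.factorial : k) ≠ 0 := by exact_mod_cast i.factorial_ne_zero
    field_simp
    exact_mod_cast h

lemma coeff_expHom (hD : IsLND D) (a : A) (i : ℕ) :
    (expHom D hD a).coeff i = (i.factorial : k)⁻¹ • D^[i] a := coeff_expPoly D hD a i

lemma expHom_injective (hD : IsLND D) : Function.Injective (expHom D hD) := by
  intro a b h
  have := congrArg (fun p => Polynomial.coeff p 0) h
  simpa [coeff_expHom] using this

/-- degree with respect to a locally nilpotent derivation -/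
def ldeg (hD : IsLND D) (a : A) : ℕ := (expHom D hD a).natDegree

lemma iter_eq_zero_of_ldeg_lt (hD : IsLND D) {a : A} {i : ℕ} (h : ldeg D hD a < i) :
    D^[i] a = 0 := by
  have := Polynomial.coeff_eq_zero_of_natDegree_lt h
  rw [coeff_expHom] at this
  exact (smul_eq_zero_iff_right (by simp [Nat.factorial_ne_zero])).1 this

lemma ldeg_eq_zero_iff (hD : IsLND D) (a : A) : ldeg D hD a = 0 ↔ D a = 0 := by
  constructor
  · intro h
    exact iter_eq_zero_of_ldeg_lt D hD (i := 1) (by omega)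
  · intro h
    unfold ldeg
    rw [Polynomial.natDegree_eq_zero_iff_degree_le_zero, Polynomial.degree_le_zero_iff]
    ext i
    rw [coeff_expHom, Polynomial.coeff_C]
    cases i with
    | zero => simp [coeff_expHom]
    | succ i => simp [h, iter_zero]

lemma ldeg_apply (hD : IsLND D) (a : A) (h : D a ≠ 0) : ldeg D hD a = ldeg D hD (D a) + 1 := by
  have key : ∀ i, D^[i] (D a) = D^[i+1] a := fun i => rfl
  have h0 : ldeg D hD a ≠ 0 := by rwa [Ne, ldeg_eq_zero_iff]
  apply le_antisymm
  · apply Polynomial.natDegree_le_iff_coeff_eq_zero.2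
    intro N hN
    rw [coeff_expHom]
    obtain ⟨M, rfl⟩ : ∃ M, N = M + 1 := ⟨N - 1, by omega⟩
    rw [← key, iter_eq_zero_of_ldeg_lt D hD (by omega), smul_zero]
  · have : ldeg D hD (D a) ≤ ldeg D hD a - 1 := by
      apply Polynomial.natDegree_le_iff_coeff_eq_zero.2
      intro N hN
      rw [coeff_expHom, key, iter_eq_zero_of_ldeg_lt D hD (by omega), smul_zero]
    omega

variable [IsDomain A]

lemma ldeg_mul (hD : IsLND D) {a b : A} (ha : a ≠ 0) (hb : b ≠ 0) :
    ldeg D hD (a * b) = ldeg D hD a + ldeg D hD b := by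
  unfold ldeg
  rw [map_mul, Polynomial.natDegree_mul]
  · exact (map_ne_zero_iff _ (expHom_injective D hD)).2 ha
  · exact (map_ne_zero_iff _ (expHom_injective D hD)).2 hb

lemma ldeg_pow (hD : IsLND D) (a : A) (n : ℕ) :
    ldeg D hD (a ^ n) = n * ldeg D hD a := by
  unfold ldeg
  rw [map_pow, Polynomial.natDegree_pow]

/-- factorially closed kernel -/
lemma ker_of_mul (hD : IsLND D) {a b : A} (hab : a * b ≠ 0) (h : D (a * b) = 0) : D a = 0 := by
  rw [← ldeg_eq_zero_iff D hD] at h ⊢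
  rw [ldeg_mul D hD (left_ne_zero_of_mul hab) (right_ne_zero_of_mul hab)] at h
  omega

lemma ker_of_dvd_self (hD : IsLND D) {a : A} (h : a ∣ D a) : D a = 0 := by
  by_contra h0
  obtain ⟨b, hb⟩ := h
  have h1 := ldeg_apply D hD a h0
  rw [hb] at h0 h1
  rw [ldeg_mul D hD (left_ne_zero_of_mul h0) (right_ne_zero_of_mul h0)] at h1
  omega

end LND



section P2
variable {k : Type} [Field k]

/-- integer weights -/
def u3 : Fin 3 → ℤ := ![3, 2, 1]

/-- weighted homogeneous of integer degree -/
abbrev WH (r : MvPolynomial (Fin 3) k) (N : ℤ) : Prop := IsWeightedHomogeneous u3 r N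

lemma weight_u3 (d : Fin 3 →₀ ℕ) : Finsupp.weight u3 d = 3 * d 0 + 2 * d 1 + d 2 := by
  rw [Finsupp.weight_apply, Finsupp.sum_fintype _ _ (by simp)]
  simp [Fin.sum_univ_three, u3]; ring

lemma weight_w3 (d : Fin 3 →₀ ℕ) : Finsupp.weight w3 d = 3 * d 0 + 2 * d 1 + d 2 := by
  rw [Finsupp.weight_apply, Finsupp.sum_fintype _ _ (by simp)]
  simp [Fin.sum_univ_three, w3]; ring

lemma weight_cast (d : Fin 3 →₀ ℕ) : Finsupp.weight u3 d = ((Finsupp.weight w3 d : ℕ) : ℤ) := by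
  rw [weight_u3, weight_w3]; push_cast; ring

lemma wh_of_nat {r : MvPolynomial (Fin 3) k} {N : ℕ} :
    IsWeightedHomogeneous w3 r N ↔ WH r (N : ℤ) := by
  constructor
  · intro h d hd
    rw [weight_cast, h hd]
  · intro h d hd
    have := h hd
    rw [weight_cast] at this
    exact_mod_cast this

lemma WH.eq_zero_of_neg {r : MvPolynomial (Fin 3) k} {N : ℤ} (h : WH r N) (hN : N < 0) : r = 0 := by
  by_contra hr
  obtain ⟨d, hd⟩ := MvPolynomial.ne_zero_iff.1 hr
  have := h hd
  rw [weight_cast] at this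
  omega

lemma WH.nonneg {r : MvPolynomial (Fin 3) k} {N : ℤ} (h : WH r N) (hr : r ≠ 0) : 0 ≤ N := by
  by_contra h'
  exact hr (h.eq_zero_of_neg (by omega))

lemma WH.exists_C {r : MvPolynomial (Fin 3) k} (h : WH r 0) : ∃ c, r = C c := by
  refine ⟨coeff 0 r, ?_⟩
  ext d
  rw [coeff_C]
  split_ifs with hd
  · rw [hd]
  · by_contra hc
    have := h hc
    rw [weight_u3] at this
    apply hd
    ext i; fin_cases i <;> simp <;> omega

/-- grading hom -/
def gradHom : MvPolynomial (Fin 3) k →ₐ[k] Polynomial (MvPolynomial (Fin 3) k) :=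
  aeval (fun i => Polynomial.monomial (w3 i) (X i))

lemma gradHom_monomial (d : Fin 3 →₀ ℕ) (c : k) :
    gradHom (monomial d c) = Polynomial.monomial (Finsupp.weight w3 d) (monomial d c) := by
  rw [gradHom, aeval_monomial, Finsupp.prod_fintype _ _ (by simp), weight_w3, monomial_eq,
    Finsupp.prod_fintype _ _ (by simp)]
  simp only [Fin.prod_univ_three, Polynomial.monomial_pow, w3, Polynomial.algebraMap_apply, MvPolynomial.algebraMap_eq]
  rw [Polynomial.monomial_mul_monomial, Polynomial.monomial_mul_monomial, Polynomial.C_mul_monomial]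
  congr 1
  simp [mul_comm]

lemma WH.gradHom_eq {r : MvPolynomial (Fin 3) k} {N : ℕ} (h : WH r (N : ℤ)) :
    gradHom r = Polynomial.monomial N r := by
  have h1 : gradHom r = ∑ d ∈ r.support, gradHom (monomial d (coeff d r)) := by
    conv_lhs => rw [MvPolynomial.as_sum r]
    rw [map_sum]
  rw [h1]
  conv_rhs => rw [MvPolynomial.as_sum r]
  rw [map_sum]
  refine Finset.sum_congr rfl fun d hd => ?_
  rw [gradHom_monomial, (wh_of_nat.2 h) (MvPolynomial.mem_support_iff.1 hd)]

lemma wh_of_gradHom {r : MvPolynomial (Fin 3) k} {N : ℕ} (s : MvPolynomial (Fin 3) k)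
    (h : gradHom r = Polynomial.monomial N s) : WH r (N : ℤ) := by
  rw [← wh_of_nat]
  intro d hd
  by_contra hne
  have h1 : gradHom r = ∑ d ∈ r.support, gradHom (monomial d (coeff d r)) := by
    conv_lhs => rw [MvPolynomial.as_sum r]
    rw [map_sum]
  have h2 : (gradHom r).coeff (Finsupp.weight w3 d) = 0 := by
    rw [h, Polynomial.coeff_monomial, if_neg (Ne.symm hne)]
  rw [h1, Polynomial.finsetSum_coeff] at h2
  have h3 := congrArg (coeff d) h2
  rw [coeff_sum, Finset.sum_eq_single d] at h3
  · rw [gradHom_monomial, Polynomial.coeff_monomial, if_pos rfl] at h3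
    simp at h3; exact hd h3
  · intro b hb hbd
    rw [gradHom_monomial, Polynomial.coeff_monomial]
    split_ifs
    · rw [coeff_monomial, if_neg hbd]
    · simp
  · intro h'; exact absurd (MvPolynomial.mem_support_iff.2 hd) h'

lemma WH.factor {a b : MvPolynomial (Fin 3) k} {N : ℤ} (h : WH (a * b) N) (hab : a * b ≠ 0) :
    ∃ M : ℕ, WH a (M : ℤ) := by
  obtain ⟨N, rfl⟩ := Int.eq_ofNat_of_zero_le (h.nonneg hab)
  have h1 := h.gradHom_eq
  have ha : a ≠ 0 := left_ne_zero_of_mul hab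
  have hb : b ≠ 0 := right_ne_zero_of_mul hab
  have hinj : ∀ c : MvPolynomial (Fin 3) k, c ≠ 0 → gradHom c ≠ 0 := by
    intro c hc h0
    have := wh_of_gradHom (N := 0) 0 (by simpa using h0)
    have h2 := wh_of_gradHom (N := 1) 0 (by simpa using h0)
    have := IsWeightedHomogeneous.inj_right hc this h2
    simp at this
  have hA := hinj a ha
  have hB := hinj b hb
  rw [map_mul] at h1
  have e1 := congrArg Polynomial.natDegree h1
  have e2 := congrArg Polynomial.natTrailingDegree h1
  rw [Polynomial.natDegree_mul hA hB, Polynomial.natDegree_monomial_eq _ hab] at e1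
  rw [Polynomial.natTrailingDegree_mul hA hB, Polynomial.natTrailingDegree_monomial hab] at e2
  have i1 := Polynomial.natTrailingDegree_le_natDegree (gradHom a)
  have i2 := Polynomial.natTrailingDegree_le_natDegree (gradHom b)
  refine ⟨(gradHom a).natDegree, wh_of_gradHom ((gradHom a).coeff (gradHom a).natDegree) ?_⟩
  ext1 i
  rw [Polynomial.coeff_monomial]
  split_ifs with hi
  · rw [hi]
  · rcases lt_or_gt_of_ne hi with hi | hi
    · exact Polynomial.coeff_eq_zero_of_natDegree_lt hi
    · exact Polynomial.coeff_eq_zero_of_lt_natTrailingDegree (by omega)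

lemma WH.of_dvd {a b : MvPolynomial (Fin 3) k} {N : ℤ} (h : WH b N) (hb : b ≠ 0) (hd : a ∣ b) :
    ∃ M : ℕ, WH a (M : ℤ) := by
  obtain ⟨c, rfl⟩ := hd
  exact h.factor hb

lemma wh_X0 : WH (X 0 : MvPolynomial (Fin 3) k) 3 := isWeightedHomogeneous_X k u3 0
lemma wh_X1 : WH (X 1 : MvPolynomial (Fin 3) k) 2 := isWeightedHomogeneous_X k u3 1
lemma wh_X2 : WH (X 2 : MvPolynomial (Fin 3) k) 1 := isWeightedHomogeneous_X k u3 2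

lemma WH.smul {r : MvPolynomial (Fin 3) k} {N : ℤ} (h : WH r N) (c : k) : WH (c • r) N := by
  rw [MvPolynomial.smul_eq_C_mul]; exact h.C_mul c

lemma WH.pow' {r : MvPolynomial (Fin 3) k} {N : ℤ} (h : WH r N) (m : ℕ) : WH (r ^ m) (m * N) := by
  have := IsWeightedHomogeneous.pow h m
  rwa [nsmul_eq_mul] at this

lemma WH.cast {r : MvPolynomial (Fin 3) k} {N M : ℤ} (h : WH r N) (e : N = M) : WH r M := e ▸ h

/-- homogeneous component -/
abbrev hcmp (N : ℕ) (r : MvPolynomial (Fin 3) k) : MvPolynomial (Fin 3) k :=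
  weightedHomogeneousComponent w3 N r

lemma wh_cmp (N : ℕ) (r : MvPolynomial (Fin 3) k) : WH (hcmp N r) (N : ℤ) :=
  wh_of_nat.1 (weightedHomogeneousComponent_isWeightedHomogeneous N r)

lemma cmp_dvd {g r : MvPolynomial (Fin 3) k} {M : ℕ} (hg : WH g (M : ℤ)) (h : g ∣ r) (N : ℕ) :
    g ∣ hcmp N r := by
  letI := weightedGradedAlgebra k w3
  have hI : (Ideal.span {g}).IsHomogeneous (weightedHomogeneousSubmodule k w3) := by
    apply Ideal.homogeneous_span
    rintro x hx
    rw [Set.mem_singleton_iff.1 hx]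
    exact ⟨M, wh_of_nat.2 hg⟩
  have := weightedHomogeneousComponent_mem_of_mem k w3 hI (Ideal.mem_span_singleton.2 h) N
  exact Ideal.mem_span_singleton.1 this

lemma eval_scale {r : MvPolynomial (Fin 3) k} {N : ℕ} (h : WH r (N : ℤ)) (a b c t : k) :
    eval ![a * t ^ 3, b * t ^ 2, c * t] r = t ^ N * eval ![a, b, c] r := by
  rw [eval_eq', eval_eq', Finset.mul_sum]
  refine Finset.sum_congr rfl fun d hd => ?_
  have := (wh_of_nat.2 h) (MvPolynomial.mem_support_iff.1 hd)
  rw [← this, weight_w3]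
  simp [Fin.prod_univ_three]
  ring

lemma WH.pderiv' {r : MvPolynomial (Fin 3) k} {N : ℤ} (h : WH r N) (i : Fin 3) :
    WH (pderiv i r) (N - u3 i) := by
  exact IsWeightedHomogeneous.pderiv h (by ring)

end P2



section P3
variable {k : Type} [Field k]

/-- evaluation hom S[T] → R extending θ -/
lemma ext_E1 [CharZero k] {S R : Type} [CommRing S] [IsDomain S] [Algebra k S] [CommRing R] [Algebra k R]
    (δ : Derivation k R R) (I : Ideal R) [I.IsPrime] (hI : ∀ a ∈ I, δ a ∈ I)
    (θ : S →ₐ[k] R) (h1 : ∀ s, θ s ∈ I → s = 0) (h2 : ∀ s, δ (θ s) ∈ I)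
    (b : R) (hb : δ b ∉ I) :
    ∀ P : Polynomial S, Polynomial.eval₂ θ.toRingHom b P ∈ I → P = 0 := by
  haveI : CharZero S := charZero_of_injective_algebraMap (algebraMap k S).injective
  have key : ∀ P : Polynomial S, δ (Polynomial.eval₂ θ.toRingHom b P)
      - Polynomial.eval₂ θ.toRingHom b (Polynomial.derivative P) * δ b ∈ I := by
    intro P
    induction P using Polynomial.induction_on' with
    | add p q hp hq =>
      have := I.add_mem hp hq
      convert this using 1
      simp only [Polynomial.eval₂_add, map_add]
      ring
    | monomial n a =>
      have := I.mul_mem_left (b ^ n) (h2 a)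
      convert this using 1
      rw [Polynomial.derivative_monomial, Polynomial.eval₂_monomial, Polynomial.eval₂_monomial]
      simp [Derivation.leibniz, Derivation.leibniz_pow]
      ring
  intro P
  induction hn : P.natDegree using Nat.strong_induction_on generalizing P with
  | _ n ih =>
    intro hP
    have h3 := key P
    have h4 : Polynomial.eval₂ θ.toRingHom b (Polynomial.derivative P) * δ b ∈ I := by
      have := I.sub_mem (hI _ hP) h3
      simpa using this
    have h5 := (Ideal.IsPrime.mem_or_mem ‹_› h4).resolve_right hb
    have h6 : Polynomial.natDegree P = 0 := by
      by_contra hne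
      have h7 := ih _ (by rw [← hn]; exact Polynomial.natDegree_derivative_lt hne) _ rfl h5
      exact hne (Polynomial.natDegree_eq_zero_of_derivative_eq_zero h7)
    rw [Polynomial.eq_C_of_natDegree_eq_zero h6] at hP ⊢
    rw [Polynomial.eval₂_C] at hP
    rw [h1 _ hP, Polynomial.C_0]

lemma ext_E2 {S R : Type} [CommRing S] [IsDomain S] [Algebra k S] [CommRing R] [IsDomain R] [Algebra k R]
    (g : R) (hg : g ≠ 0)
    (θ : S →ₐ[k] R) (h1 : ∀ s, g ∣ θ s → s = 0) :
    ∀ P : Polynomial S, Polynomial.eval₂ θ.toRingHom g P = 0 → P = 0 := by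
  intro P
  induction hn : P.natDegree using Nat.strong_induction_on generalizing P with
  | _ n ih =>
    intro hP
    have e := Polynomial.divX_mul_X_add P
    rw [← e, Polynomial.eval₂_add, Polynomial.eval₂_mul, Polynomial.eval₂_X, Polynomial.eval₂_C] at hP
    have h2 : P.coeff 0 = 0 := by
      apply h1
      exact ⟨- Polynomial.eval₂ θ.toRingHom g P.divX, by
        have : θ (P.coeff 0) = θ.toRingHom (P.coeff 0) := rfl
        rw [this]; linear_combination hP⟩
    rw [h2, map_zero, add_zero] at hP
    have h3 := (mul_eq_zero.1 hP).resolve_right hg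
    rw [h2, map_zero, add_zero] at e
    rcases Nat.eq_zero_or_pos n with h0 | h0
    · rw [h0] at hn
      rw [Polynomial.eq_C_of_natDegree_eq_zero hn, h2, Polynomial.C_0]
    · have := ih _ (by rw [Polynomial.natDegree_divX_eq_natDegree_tsub_one]; omega) P.divX rfl h3
      rw [← e, this, zero_mul]

lemma trdeg_contra {S : Type} [CommRing S] [Algebra k S]
    (e : S ≃ₐ[k] MvPolynomial (Fin 4) k) (φ : S →ₐ[k] MvPolynomial (Fin 3) k)
    (h : Function.Injective φ) : False := by
  have h1 := trdeg_le_of_injective (φ.comp e.symm.toAlgHom) (h.comp e.symm.injective)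
  rw [MvPolynomial.trdeg_of_isDomain, MvPolynomial.trdeg_of_isDomain] at h1
  simp at h1
  have h2 : ((4 : ℕ) : Cardinal) ≤ ((3 : ℕ) : Cardinal) := by simpa using h1
  have := Nat.cast_le.1 h2
  omega

lemma binary_form [IsAlgClosed k] {R : Type} [CommRing R] [Algebra k R] (I : Ideal R) [I.IsPrime]
    (H1 H2 : R) (h2 : H2 ∉ I) (h : ∀ c : k, H1 - c • H2 ∉ I) :
    ∀ (n m : ℕ) (p : Polynomial k), p.natDegree = n → n ≤ m → aeval ![H1, H2] (p.homogenize m) ∈ I → p = 0 := by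
  intro n
  induction n with
  | zero =>
    intro m p hp _ hI
    rw [Polynomial.eq_C_of_natDegree_eq_zero hp] at hI ⊢
    rw [Polynomial.homogenize_C] at hI
    simp at hI
    by_contra hne
    have hc : p.coeff 0 ≠ 0 := fun h => hne (by rw [h, Polynomial.C_0])
    rcases Ideal.IsPrime.mem_or_mem ‹_› hI with h' | h'
    · apply ‹I.IsPrime›.ne_top
      apply Ideal.eq_top_of_isUnit_mem _ h'
      exact (IsUnit.mk0 _ hc).map (algebraMap k R)
    · exact h2 (Ideal.IsPrime.mem_of_pow_mem ‹_› _ h')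
  | succ n ih =>
    intro m p hp hm hI
    obtain ⟨r, hr⟩ := IsAlgClosed.exists_root p (by
      intro h0
      have := Polynomial.natDegree_eq_zero_iff_degree_le_zero.2 h0.le
      omega)
    obtain ⟨q, rfl⟩ := Polynomial.dvd_iff_isRoot.2 hr
    have hq : q ≠ 0 := by rintro rfl; simp at hp
    rw [Polynomial.natDegree_mul (Polynomial.X_sub_C_ne_zero r) hq, Polynomial.natDegree_X_sub_C] at hp
    obtain ⟨m, rfl⟩ : ∃ m', m = 1 + m' := ⟨m - 1, by omega⟩
    rw [Polynomial.homogenize_mul _ _ (by simp) (by omega), map_mul] at hI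
    rcases Ideal.IsPrime.mem_or_mem ‹_› hI with h' | h'
    · exfalso
      apply h r
      rw [Polynomial.homogenize_sub, Polynomial.homogenize_X one_ne_zero, Polynomial.homogenize_C] at h'
      simpa [Algebra.smul_def] using h'
    · rw [ih m q (by omega) (by omega) h', mul_zero]

lemma wh_aeval2 {H1 H2 : MvPolynomial (Fin 3) k} {D : ℕ} (w1 : WH H1 (D : ℤ)) (w2 : WH H2 (D : ℤ))
    (φ : MvPolynomial (Fin 2) k) (m : ℕ) (hφ : φ.IsHomogeneous m) : WH (aeval ![H1, H2] φ) ((m * D : ℕ) : ℤ) := by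
  rw [aeval_def, eval₂_eq']
  apply IsWeightedHomogeneous.sum
  intro d hd
  have hd' := hφ (MvPolynomial.mem_support_iff.1 hd)
  have e : d 0 + d 1 = m := by
    rw [← hd', Finsupp.weight_apply, Finsupp.sum_fintype _ _ (by simp)]
    simp
  simp only [Fin.prod_univ_two, MvPolynomial.algebraMap_eq]
  apply IsWeightedHomogeneous.C_mul
  refine WH.cast ((w1.pow' (d 0)).mul (w2.pow' (d 1))) ?_
  rw [← e]; push_cast; ring

lemma algindep_mod [IsAlgClosed k] {g H1 H2 : MvPolynomial (Fin 3) k} {D G : ℕ} (hD : 0 < D) (hg : Prime g)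
    (wg : WH g (G : ℤ)) (w1 : WH H1 (D : ℤ)) (w2 : WH H2 (D : ℤ)) (h2 : ¬ g ∣ H2)
    (h : ∀ c : k, ¬ g ∣ H1 - c • H2) (φ : MvPolynomial (Fin 2) k) (hφ : g ∣ aeval ![H1, H2] φ) : φ = 0 := by
  haveI : (Ideal.span {g}).IsPrime := (Ideal.span_singleton_prime hg.ne_zero).2 hg
  have hom : ∀ m, ∀ φ : MvPolynomial (Fin 2) k, φ.IsHomogeneous m → g ∣ aeval ![H1, H2] φ → φ = 0 := by
    intro m φ hm hd
    have e := Polynomial.homogenize_eq_of_isHomogeneous hm rfl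
    have h1 := binary_form (Ideal.span {g}) H1 H2 (by rwa [Ideal.mem_span_singleton])
      (by intro c; rw [Ideal.mem_span_singleton]; exact h c) _ m
      (aeval ![Polynomial.X, 1] φ) rfl (by
        have := MvPolynomial.aeval_natDegree_le (m := m) φ hm.totalDegree_le ![Polynomial.X, 1]
          (n := 1) (by intro i; fin_cases i <;> simp)
        simpa using this) (by rw [Ideal.mem_span_singleton, e]; exact hd)
    rw [← e, h1, Polynomial.homogenize_zero]
  have hall : ∀ m, homogeneousComponent m φ = 0 := by
    intro m
    apply hom m _ (homogeneousComponent_isHomogeneous m φ)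
    have h3 := cmp_dvd wg hφ (m * D)
    convert h3 using 1
    conv_rhs => rw [← sum_homogeneousComponent φ, map_sum, hcmp, map_sum]
    have h4 : ∀ i, weightedHomogeneousComponent w3 (m * D) (aeval ![H1, H2] (homogeneousComponent i φ)) =
        if i = m then (aeval ![H1, H2] (homogeneousComponent i φ)) else 0 := by
      intro i
      have := wh_of_nat.2 (wh_aeval2 w1 w2 _ _ (homogeneousComponent_isHomogeneous i φ))
      split_ifs with him
      · subst him
        exact this.weightedHomogeneousComponent_same
      · apply this.weightedHomogeneousComponent_ne
        intro h'
        exact him (Nat.eq_of_mul_eq_mul_right hD h'.symm)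
    simp only [h4]
    rw [Finset.sum_ite_eq']
    split_ifs with hm
    · rfl
    · rw [homogeneousComponent_eq_zero _ _ (by simpa using hm), map_zero]
  rw [← sum_homogeneousComponent φ]
  exact Finset.sum_eq_zero fun i _ => hall i

lemma lemmaT [IsAlgClosed k] [CharZero k] (δ : Derivation k (MvPolynomial (Fin 3) k) (MvPolynomial (Fin 3) k))
    {g h1 h2 b : MvPolynomial (Fin 3) k} {G d1 d2 : ℕ} (hg : Prime g) (wg : WH g (G : ℤ)) (hδg : g ∣ δ g)
    (hb : ¬ g ∣ δ b) (w1 : WH h1 (d1 : ℤ)) (w2 : WH h2 (d2 : ℤ)) (hd1 : 0 < d1) (hd2 : 0 < d2)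
    (n1 : ¬ g ∣ h1) (n2 : ¬ g ∣ h2) (k1 : g ∣ δ h1) (k2 : g ∣ δ h2) :
    ∃ c : k, c ≠ 0 ∧ g ∣ h1 ^ d2 - c • h2 ^ d1 := by
  haveI : (Ideal.span {g}).IsPrime := (Ideal.span_singleton_prime hg.ne_zero).2 hg
  have main : ∃ c : k, g ∣ h1 ^ d2 - c • h2 ^ d1 := by
    by_contra hcon
    push Not at hcon
    have hI : ∀ a ∈ Ideal.span {g}, δ a ∈ Ideal.span {g} := by
      intro a ha
      rw [Ideal.mem_span_singleton] at ha ⊢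
      obtain ⟨c, rfl⟩ := ha
      rw [Derivation.leibniz, smul_eq_mul, smul_eq_mul]
      exact dvd_add (Dvd.intro _ rfl) (hδg.mul_left _)
    have A1 := algindep_mod (D := d1 * d2) (Nat.mul_pos hd1 hd2) hg wg
      ((w1.pow' d2).cast (by push_cast; ring)) ((w2.pow' d1).cast (by push_cast; ring))
      (fun h => n2 (hg.dvd_of_dvd_pow h)) hcon
    have hδpow : ∀ (h : MvPolynomial (Fin 3) k) (m : ℕ), g ∣ δ h → g ∣ δ (h ^ m) := by
      intro h m hh
      rw [Derivation.leibniz_pow, nsmul_eq_mul, smul_eq_mul]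
      exact (hh.mul_left _).mul_left _
    have A2 := ext_E1 δ (Ideal.span {g}) hI (aeval ![h1 ^ d2, h2 ^ d1]) (by
        intro s hs; exact A1 s (Ideal.mem_span_singleton.1 hs)) (by
        intro s
        rw [Ideal.mem_span_singleton]
        induction s using MvPolynomial.induction_on with
        | C a => simp
        | add p q hp hq => rw [map_add, map_add]; exact dvd_add hp hq
        | mul_X p i hp =>
          rw [map_mul, Derivation.leibniz, smul_eq_mul, smul_eq_mul]
          refine dvd_add (Dvd.dvd.mul_left ?_ _) (hp.mul_left _)
          rw [aeval_X]
          fin_cases i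
          · exact hδpow _ _ k1
          · exact hδpow _ _ k2) b (by rwa [Ideal.mem_span_singleton])
    let θ3 : Polynomial (MvPolynomial (Fin 2) k) →ₐ[k] MvPolynomial (Fin 3) k :=
      { Polynomial.eval₂RingHom (aeval ![h1 ^ d2, h2 ^ d1] : MvPolynomial (Fin 2) k →ₐ[k] _).toRingHom b with
        commutes' := by
          intro r
          simp [Polynomial.algebraMap_apply, MvPolynomial.algebraMap_eq, ← MvPolynomial.algebraMap_eq] }
    have A3 := ext_E2 g hg.ne_zero θ3 (by
      intro s hs
      exact A2 s (Ideal.mem_span_singleton.2 hs))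
    let θ4 : Polynomial (Polynomial (MvPolynomial (Fin 2) k)) →ₐ[k] MvPolynomial (Fin 3) k :=
      { Polynomial.eval₂RingHom θ3.toRingHom g with
        commutes' := by
          intro r
          have : θ3 (algebraMap k _ r) = algebraMap k _ r := θ3.commutes r
          simpa [Polynomial.algebraMap_apply, MvPolynomial.algebraMap_eq, ← MvPolynomial.algebraMap_eq] using this }
    refine trdeg_contra (k := k) (S := Polynomial (Polynomial (MvPolynomial (Fin 2) k))) ?_ θ4 ?_
    · exact ((Polynomial.mapAlgEquiv (MvPolynomial.finSuccEquiv k 2).symm).trans (MvPolynomial.finSuccEquiv k 3).symm)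
    · rw [injective_iff_map_eq_zero]
      intro a ha
      exact A3 a ha
  obtain ⟨c, hc⟩ := main
  refine ⟨c, ?_, hc⟩
  rintro rfl
  rw [zero_smul, sub_zero] at hc
  exact n1 (hg.dvd_of_dvd_pow hc)

end P3



section P4
variable {k : Type} [Field k]

lemma val_lemma (A : Subring (FractionRing (Polynomial k)))
    (hk : ∀ c : k, algebraMap (Polynomial k) (FractionRing (Polynomial k)) (Polynomial.C c) ∈ A)
    (p q : Polynomial k) (hp : p ≠ 0)
    (h1 : (algebraMap (Polynomial k) (FractionRing (Polynomial k)) p)⁻¹ ∈ A)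
    (h2 : algebraMap (Polynomial k) (FractionRing (Polynomial k)) q * (algebraMap (Polynomial k) (FractionRing (Polynomial k)) p)⁻¹ ∈ A)
    (hd : p.natDegree < q.natDegree) : algebraMap (Polynomial k) (FractionRing (Polynomial k)) p ∈ A := by
  set K := FractionRing (Polynomial k)
  set ι := algebraMap (Polynomial k) K
  by_contra hpA
  have hιp : ι p ≠ 0 := by
    rw [Ne, map_eq_zero_iff ι (IsFractionRing.injective _ _)]; exact hp
  have hιq : q ≠ 0 := by rintro rfl; simp at hd
  have hI : Ideal.span {(⟨(ι p)⁻¹, h1⟩ : A)} ≠ ⊤ := by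
    rw [Ne, Ideal.span_singleton_eq_top]
    intro hu
    obtain ⟨b, hb⟩ := hu.exists_right_inv
    apply hpA
    have h3 := congrArg Subtype.val hb
    simp only [Subring.coe_mul, Subring.coe_one] at h3
    have : ι p = b := by
      rw [← mul_one (ι p), ← h3, ← mul_assoc, mul_inv_cancel₀ hιp, one_mul]
    rw [this]; exact b.2
  obtain ⟨V, hV1, hV2⟩ := Ideal.image_subset_nonunits_valuationSubring _ hI
  have hpV : ι p ∉ V := by
    have := hV2 ⟨_, Ideal.subset_span rfl, rfl⟩
    exact (V.inv_mem_nonunits_iff.1 this).resolve_left hιp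
  have hkV : ∀ c : k, ι (Polynomial.C c) ∈ V := fun c => hV1 (hk c)
  have hTV : ι Polynomial.X ∉ V := by
    intro hT
    apply hpV
    have : ∀ r : Polynomial k, ι r ∈ V := by
      intro r
      induction r using Polynomial.induction_on' with
      | add p q hp hq => rw [map_add]; exact V.add_mem _ _ hp hq
      | monomial n a =>
        rw [← Polynomial.C_mul_X_pow_eq_monomial, map_mul, map_pow]
        exact V.mul_mem _ _ (hkV a) (pow_mem hT n)
    exact this p
  have hvT : 1 < V.valuation (ι Polynomial.X) := by
    rw [← not_le, V.valuation_le_one_iff]; exact hTV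
  have hae : ∀ r : Polynomial k, Polynomial.aeval (ι Polynomial.X) r = ι r := by
    intro r
    have h := Polynomial.aeval_algebraMap_apply (R := k) K (Polynomial.X : Polynomial k) r
    rw [Polynomial.aeval_X_left_apply] at h
    exact h
  haveI : Valuation.IsTrivialOn k V.valuation := ⟨by
    intro c hc
    have e : algebraMap k K c = ι (Polynomial.C c) := IsScalarTower.algebraMap_apply k (Polynomial k) K c
    rw [e]
    apply le_antisymm
    · exact (V.valuation_le_one_iff _).2 (hkV c)
    · have h3 := (V.valuation_le_one_iff _).2 (hkV c⁻¹)
      have h4 : V.valuation (ι (Polynomial.C c)) * V.valuation (ι (Polynomial.C c⁻¹)) = 1 := by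
        rw [← map_mul, ← map_mul, ← Polynomial.C_mul, mul_inv_cancel₀ hc]; simp
      by_contra hlt
      rw [not_le] at hlt
      have := mul_le_of_le_one_right' (a := V.valuation (ι (Polynomial.C c))) h3
      rw [h4] at this
      exact absurd hlt (not_lt.2 this)⟩
  have e1 := Polynomial.valuation_aeval_eq_valuation_X_pow_natDegree_of_one_lt_valuation_X (v := V.valuation) _ hvT hp
  have e2 := Polynomial.valuation_aeval_eq_valuation_X_pow_natDegree_of_one_lt_valuation_X (v := V.valuation) _ hvT hιq
  rw [hae] at e1 e2
  have h5 := (V.valuation_le_one_iff _).2 (hV1 h2)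
  rw [map_mul, map_inv₀, e1, e2] at h5
  have h6 : V.valuation (ι Polynomial.X) ^ p.natDegree < V.valuation (ι Polynomial.X) ^ q.natDegree :=
    pow_lt_pow_right₀ hvT hd
  have h7 : V.valuation (ι Polynomial.X) ^ p.natDegree ≠ 0 := pow_ne_zero _ (by intro h; rw [h] at hvT; simp at hvT)
  rw [← div_eq_mul_inv, div_le_one₀ (zero_lt_iff.2 h7)] at h5
  exact absurd h6 (not_lt.2 h5)

lemma lemmaK (ψ : MvPolynomial (Fin 3) k →+* Polynomial k) (hψC : ∀ c, ψ (C c) = Polynomial.C c)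
    {g : MvPolynomial (Fin 3) k} (hZ : ∀ (N : ℤ) u, WH u N → ψ u = 0 → g ∣ u)
    {U U' H : MvPolynomial (Fin 3) k} {D : ℤ} (wU : WH U D) (wU' : WH U' D) (wH : WH H D)
    {η : k} (hη : η ≠ 0) (hH : ψ H = Polynomial.C η)
    (hd : (ψ U).natDegree = 0 ∨ (ψ U).natDegree < (ψ U').natDegree)
    (ε : MvPolynomial (Fin 3) k →ₐ[k] k) (hεg : ε g = 0) (hεH : ε H = 0) : ε U = 0 := by
  have hε : ∀ r, g ∣ r → ε r = 0 := by
    rintro r ⟨s, rfl⟩; rw [map_mul, hεg, zero_mul]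
  have hεC : ∀ c, ε (C c) = c := fun c => ε.commutes c
  have hconst : (ψ U).natDegree = 0 → ε U = 0 := by
    intro h0
    have h1 := Polynomial.eq_C_of_natDegree_eq_zero h0
    set c := (ψ U).coeff 0
    have h2 : g ∣ C η * U - C c * H := by
      apply hZ D _ (IsWeightedHomogeneous.sub (wU.C_mul _) (wH.C_mul _))
      rw [map_sub, map_mul, map_mul, hψC, hψC, h1, hH]; ring
    have h3 := hε _ h2
    rw [map_sub, map_mul, map_mul, hεC, hεC, hεH, mul_zero, sub_zero] at h3
    exact (mul_eq_zero.1 h3).resolve_left hη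
  rcases hd with hd | hd
  · exact hconst hd
  by_cases h0 : ψ U = 0
  · exact hconst (by rw [h0]; simp)
  set ι := algebraMap (Polynomial k) (FractionRing (Polynomial k)) with hι
  have hinj : Function.Injective ι := IsFractionRing.injective _ _
  have hιU : ι (ψ U) ≠ 0 := by rw [Ne, map_eq_zero_iff ι hinj]; exact h0
  let A : Subring (FractionRing (Polynomial k)) :=
    { carrier := {x | ∃ (j : ℕ) (a : MvPolynomial (Fin 3) k), WH a (j * D) ∧ x * ι (ψ U) ^ j = ι (ψ a)}
      mul_mem' := by
        rintro x y ⟨j, a, wa, ha⟩ ⟨i, b, wb, hb⟩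
        refine ⟨j + i, a * b, WH.cast (wa.mul wb) (by push_cast; ring), ?_⟩
        rw [map_mul, map_mul, ← ha, ← hb]; ring
      one_mem' := ⟨0, 1, WH.cast (isWeightedHomogeneous_one k u3) (by simp), by simp⟩
      add_mem' := by
        rintro x y ⟨j, a, wa, ha⟩ ⟨i, b, wb, hb⟩
        refine ⟨j + i, a * U ^ i + b * U ^ j, IsWeightedHomogeneous.add (WH.cast (wa.mul (wU.pow' i)) (by push_cast; ring)) (WH.cast (wb.mul (wU.pow' j)) (by push_cast; ring)), ?_⟩
        simp only [map_mul, map_add, map_pow]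
        rw [← ha, ← hb]; ring
      zero_mem' := ⟨0, 0, isWeightedHomogeneous_zero k u3 _, by simp⟩
      neg_mem' := by
        rintro x ⟨j, a, wa, ha⟩
        refine ⟨j, -a, IsWeightedHomogeneous.neg wa, ?_⟩
        rw [map_neg, map_neg, ← ha]; ring }
  have hmem := val_lemma A (by
      intro c
      exact ⟨0, C c, WH.cast (isWeightedHomogeneous_C u3 c) (by simp), by rw [hψC]; simp [hι]⟩)
    (ψ U) (ψ U') h0 ⟨1, C η⁻¹ * H, WH.cast (wH.C_mul _) (by simp), by
      rw [map_mul, hψC, hH, ← Polynomial.C_mul, inv_mul_cancel₀ hη]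
      simp [hι] at hιU ⊢
      rw [inv_mul_cancel₀]
      simpa using hιU⟩
    ⟨1, U', WH.cast wU' (by simp), by
      rw [pow_one, mul_assoc]
      rw [inv_mul_cancel₀ hιU, mul_one]⟩ hd
  obtain ⟨j, a, wa, ha⟩ := hmem
  rw [← pow_succ', ← map_pow] at ha
  have ha := hinj ha
  have h2 : g ∣ C η * U ^ (j + 1) - a * H := by
    apply hZ (((j + 1 : ℕ) : ℤ) * D) _ (IsWeightedHomogeneous.sub (IsWeightedHomogeneous.C_mul (wU.pow' _) _)
      (WH.cast (wa.mul wH) (by push_cast; ring)))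
    rw [map_sub, map_mul, map_mul, map_pow, hψC, hH, ha]; ring
  have h3 := hε _ h2
  rw [map_sub, map_mul, map_mul, hεC, hεH, mul_zero, sub_zero, map_pow] at h3
  exact pow_eq_zero_iff (by omega) |>.1 ((mul_eq_zero.1 h3).resolve_left hη)

lemma lemmaK2 (ψ : MvPolynomial (Fin 3) k →+* Polynomial k) (hψC : ∀ c, ψ (C c) = Polynomial.C c)
    {g : MvPolynomial (Fin 3) k} (hZ : ∀ (N : ℤ) u, WH u N → ψ u = 0 → g ∣ u)
    {U V H : MvPolynomial (Fin 3) k} {D : ℤ} (wU : WH U D) (wV : WH V D) (wH : WH H D)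
    {η : k} (hη : η ≠ 0) (hH : ψ H = Polynomial.C η)
    (ε₁ ε₂ : MvPolynomial (Fin 3) k →ₐ[k] k) (hg1 : ε₁ g = 0) (hH1 : ε₁ H = 0) (hg2 : ε₂ g = 0) (hH2 : ε₂ H = 0)
    (hU1 : ε₁ U = 0) (hV1 : ε₁ V ≠ 0) (hU2 : ε₂ U ≠ 0) : False := by
  have c1 : ¬ ((ψ U).natDegree = 0 ∨ (ψ U).natDegree < (ψ V).natDegree) := fun h =>
    hU2 (lemmaK ψ hψC hZ wU wV wH hη hH h ε₂ hg2 hH2)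
  have c2 : ¬ ((ψ V).natDegree = 0 ∨ (ψ V).natDegree < (ψ U).natDegree) := fun h =>
    hV1 (lemmaK ψ hψC hZ wV wU wH hη hH h ε₁ hg1 hH1)
  have e : (ψ U).natDegree = (ψ V).natDegree := by omega
  have hU0 : ψ U ≠ 0 := by intro h; rw [h] at c1; simp at c1
  have hV0 : ψ V ≠ 0 := by intro h; rw [h] at c2; simp at c2
  set lu := (ψ U).leadingCoeff
  set lv := (ψ V).leadingCoeff
  have hlu : lu ≠ 0 := Polynomial.leadingCoeff_ne_zero.2 hU0
  have hlv : lv ≠ 0 := Polynomial.leadingCoeff_ne_zero.2 hV0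
  have h3 := lemmaK ψ hψC hZ (U := C lv * U - C lu * V) (U' := U)
    (IsWeightedHomogeneous.sub (wU.C_mul _) (wV.C_mul _)) wU wH hη hH (by
      right
      rw [map_sub, map_mul, map_mul, hψC, hψC]
      by_cases hz : (Polynomial.C lv * ψ U - Polynomial.C lu * ψ V) = 0
      · rw [hz, Polynomial.natDegree_zero]; omega
      apply Polynomial.natDegree_lt_natDegree hz
      have hd1 : (Polynomial.C lv * ψ U).degree = (ψ U).degree := Polynomial.degree_C_mul hlv
      rw [← hd1]
      apply Polynomial.degree_sub_lt
      · rw [Polynomial.degree_C_mul hlv, Polynomial.degree_C_mul hlu, Polynomial.degree_eq_natDegree hU0, Polynomial.degree_eq_natDegree hV0, e]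
      · exact mul_ne_zero (by simpa using hlv) hU0
      · rw [Polynomial.leadingCoeff_mul, Polynomial.leadingCoeff_mul, Polynomial.leadingCoeff_C, Polynomial.leadingCoeff_C]
        exact mul_comm _ _) ε₁ hg1 hH1
  have hεC : ∀ c, ε₁ (C c) = c := fun c => ε₁.commutes c
  rw [map_sub, map_mul, map_mul, hU1, mul_zero, zero_sub, neg_eq_zero, hεC] at h3
  exact (mul_ne_zero hlu hV1) h3

/-- homogeneous derivation of degree e -/
def HomDer (δ : Derivation k (MvPolynomial (Fin 3) k) (MvPolynomial (Fin 3) k)) (e : ℤ) : Prop :=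
  ∀ (N : ℤ) (r : MvPolynomial (Fin 3) k), WH r N → WH (δ r) (N + e)

lemma HomDer.iter {δ : Derivation k (MvPolynomial (Fin 3) k) (MvPolynomial (Fin 3) k)} {e : ℤ} (h : HomDer δ e)
    (m : ℕ) {N : ℤ} {r : MvPolynomial (Fin 3) k} (hr : WH r N) : WH (δ^[m] r) (N + m * e) := by
  induction m with
  | zero => simpa using hr
  | succ m ih =>
    rw [Function.iterate_succ_apply']
    exact WH.cast (h _ _ ih) (by push_cast; ring)

lemma lastIter {δ : Derivation k (MvPolynomial (Fin 3) k) (MvPolynomial (Fin 3) k)} (hL : IsLND δ)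
    {g u : MvPolynomial (Fin 3) k} (hu : ¬ g ∣ u) : ∃ m, ¬ g ∣ δ^[m] u ∧ g ∣ δ (δ^[m] u) := by
  by_contra hcon
  push Not at hcon
  have : ∀ m, ¬ g ∣ δ^[m] u := by
    intro m
    induction m with
    | zero => exact hu
    | succ m ih => rw [Function.iterate_succ_apply']; exact hcon m ih
  obtain ⟨N, hN⟩ := hL u
  exact this N (by rw [hN]; exact dvd_zero g)

lemma exists_point [IsAlgClosed k] {g h : MvPolynomial (Fin 3) k} (hg : Prime g) (hh : ¬ g ∣ h) :
    ∃ p : Fin 3 → k, aeval p g = 0 ∧ aeval p h ≠ 0 := by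
  by_contra hcon
  push Not at hcon
  haveI : (Ideal.span {g}).IsPrime := (Ideal.span_singleton_prime hg.ne_zero).2 hg
  have h1 := MvPolynomial.IsPrime.vanishingIdeal_zeroLocus (K := k) (Ideal.span {g})
  apply hh
  rw [← Ideal.mem_span_singleton, ← h1, mem_vanishingIdeal_iff]
  intro x hx
  exact hcon x (hx g (Ideal.mem_span_singleton_self g))

theorem keyProp [IsAlgClosed k] [CharZero k] (δ : Derivation k (MvPolynomial (Fin 3) k) (MvPolynomial (Fin 3) k))
    (hL : IsLND δ) {e : ℤ} (hom : HomDer δ e)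
    {g h b : MvPolynomial (Fin 3) k} {G d : ℕ} (hg : Prime g) (wg : WH g (G : ℤ)) (hδg : g ∣ δ g)
    (hb : ¬ g ∣ δ b) (wh : WH h (d : ℤ)) (nh : ¬ g ∣ h) (kh : g ∣ δ h)
    (a₁ b₁ a₂ b₂ : k) (hne : (a₁, b₁) ≠ (a₂, b₂))
    (hg1 : aeval ![a₁, b₁, 1] g = 0) (hg2 : aeval ![a₂, b₂, 1] g = 0)
    (hh1 : aeval ![a₁, b₁, 1] h = 0) (hh2 : aeval ![a₂, b₂, 1] h = 0) : False := by
  have hd : 0 < d := by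
    rcases Nat.eq_zero_or_pos d with h0 | h0
    · subst h0
      obtain ⟨c, rfl⟩ := wh.exists_C
      simp at hh1
      rw [hh1] at nh; simp at nh
    · exact h0
  obtain ⟨p, hpg, hph⟩ := exists_point hg nh
  have hpI : ∀ r, g ∣ r → aeval p r = 0 := by
    rintro r ⟨s, rfl⟩; rw [map_mul, hpg, zero_mul]
  have hiter : ∀ m r, g ∣ r → g ∣ δ^[m] r := by
    intro m
    induction m with
    | zero => intro r h; exact h
    | succ m ih =>
      rintro r ⟨s, rfl⟩
      rw [Function.iterate_succ_apply]
      apply ih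
      rw [Derivation.leibniz, smul_eq_mul, smul_eq_mul]
      exact dvd_add (Dvd.intro _ rfl) (hδg.mul_left _)
  let ψ : MvPolynomial (Fin 3) k →+* Polynomial k :=
    (Polynomial.mapRingHom (aeval p : MvPolynomial (Fin 3) k →ₐ[k] k).toRingHom).comp (expHom δ hL)
  have hψc : ∀ u i, (ψ u).coeff i = (i.factorial : k)⁻¹ * aeval p (δ^[i] u) := by
    intro u i
    have : (ψ u).coeff i = aeval p ((expHom δ hL u).coeff i) := by
      simp [ψ]
    rw [this, coeff_expHom, map_smul, smul_eq_mul]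
  have hψC : ∀ c, ψ (C c) = Polynomial.C c := by
    intro c
    ext i
    rw [hψc, Polynomial.coeff_C]
    cases i with
    | zero => simp
    | succ i =>
      have : δ (C c) = 0 := by rw [← MvPolynomial.algebraMap_eq]; exact δ.map_algebraMap c
      rw [Function.iterate_succ_apply, this, iter_zero]; simp
  have hψh : ψ h = Polynomial.C (aeval p h) := by
    ext i
    rw [hψc, Polynomial.coeff_C]
    cases i with
    | zero => simp
    | succ i =>
      rw [Function.iterate_succ_apply, hpI _ (hiter i _ kh)]; simp
  have hZ : ∀ (N : ℤ) u, WH u N → ψ u = 0 → g ∣ u := by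
    intro N u wu hu
    by_contra hgu
    obtain ⟨m, hm1, hm2⟩ := lastIter hL hgu
    have wv := hom.iter m wu
    set v := δ^[m] u with hv
    have hv0 : v ≠ 0 := by intro h; rw [h] at hm1; simp at hm1
    have hpv : aeval p v = 0 := by
      have := hψc u m
      rw [hu, Polynomial.coeff_zero] at this
      have h2 := (mul_eq_zero.1 this.symm).resolve_left (inv_ne_zero (by exact_mod_cast m.factorial_ne_zero))
      exact h2
    obtain ⟨d', hd'⟩ := Int.eq_ofNat_of_zero_le (wv.nonneg hv0)
    rw [hd'] at wv
    rcases Nat.eq_zero_or_pos d' with h0 | h0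
    · subst h0
      obtain ⟨c, hc⟩ := wv.exists_C
      rw [hc] at hpv hv0
      simp at hpv
      rw [hpv] at hv0; simp at hv0
    · obtain ⟨c, hc0, hc⟩ := lemmaT δ hg wg hδg hb wh wv hd h0 nh hm1 kh hm2
      have h3 := hpI _ hc
      rw [map_sub, map_smul, map_pow, map_pow, hpv, zero_pow hd.ne', smul_zero, sub_zero] at h3
      exact (pow_ne_zero _ hph) h3
  have fin : ∀ (s : ℕ), 0 < s → ∀ u₁ u₂ : MvPolynomial (Fin 3) k, WH u₁ (s : ℤ) → WH u₂ (s : ℤ) →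
      aeval ![a₁, b₁, 1] u₁ = 0 → aeval ![a₁, b₁, 1] u₂ ≠ 0 → aeval ![a₂, b₂, 1] u₁ ≠ 0 → False := by
    intro s hs u₁ u₂ w1 w2 h1 h2 h3
    refine lemmaK2 ψ hψC hZ (U := u₁ ^ d) (V := u₂ ^ d) (H := h ^ s) (D := d * s) (w1.pow' d) (w2.pow' d)
      (WH.cast (wh.pow' s) (by ring)) (η := (aeval p h) ^ s) (pow_ne_zero _ hph) (by rw [map_pow, hψh]; simp)
      (aeval ![a₁, b₁, 1]) (aeval ![a₂, b₂, 1]) hg1 (by rw [map_pow, hh1, zero_pow hs.ne']) hg2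
      (by rw [map_pow, hh2, zero_pow hs.ne']) (by rw [map_pow, h1, zero_pow hd.ne']) (by rw [map_pow]; exact pow_ne_zero _ h2)
      (by rw [map_pow]; exact pow_ne_zero _ h3)
  by_cases ha : a₁ = a₂
  · have hb' : b₁ ≠ b₂ := by intro h; exact hne (by rw [ha, h])
    have w : ∀ c, WH (X 1 - C c * X 2 ^ 2 : MvPolynomial (Fin 3) k) ((2 : ℕ) : ℤ) := fun c =>
      IsWeightedHomogeneous.sub wh_X1 (IsWeightedHomogeneous.C_mul (WH.cast (wh_X2.pow' 2) (by norm_num)) c)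
    refine fin 2 (by norm_num) _ _ (w b₁) (w b₂) ?_ ?_ ?_
    · simp
    · simp [sub_eq_zero, hb']
    · simp [sub_eq_zero, hb'.symm]
  · have w : ∀ c, WH (X 0 - C c * X 2 ^ 3 : MvPolynomial (Fin 3) k) ((3 : ℕ) : ℤ) := fun c =>
      IsWeightedHomogeneous.sub wh_X0 (IsWeightedHomogeneous.C_mul (WH.cast (wh_X2.pow' 3) (by norm_num)) c)
    refine fin 3 (by norm_num) _ _ (w a₁) (w a₂) ?_ ?_ ?_
    · simp
    · simp [sub_eq_zero, ha]
    · simp [sub_eq_zero, Ne.symm ha]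

end P4



section P5
variable {k : Type} [Field k]

lemma pderiv_pderiv_comm {k : Type} [Field k] (i j : Fin 3) (f : MvPolynomial (Fin 3) k) :
    pderiv i (pderiv j f) = pderiv j (pderiv i f) := by
  have h : ⁅(pderiv i : Derivation k (MvPolynomial (Fin 3) k) (MvPolynomial (Fin 3) k)), (pderiv j : Derivation k (MvPolynomial (Fin 3) k) (MvPolynomial (Fin 3) k))⁆ = 0 := by
    apply MvPolynomial.derivation_ext
    intro l
    rw [Derivation.commutator_apply]
    by_cases h1 : l = i <;> by_cases h2 : l = j <;> simp [pderiv_X, Pi.single_apply, h1, h2] <;> split_ifs <;> simp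
  have h2 := congrArg (fun D => D f) h
  simp only [Derivation.commutator_apply, Derivation.zero_apply] at h2
  exact sub_eq_zero.1 h2

lemma der_eq_sum (δ : Derivation k (MvPolynomial (Fin 3) k) (MvPolynomial (Fin 3) k)) (r : MvPolynomial (Fin 3) k) :
    δ r = ∑ i, pderiv i r * δ (X i) := by
  have h : δ = δ (X 0) • pderiv 0 + δ (X 1) • pderiv 1 + δ (X 2) • pderiv 2 := by
    apply MvPolynomial.derivation_ext
    intro i
    fin_cases i <;> simp [pderiv_X, Pi.single_apply]
  rw [Fin.sum_univ_three]
  conv_lhs => rw [h]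
  simp [mul_comm]

lemma dvd_der {δ : Derivation k (MvPolynomial (Fin 3) k) (MvPolynomial (Fin 3) k)} {g : MvPolynomial (Fin 3) k}
    (h : ∀ i, g ∣ δ (X i)) (r) : g ∣ δ r := by
  rw [der_eq_sum]
  exact Finset.dvd_sum fun i _ => (h i).mul_left _

lemma not_dvd_of_lt {g r : MvPolynomial (Fin 3) k} {G N : ℤ} (wg : WH g G) (wr : WH r N) (hr : r ≠ 0) (h : N < G) :
    ¬ g ∣ r := by
  rintro ⟨s, rfl⟩
  rw [mul_comm] at wr hr
  obtain ⟨M, hM⟩ := wr.factor hr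
  have := IsWeightedHomogeneous.inj_right hr wr (IsWeightedHomogeneous.mul hM wg)
  omega

lemma WH.pos_of_prime {g : MvPolynomial (Fin 3) k} {G : ℕ} (wg : WH g (G : ℤ)) (hg : Prime g) : 0 < G := by
  rcases Nat.eq_zero_or_pos G with h | h
  · subst h
    obtain ⟨c, rfl⟩ := wg.exists_C
    exfalso
    apply hg.not_unit
    apply IsUnit.map
    apply IsUnit.mk0
    rintro rfl
    exact hg.ne_zero (by simp)
  · exact h

lemma exists_prime_factor {G : MvPolynomial (Fin 3) k} (hG : G ≠ 0) (ε : MvPolynomial (Fin 3) k →ₐ[k] k)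
    (h : ε G = 0) : ∃ g, Prime g ∧ g ∣ G ∧ ε g = 0 := by
  obtain ⟨s, hs, u, hu⟩ := UniqueFactorizationMonoid.exists_prime_factors G hG
  rw [← hu, map_mul] at h
  have h1 : ε (u : MvPolynomial (Fin 3) k) ≠ 0 := (u.isUnit.map ε).ne_zero
  have h2 := (mul_eq_zero.1 h).resolve_right h1
  rw [map_multiset_prod, Multiset.prod_eq_zero_iff, Multiset.mem_map] at h2
  obtain ⟨g, hg, hg0⟩ := h2
  exact ⟨g, hs g hg, (Multiset.dvd_prod hg).trans (hu ▸ Dvd.intro _ rfl), hg0⟩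

theorem noLND [IsAlgClosed k] [CharZero k] {f : MvPolynomial (Fin 3) k} (hf : Irreducible f) (wf : WH f 9)
    (hfx : pderiv 0 f ≠ 0) (a₁ b₁ a₂ b₂ : k) (hne : (a₁, b₁) ≠ (a₂, b₂))
    (hf1 : aeval ![a₁, b₁, 1] f = 0) (hf2 : aeval ![a₂, b₂, 1] f = 0)
    (hp1 : ∀ i : Fin 3, aeval ![a₁, b₁, 1] (pderiv i f) = 0) (hp2 : ∀ i : Fin 3, aeval ![a₂, b₂, 1] (pderiv i f) = 0) :
    ∀ (M : ℕ) (δ : Derivation k (MvPolynomial (Fin 3) k) (MvPolynomial (Fin 3) k)) (e : ℤ), e + 3 < M →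
      IsLND δ → HomDer δ e → δ (δ f) = 0 → δ = 0 := by
  have hfp : Prime f := hf.prime
  intro M
  induction M with
  | zero =>
    intro δ e he hL hom _
    apply MvPolynomial.derivation_ext
    intro i
    have : WH (δ (X i)) (u3 i + e) := hom _ _ (isWeightedHomogeneous_X k u3 i)
    apply this.eq_zero_of_neg
    fin_cases i <;> simp [u3] <;> push_cast at he <;> omega
  | succ M ih =>
    intro δ e he hL hom hδδ
    by_contra hδ0
    obtain ⟨i0, hi0⟩ : ∃ i, δ (X i) ≠ 0 := by
      by_contra hcon
      push Not at hcon
      exact hδ0 (MvPolynomial.derivation_ext (by intro i; rw [hcon i]; rfl))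
    by_cases hprim : ∃ g, Prime g ∧ ∀ i, g ∣ δ (X i)
    · obtain ⟨g, hg, hgd⟩ := hprim
      have hδg : δ g = 0 := ker_of_dvd_self δ hL (dvd_der hgd g)
      obtain ⟨G, wg⟩ := (hom _ _ (isWeightedHomogeneous_X k u3 i0)).of_dvd hi0 (hgd i0)
      have hG := wg.pos_of_prime hg
      choose d hd using hgd
      set δ' : Derivation k (MvPolynomial (Fin 3) k) (MvPolynomial (Fin 3) k) := mkDerivation k d with hδ'
      have hmul : ∀ r, δ r = g * δ' r := by
        intro r
        have : δ = g • δ' := by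
          apply MvPolynomial.derivation_ext
          intro i
          simp [hδ', mkDerivation_X, hd i]
        conv_lhs => rw [this]
        rfl
      have hδ'g : δ' g = 0 := by
        have := hmul g
        rw [hδg] at this
        exact (mul_eq_zero.1 this.symm).resolve_left hg.ne_zero
      have hiter : ∀ N r, δ^[N] r = g ^ N * δ'^[N] r := by
        intro N r
        induction N with
        | zero => simp
        | succ N ihN =>
          rw [Function.iterate_succ_apply', Function.iterate_succ_apply', ihN, hmul, Derivation.leibniz,
            Derivation.leibniz_pow, hδ'g]
          simp; ring
      apply hδ0
      have hz : δ' = 0 := by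
        apply ih δ' (e - G) (by push_cast at he; omega)
        · intro r
          obtain ⟨N, hN⟩ := hL r
          refine ⟨N, ?_⟩
          rw [hiter] at hN
          exact (mul_eq_zero.1 hN).resolve_left (pow_ne_zero _ hg.ne_zero)
        · intro N r hr
          have h1 := hom _ _ hr
          rw [hmul, mul_comm] at h1
          by_cases h0 : δ' r = 0
          · rw [h0]; exact isWeightedHomogeneous_zero k u3 _
          have h2 : δ' r * g ≠ 0 := mul_ne_zero h0 hg.ne_zero
          obtain ⟨L, hL'⟩ := WH.factor h1 h2
          have := IsWeightedHomogeneous.inj_right h2 h1 (IsWeightedHomogeneous.mul hL' wg)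
          exact hL'.cast (by omega)
        · have := hiter 2 f
          simp only [Function.iterate_succ_apply, Function.iterate_zero_apply] at this
          rw [hδδ] at this
          exact (mul_eq_zero.1 this.symm).resolve_left (pow_ne_zero _ hg.ne_zero)
      apply Derivation.ext
      intro r
      rw [hmul, hz]; simp
    · push Not at hprim
      by_cases hδf : δ f = 0
      · -- case 1
        obtain ⟨j, hj⟩ := hprim f hfp
        have hJ : ∀ i, δ (pderiv i f) ∈ Ideal.span (Set.range fun i => pderiv i f) := by
          intro i
          have h1 : pderiv i (δ f) = 0 := by rw [hδf]; simp
          rw [der_eq_sum δ f, map_sum] at h1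
          have h2 : δ (pderiv i f) = - ∑ l, pderiv l f * pderiv i (δ (X l)) := by
            rw [der_eq_sum, eq_neg_iff_add_eq_zero, ← h1, ← Finset.sum_add_distrib]
            refine Finset.sum_congr rfl fun l _ => ?_
            rw [Derivation.leibniz, smul_eq_mul, smul_eq_mul, pderiv_pderiv_comm]
            ring
          rw [h2]
          apply Ideal.neg_mem_iff _ |>.2
          apply Ideal.sum_mem
          intro l _
          exact Ideal.mul_mem_right _ _ (Ideal.subset_span ⟨l, rfl⟩)
        have hJ2 : ∀ r ∈ Ideal.span (Set.range fun i => pderiv i f), δ r ∈ Ideal.span (Set.range fun i => pderiv i f) := by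
          intro r hr
          induction hr using Submodule.span_induction with
          | mem x hx => obtain ⟨i, rfl⟩ := hx; exact hJ i
          | zero => simp
          | add x y _ _ hx hy => rw [map_add]; exact Ideal.add_mem _ hx hy
          | smul a x hx' hx =>
            rw [smul_eq_mul, Derivation.leibniz, smul_eq_mul, smul_eq_mul]
            exact Ideal.add_mem _ (Ideal.mul_mem_left _ _ hx) (Ideal.mul_mem_right _ _ hx')
        have wfx : WH (pderiv 0 f) (9 - u3 0) := WH.pderiv' wf 0
        have hn : ¬ f ∣ pderiv 0 f := not_dvd_of_lt wf wfx hfx (by simp [u3])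
        obtain ⟨m, hm1, hm2⟩ := lastIter hL hn
        have wv := hom.iter m wfx
        have hv0 : δ^[m] (pderiv 0 f) ≠ 0 := by intro h; rw [h] at hm1; simp at hm1
        obtain ⟨d', hd'⟩ := Int.eq_ofNat_of_zero_le (wv.nonneg hv0)
        rw [hd'] at wv
        have hvJ : δ^[m] (pderiv 0 f) ∈ Ideal.span (Set.range fun i => pderiv i f) := by
          clear hm1 hm2 wv hv0 hd'
          induction m with
          | zero => exact Ideal.subset_span ⟨0, rfl⟩
          | succ m ihm => rw [Function.iterate_succ_apply']; exact hJ2 _ ihm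
        have hker : ∀ (ε : MvPolynomial (Fin 3) k →ₐ[k] k), (∀ i, ε (pderiv i f) = 0) → ε (δ^[m] (pderiv 0 f)) = 0 := by
          intro ε hε
          have : Ideal.span (Set.range fun i => pderiv i f) ≤ RingHom.ker ε := by
            rw [Ideal.span_le]
            rintro _ ⟨i, rfl⟩
            exact hε i
          exact this hvJ
        exact keyProp δ hL hom hfp (G := 9) wf (by rw [hδf]; exact dvd_zero _) hj wv hm1 hm2 a₁ b₁ a₂ b₂ hne hf1 hf2
          (hker _ hp1) (hker _ hp2)
      · -- case 2
        have hε : ∀ (ε : MvPolynomial (Fin 3) k →ₐ[k] k), (∀ i, ε (pderiv i f) = 0) → ε (δ f) = 0 := by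
          intro ε hε
          rw [der_eq_sum, map_sum]
          exact Finset.sum_eq_zero fun i _ => by rw [map_mul, hε, zero_mul]
        have wG : WH (δ f) (9 + e) := hom _ _ wf
        have facts : ∀ g, Prime g → g ∣ δ f → δ g = 0 ∧ (∃ G : ℕ, WH g (G : ℤ)) ∧ ¬ g ∣ f := by
          intro g hg hgd
          refine ⟨?_, wG.of_dvd hδf hgd, ?_⟩
          · obtain ⟨s, hs⟩ := hgd
            apply ker_of_mul δ hL (b := s)
            · rw [← hs]; exact hδf
            · rw [← hs]; exact hδδ
          · intro hgf
            have hass : Associated g f := hg.irreducible.associated_of_dvd hf hgf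
            exact hδf (ker_of_dvd_self δ hL (hass.symm.dvd.trans hgd))
        obtain ⟨g₁, hg₁, hd₁, he₁⟩ := exists_prime_factor hδf _ (hε _ hp1)
        obtain ⟨g₂, hg₂, hd₂, he₂⟩ := exists_prime_factor hδf _ (hε _ hp2)
        obtain ⟨k₁, ⟨G₁, w₁⟩, n₁⟩ := facts g₁ hg₁ hd₁
        obtain ⟨k₂, ⟨G₂, w₂⟩, n₂⟩ := facts g₂ hg₂ hd₂
        have he₃ : aeval ![a₂, b₂, 1] g₁ = 0 := by
          by_cases hdd : g₂ ∣ g₁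
          · obtain ⟨s, rfl⟩ := hdd
            rw [map_mul, he₂, zero_mul]
          obtain ⟨j, hj⟩ := hprim g₂ hg₂
          have hG1 := w₁.pos_of_prime hg₁
          obtain ⟨c, hc0, s, hc⟩ := lemmaT δ hg₂ w₂ (by rw [k₂]; exact dvd_zero _) hj (d1 := 9) wf w₁ (by norm_num)
            hG1 n₂ hdd hd₂ (by rw [k₁]; exact dvd_zero _)
          have := congrArg (aeval ![a₂, b₂, 1]) hc
          rw [map_mul, he₂, zero_mul, map_sub, map_smul, map_pow, map_pow, hf2, zero_pow hG1.ne', zero_sub, neg_eq_zero, smul_eq_mul] at this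
          exact pow_eq_zero_iff (by norm_num) |>.1 ((mul_eq_zero.1 this).resolve_left hc0)
        obtain ⟨j, hj⟩ := hprim g₁ hg₁
        exact keyProp δ hL hom hg₁ w₁ (by rw [k₁]; exact dvd_zero _) hj (d := 9) wf n₁ hd₁ a₁ b₁ a₂ b₂ hne he₁ he₃ hf1 hf2

end P5



section P6

lemma reg_of_equiv {S T : Type*} [CommRing S] [CommRing T] (e : S ≃+* T) (h : IsRegLocalRing S) :
    IsRegLocalRing T := by
  classical
  obtain ⟨h1, h2, s, hs, hc⟩ := h
  refine ⟨isNoetherianRing_of_ringEquiv S e, e.isLocalRing, s.image e, ?_, ?_⟩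
  · have h3 := Ideal.map_jacobson_of_bijective (f := e.toRingHom) e.bijective (I := (⊥ : Ideal S))
    rw [← hs, Ideal.map_span, Ideal.map_bot] at h3
    rw [← h3]; simp
  · rw [Finset.card_image_of_injective _ e.injective, hc]
    exact ringKrullDim_eq_of_ringEquiv e

lemma reg_of_isField {S : Type*} [CommRing S] (h : IsField S) : IsRegLocalRing S := by
  letI := h.toField
  refine ⟨inferInstance, inferInstance, ∅, ?_, ?_⟩
  · rw [IsLocalRing.jacobson_eq_maximalIdeal _ bot_ne_top]
    simp [IsLocalRing.maximalIdeal_eq_bot]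
  · rw [ringKrullDim_eq_zero_of_isField h]; simp; rfl

lemma reg_of_dvr {S : Type*} [CommRing S] [IsDomain S] [IsLocalRing S] (π : S) (h0 : π ≠ 0)
    (hm : IsLocalRing.maximalIdeal S = Ideal.span {π}) (hfin : ∀ x : S, x ≠ 0 → ∃ n, ¬ π ^ n ∣ x) :
    IsRegLocalRing S := by
  classical
  have hp : Prime π := by
    rw [← Ideal.span_singleton_prime h0, ← hm]; infer_instance
  haveI : IsDiscreteValuationRing S := by
    apply IsDiscreteValuationRing.ofHasUnitMulPowIrreducibleFactorization
    refine ⟨π, hp.irreducible, ?_⟩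
    intro x hx
    have hn := Nat.find_spec (hfin x hx)
    obtain ⟨m, hm'⟩ : ∃ m, Nat.find (hfin x hx) = m + 1 := by
      apply Nat.exists_eq_succ_of_ne_zero
      intro h; rw [h] at hn; simp at hn
    have hd : π ^ m ∣ x := by
      by_contra hc
      exact Nat.find_min (hfin x hx) (m := m) (by omega) hc
    rw [hm'] at hn
    obtain ⟨y, rfl⟩ := hd
    refine ⟨m, ?_⟩
    have hy : IsUnit y := by
      by_contra hy
      have : y ∈ IsLocalRing.maximalIdeal S := (IsLocalRing.mem_maximalIdeal y).2 hy
      rw [hm, Ideal.mem_span_singleton] at this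
      exact hn (by rw [pow_succ]; exact mul_dvd_mul_left _ this)
    exact associated_mul_unit_right _ _ hy
  refine ⟨inferInstance, inferInstance, {π}, ?_, ?_⟩
  · rw [IsLocalRing.jacobson_eq_maximalIdeal _ bot_ne_top, hm]; simp
  · rw [IsDiscreteValuationRing.ringKrullDim_eq_one]; simp; rfl

section hl
variable {k : Type} [Field k] {B : Type} [CommRing B] [IsDomain B] [IsNoetherianRing B] [Algebra k B]
  (ℬ : ℕ → Submodule k B) [GradedAlgebra ℬ] (P : Ideal B) [P.IsPrime]

instance hl_dom : IsDomain (HomogeneousLocalization.AtPrime ℬ P) := by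
  have hinj : Function.Injective (algebraMap (HomogeneousLocalization.AtPrime ℬ P) (Localization.AtPrime P)) :=
    HomogeneousLocalization.val_injective _
  haveI : IsDomain (Localization.AtPrime P) :=
    IsLocalization.isDomain_localization P.primeCompl_le_nonZeroDivisors
  exact hinj.isDomain (algebraMap (HomogeneousLocalization.AtPrime ℬ P) (Localization.AtPrime P))

lemma hl_unit (c : HomogeneousLocalization.NumDenSameDeg ℬ P.primeCompl) (h : (c.num : B) ∉ P) :
    IsUnit (HomogeneousLocalization.mk c : HomogeneousLocalization.AtPrime ℬ P) := by
  refine IsUnit.of_mul_eq_one (HomogeneousLocalization.mk ⟨c.deg, c.den, c.num, h⟩) ?_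
  rw [HomogeneousLocalization.ext_iff_val, HomogeneousLocalization.val_mul,
    HomogeneousLocalization.val_mk, HomogeneousLocalization.val_mk, Localization.mk_mul,
    HomogeneousLocalization.val_one, ← Localization.mk_one, Localization.mk_eq_mk_iff, Localization.r_iff_exists]
  refine ⟨1, ?_⟩
  simp [mul_comm]

lemma hl_mk_eq (c d : HomogeneousLocalization.NumDenSameDeg ℬ P.primeCompl)
    (h : (c.num : B) * d.den = d.num * c.den) :
    (HomogeneousLocalization.mk c : HomogeneousLocalization.AtPrime ℬ P) = HomogeneousLocalization.mk d := by
  rw [HomogeneousLocalization.ext_iff_val, 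
    HomogeneousLocalization.val_mk, HomogeneousLocalization.val_mk, Localization.mk_eq_mk_iff, Localization.r_iff_exists]
  refine ⟨1, ?_⟩
  simp
  linear_combination h

lemma hl_mul (c d : HomogeneousLocalization.NumDenSameDeg ℬ P.primeCompl) :
    (HomogeneousLocalization.mk c : HomogeneousLocalization.AtPrime ℬ P) * HomogeneousLocalization.mk d
     = HomogeneousLocalization.mk ⟨c.deg + d.deg, ⟨(c.num : B) * (d.num : B), SetLike.mul_mem_graded c.num.2 d.num.2⟩,
        ⟨(c.den : B) * (d.den : B), SetLike.mul_mem_graded c.den.2 d.den.2⟩, P.primeCompl.mul_mem c.den_mem d.den_mem⟩ := by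
  rw [HomogeneousLocalization.ext_iff_val, HomogeneousLocalization.val_mul,
    HomogeneousLocalization.val_mk, HomogeneousLocalization.val_mk, Localization.mk_mul, HomogeneousLocalization.val_mk]
  rfl

lemma hl_val_mem (c : HomogeneousLocalization.NumDenSameDeg ℬ P.primeCompl) (h : (c.num : B) ∈ P) :
    (HomogeneousLocalization.mk c : HomogeneousLocalization.AtPrime ℬ P).val ∈ IsLocalRing.maximalIdeal (Localization.AtPrime P) := by
  rw [HomogeneousLocalization.val_mk, Localization.mk_eq_mk', IsLocalization.AtPrime.mk'_mem_maximal_iff _ P]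
  exact h

lemma hl_mem (c : HomogeneousLocalization.NumDenSameDeg ℬ P.primeCompl) :
    (HomogeneousLocalization.mk c : HomogeneousLocalization.AtPrime ℬ P) ∈ IsLocalRing.maximalIdeal _ ↔ (c.num : B) ∈ P := by
  constructor
  · intro h
    by_contra hc
    exact (IsLocalRing.mem_maximalIdeal _).1 h (hl_unit ℬ P c hc)
  · intro h
    rw [IsLocalRing.mem_maximalIdeal, mem_nonunits_iff, ← HomogeneousLocalization.isUnit_iff_isUnit_val]
    exact (IsLocalRing.mem_maximalIdeal _).1 (hl_val_mem ℬ P c h)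

lemma hl_field (h : P = ⊥) : IsRegLocalRing (HomogeneousLocalization.AtPrime ℬ P) := by
  apply reg_of_isField
  refine ⟨⟨0, 1, zero_ne_one⟩, mul_comm, ?_⟩
  intro a ha
  obtain ⟨c, rfl⟩ := HomogeneousLocalization.mk_surjective a
  refine (hl_unit ℬ P c ?_).exists_right_inv
  intro hc
  apply ha
  have hc : (c.num : B) = 0 := by
    have h1 : P ≤ ⊥ := h.le
    exact Ideal.mem_bot.1 (h1 hc)
  rw [HomogeneousLocalization.ext_iff_val, HomogeneousLocalization.val_mk, hc, HomogeneousLocalization.val_zero]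
  exact Localization.mk_zero _

lemma hl_reg {d : ℕ} {u v : B} (hu : u ∈ ℬ d) (hv : v ∈ ℬ d) (hu0 : u ≠ 0) (huP : u ∈ P) (hvP : v ∉ P)
    (H : ∀ N, ∀ a ∈ ℬ N, a ∈ P → (∃ s ∈ ℬ N, s ∉ P) → ∃ σ, σ ∉ P ∧ u ∣ σ * a) :
    IsRegLocalRing (HomogeneousLocalization.AtPrime ℬ P) := by
  classical
  let uc : HomogeneousLocalization.NumDenSameDeg ℬ P.primeCompl := ⟨d, ⟨u, hu⟩, ⟨v, hv⟩, hvP⟩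
  refine reg_of_dvr (HomogeneousLocalization.mk uc) ?_ ?_ ?_
  · intro h
    rw [HomogeneousLocalization.ext_iff_val, HomogeneousLocalization.val_mk, HomogeneousLocalization.val_zero,
      Localization.mk_eq_mk', IsLocalization.mk'_eq_zero_iff] at h
    obtain ⟨m, hm⟩ := h
    rcases mul_eq_zero.1 hm with h | h
    · exact m.2 (by rw [h]; exact P.zero_mem)
    · exact hu0 h
  · apply le_antisymm
    · intro x hx
      obtain ⟨c, rfl⟩ := HomogeneousLocalization.mk_surjective x
      rw [hl_mem] at hx
      rw [Ideal.mem_span_singleton]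
      obtain ⟨N, ⟨a, ha⟩, ⟨s, hs⟩, hsP⟩ := c
      simp only at hx
      obtain ⟨σ, hσ, e, he⟩ := H N a ha hx ⟨s, hs, hsP⟩
      obtain ⟨M, hM⟩ : ∃ M, (DirectSum.decompose ℬ σ M : B) ∉ P := by
        by_contra hc
        push Not at hc
        apply hσ
        rw [← DirectSum.sum_support_decompose ℬ σ]
        exact P.sum_mem fun i _ => hc i
      have e1 : (DirectSum.decompose ℬ (σ * a) (M + N) : B) = (DirectSum.decompose ℬ σ M : B) * a := by
        exact DirectSum.coe_decompose_mul_add_of_right_mem ℬ ha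
      rw [he] at e1
      set σ' := DirectSum.decompose ℬ σ M with hσ'
      by_cases hd : d ≤ M + N
      · rw [DirectSum.coe_decompose_mul_of_left_mem_of_le ℬ hu hd] at e1
        set e' := DirectSum.decompose ℬ e (M + N - d)
        refine ⟨HomogeneousLocalization.mk ⟨M + N, ⟨e' * v, ?_⟩, ⟨σ' * s, SetLike.mul_mem_graded σ'.2 hs⟩, P.primeCompl.mul_mem hM hsP⟩, ?_⟩
        · have := SetLike.mul_mem_graded e'.2 hv
          rwa [Nat.sub_add_cancel hd] at this
        · rw [hl_mul]
          apply hl_mk_eq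
          simp only [uc]
          linear_combination (-v * s) * e1
      · rw [DirectSum.coe_decompose_mul_of_left_mem_of_not_le ℬ hu hd] at e1
        have ha0 : a = 0 := by
          rcases mul_eq_zero.1 e1.symm with h | h
          · exact absurd (by rw [h]; exact P.zero_mem) hM
          · exact h
        refine ⟨0, ?_⟩
        rw [HomogeneousLocalization.ext_iff_val, HomogeneousLocalization.val_mk]
        simp only [ha0, mul_zero, HomogeneousLocalization.val_zero]
        exact Localization.mk_zero _
    · rw [Ideal.span_singleton_le_iff_mem, hl_mem]
      exact huP
  · intro x hx
    by_contra hc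
    push Not at hc
    apply hx
    have hinj : Function.Injective (algebraMap (HomogeneousLocalization.AtPrime ℬ P) (Localization.AtPrime P)) :=
      HomogeneousLocalization.val_injective _
    apply hinj
    rw [map_zero]
    haveI : IsDomain (Localization.AtPrime P) :=
      IsLocalization.isDomain_localization P.primeCompl_le_nonZeroDivisors
    haveI : IsNoetherianRing (Localization.AtPrime P) := IsLocalization.isNoetherianRing P.primeCompl _ inferInstance
    have h1 := Ideal.iInf_pow_eq_bot_of_isDomain (IsLocalRing.maximalIdeal (Localization.AtPrime P)) (Ideal.IsPrime.ne_top')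
    rw [← Ideal.mem_bot, ← h1, Ideal.mem_iInf]
    intro i
    obtain ⟨y, rfl⟩ := hc i
    rw [map_mul, map_pow]
    exact Ideal.mul_mem_right _ _ (Ideal.pow_mem_pow (hl_val_mem ℬ P uc huP) _)
end hl
end P6



section P7
variable {k : Type} [Field k]

lemma WH.induct {p : MvPolynomial (Fin 3) k → Prop} {N : ℕ} {r : MvPolynomial (Fin 3) k} (wr : WH r (N : ℤ))
    (h0 : p 0) (hadd : ∀ a b, p a → p b → p (a + b))
    (hm : ∀ (i j l : ℕ) (c : k), 3 * i + 2 * j + l = N → p (C c * X 0 ^ i * X 1 ^ j * X 2 ^ l)) : p r := by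
  rw [r.as_sum]
  refine Finset.sum_induction _ p hadd h0 ?_
  intro d hd
  have hw := wr (MvPolynomial.mem_support_iff.1 hd)
  rw [weight_u3] at hw
  have h := hm (d 0) (d 1) (d 2) (coeff d r) (by exact_mod_cast hw)
  convert h using 1
  rw [MvPolynomial.monomial_eq, Finsupp.prod_fintype _ _ (by simp), Fin.prod_univ_three]
  ring

def fexp (p q r s c1 c2 c3 c4 c5 c6 c7 c8 : k) : MvPolynomial (Fin 3) k :=
  C p * X 0 ^ 3 + C q * X 0 * X 1 ^ 3 + C r * X 0 ^ 2 * X 1 * X 2 + C s * X 1 ^ 4 * X 2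
    + C c1 * X 0 * X 1 ^ 2 * X 2 ^ 2 + C c2 * X 0 ^ 2 * X 2 ^ 3 + C c3 * X 1 ^ 3 * X 2 ^ 3
    + C c4 * X 0 * X 1 * X 2 ^ 4 + C c5 * X 1 ^ 2 * X 2 ^ 5 + C c6 * X 0 * X 2 ^ 6 + C c7 * X 1 * X 2 ^ 7
    + C c8 * X 2 ^ 9

lemma fexp_exists {f : MvPolynomial (Fin 3) k} (wf : WH f 9) :
    ∃ p q r s c1 c2 c3 c4 c5 c6 c7 c8 : k, f = fexp p q r s c1 c2 c3 c4 c5 c6 c7 c8 := by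
  refine WH.induct (p := fun f => ∃ p q r s c1 c2 c3 c4 c5 c6 c7 c8 : k, f = fexp p q r s c1 c2 c3 c4 c5 c6 c7 c8) (N := 9) (by exact_mod_cast wf) ⟨0,0,0,0,0,0,0,0,0,0,0,0, by simp [fexp]⟩ ?_ ?_
  · rintro _ _ ⟨p, q, r, s, c1, c2, c3, c4, c5, c6, c7, c8, rfl⟩ ⟨p', q', r', s', c1', c2', c3', c4', c5', c6', c7', c8', rfl⟩
    refine ⟨p + p', q + q', r + r', s + s', c1 + c1', c2 + c2', c3 + c3', c4 + c4', c5 + c5', c6 + c6', c7 + c7', c8 + c8', ?_⟩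
    simp only [fexp, map_add]
    ring
  · intro i j l c h
    have hi : i ≤ 3 := by omega
    have hj : j ≤ 4 := by omega
    interval_cases i <;> interval_cases j <;> try omega
    · obtain rfl : l = 9 := by omega
      exact ⟨0,0,0,0,0,0,0,0,0,0,0,c, by simp [fexp]⟩
    · obtain rfl : l = 7 := by omega
      exact ⟨0,0,0,0,0,0,0,0,0,0,c,0, by simp [fexp]⟩
    · obtain rfl : l = 5 := by omega
      exact ⟨0,0,0,0,0,0,0,0,c,0,0,0, by simp [fexp]⟩
    · obtain rfl : l = 3 := by omega
      exact ⟨0,0,0,0,0,0,c,0,0,0,0,0, by simp [fexp]⟩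
    · obtain rfl : l = 1 := by omega
      exact ⟨0,0,0,c,0,0,0,0,0,0,0,0, by simp [fexp]⟩
    · obtain rfl : l = 6 := by omega
      exact ⟨0,0,0,0,0,0,0,0,0,c,0,0, by simp [fexp]⟩
    · obtain rfl : l = 4 := by omega
      exact ⟨0,0,0,0,0,0,0,c,0,0,0,0, by simp [fexp]⟩
    · obtain rfl : l = 2 := by omega
      exact ⟨0,0,0,0,c,0,0,0,0,0,0,0, by simp [fexp]⟩
    · obtain rfl : l = 0 := by omega
      exact ⟨0,c,0,0,0,0,0,0,0,0,0,0, by simp [fexp]⟩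
    · obtain rfl : l = 3 := by omega
      exact ⟨0,0,0,0,0,c,0,0,0,0,0,0, by simp [fexp]⟩
    · obtain rfl : l = 1 := by omega
      exact ⟨0,0,c,0,0,0,0,0,0,0,0,0, by simp [fexp]⟩
    · obtain rfl : l = 0 := by omega
      exact ⟨c,0,0,0,0,0,0,0,0,0,0,0, by simp [fexp]⟩

lemma f_form {f : MvPolynomial (Fin 3) k} (wf : WH f 9) (h : CondC3C4 k f) :
    ∃ p q r s c1 c2 c3 c4 c5 c6 c7 c8 : k, f = fexp p q r s c1 c2 c3 c4 c5 c6 c7 c8 ∧ p ≠ 0 ∧ q ≠ 0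
      ∧ 3 * p * s - q * r ≠ 0 := by
  obtain ⟨p, q, r, s, hp, hq, h3, h4, h5⟩ := h
  obtain ⟨p', q', r', s', c1, c2, c3, c4, c5, c6, c7, c8, rfl⟩ := fexp_exists wf
  have e1 : ∀ a b : k, p' * a ^ 3 + q' * a * b ^ 3 = a * (p * a ^ 2 + q * b ^ 3) := by
    intro a b
    have := congrArg (aeval (fun i : ℕ => if i = 0 then a else b)) h3
    simpa [fexp] using this
  have e2 : ∀ a b : k, r' * a ^ 2 * b + s' * b ^ 4 = b * (r * a ^ 2 + s * b ^ 3) := by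
    intro a b
    have := congrArg (aeval (fun i : ℕ => if i = 0 then a else b)) h4
    simpa [fexp, pderiv_X, Pi.single_apply] using this
  have a1 : p' = p := by simpa using e1 1 0
  have a2 : q' = q := by have := e1 1 1; rw [a1] at this; simpa using this
  have a3 : s' = s := by simpa using e2 0 1
  have a4 : r' = r := by have := e2 1 1; rw [a3] at this; simpa using this
  subst a1 a2 a3 a4
  exact ⟨p', q', r', s', c1, c2, c3, c4, c5, c6, c7, c8, rfl, hp, hq, h5⟩

end P7



section P8
variable {k : Type} [Field k]

lemma aeval_scale {K : Type} [CommRing K] [Algebra k K] {r : MvPolynomial (Fin 3) k} {N : ℕ} (wr : WH r (N : ℤ)) (a b c t : K) :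
    aeval ![a * t ^ 3, b * t ^ 2, c * t] r = t ^ N * aeval ![a, b, c] r := by
  refine WH.induct (p := fun r => aeval ![a * t ^ 3, b * t ^ 2, c * t] r = t ^ N * aeval ![a, b, c] r) wr ?_ ?_ ?_
  · simp
  · intro r s hr hs
    simp only [map_add, hr, hs]; ring
  · intro i j l c h
    subst h
    simp
    ring

lemma decomp_gen {σ : Type} {B : Type} [CommRing B] [Algebra k B]
    (ℬ : ℕ → Submodule k B) [GradedAlgebra ℬ] (w : σ → ℕ) (ψ : MvPolynomial σ k →ₐ[k] B)
    (h : ∀ N r, IsWeightedHomogeneous w r N → ψ r ∈ ℬ N) (r : MvPolynomial σ k) (N : ℕ) :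
    (DirectSum.decompose ℬ (ψ r) N : B) = ψ (weightedHomogeneousComponent w N r) := by
  classical
  induction r using MvPolynomial.induction_on' with
  | monomial u a =>
    have h1 : IsWeightedHomogeneous w (monomial u a) (Finsupp.weight w u) := isWeightedHomogeneous_monomial w u a rfl
    by_cases hN : Finsupp.weight w u = N
    · subst hN
      rw [DirectSum.decompose_of_mem_same ℬ (h _ _ h1), weightedHomogeneousComponent_of_mem h1, if_pos rfl]
    · rw [DirectSum.decompose_of_mem_ne ℬ (h _ _ h1) hN, weightedHomogeneousComponent_of_mem h1, if_neg (Ne.symm hN), map_zero]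
  | add p q hp hq => simp [DirectSum.decompose_add, hp, hq]

section
variable [IsAlgClosed k] [CharZero k] {f : MvPolynomial (Fin 3) k} (p q r s c1 c2 c3 c4 c5 c6 c7 c8 : k)

lemma comap_ne (hf : f = fexp p q r s c1 c2 c3 c4 c5 c6 c7 c8) (hp : p ≠ 0)
    (hirr : Irreducible f) (P : Ideal (MvPolynomial (Fin 3) k ⧸ Ideal.span {f})) (hP : P ≠ ⊥) :
    ∃ φ : MvPolynomial (Fin 2) k, φ ≠ 0 ∧ Ideal.Quotient.mkₐ k (Ideal.span {f}) (aeval ![X 1, X 2] φ) ∈ P := by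
  haveI : (Ideal.span {f}).IsPrime := (Ideal.span_singleton_prime hirr.ne_zero).2 hirr.prime
  let θ : MvPolynomial (Fin 2) k →ₐ[k] MvPolynomial (Fin 3) k := aeval ![X 1, X 2]
  let g : MvPolynomial (Fin 2) k →+* (MvPolynomial (Fin 3) k ⧸ Ideal.span {f}) :=
    (Ideal.Quotient.mk (Ideal.span {f})).comp θ.toRingHom
  letI := g.toAlgebra
  have hg : ∀ φ, algebraMap (MvPolynomial (Fin 2) k) (MvPolynomial (Fin 3) k ⧸ Ideal.span {f}) φ
      = Ideal.Quotient.mk (Ideal.span {f}) (aeval ![X 1, X 2] φ) := fun φ => rfl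
  have hx : IsIntegral (MvPolynomial (Fin 2) k) (Ideal.Quotient.mk (Ideal.span {f}) (X 0)) := by
    refine ⟨Polynomial.X ^ 3 + Polynomial.C (C p⁻¹ * (C r * X 0 * X 1 + C c2 * X 1 ^ 3)) * Polynomial.X ^ 2
      + Polynomial.C (C p⁻¹ * (C q * X 0 ^ 3 + C c1 * X 0 ^ 2 * X 1 ^ 2 + C c4 * X 0 * X 1 ^ 4 + C c6 * X 1 ^ 6)) * Polynomial.X
      + Polynomial.C (C p⁻¹ * (C s * X 0 ^ 4 * X 1 + C c3 * X 0 ^ 3 * X 1 ^ 3 + C c5 * X 0 ^ 2 * X 1 ^ 5 + C c7 * X 0 * X 1 ^ 7 + C c8 * X 1 ^ 9)), by monicity!, ?_⟩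
    simp only [Polynomial.eval₂_add, Polynomial.eval₂_mul, Polynomial.eval₂_pow, Polynomial.eval₂_X, Polynomial.eval₂_C, hg]
    rw [← map_pow, ← map_pow, ← map_mul, ← map_mul, ← map_add, ← map_add, ← map_add, Ideal.Quotient.eq_zero_iff_mem, Ideal.mem_span_singleton]
    refine ⟨C p⁻¹, ?_⟩
    have hpp : (C p⁻¹ : MvPolynomial (Fin 3) k) * C p = 1 := by rw [← C_mul, inv_mul_cancel₀ hp, C_1]
    rw [hf]
    simp [fexp, MvPolynomial.algebraMap_eq]
    linear_combination (-X 0 ^ 3) * hpp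
  haveI : Algebra.IsIntegral (MvPolynomial (Fin 2) k) (MvPolynomial (Fin 3) k ⧸ Ideal.span {f}) := by
    refine ⟨fun b => ?_⟩
    obtain ⟨a, rfl⟩ := Ideal.Quotient.mk_surjective b
    induction a using MvPolynomial.induction_on with
    | C c => 
      have := isIntegral_algebraMap (R := MvPolynomial (Fin 2) k) (A := MvPolynomial (Fin 3) k ⧸ Ideal.span {f}) (x := C c)
      rw [hg] at this
      simpa using this
    | add a b ha hb => rw [map_add]; exact ha.add hb
    | mul_X a i ha =>
      rw [map_mul]
      refine ha.mul ?_
      fin_cases i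
      · exact hx
      · have := isIntegral_algebraMap (R := MvPolynomial (Fin 2) k) (A := MvPolynomial (Fin 3) k ⧸ Ideal.span {f}) (x := X 0)
        rw [hg] at this
        simpa using this
      · have := isIntegral_algebraMap (R := MvPolynomial (Fin 2) k) (A := MvPolynomial (Fin 3) k ⧸ Ideal.span {f}) (x := X 1)
        rw [hg] at this
        simpa using this
  by_contra hc
  push Not at hc
  apply hP
  apply Ideal.eq_bot_of_comap_eq_bot (R := MvPolynomial (Fin 2) k)
  rw [eq_bot_iff]
  intro φ hφ
  rw [Ideal.mem_bot]
  by_contra h0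
  exact hc φ h0 hφ

lemma alg_mem {K : Type} [Field K] [Algebra k K] (η : K) (Q : Polynomial k) (hQ : Q ≠ 0) (h : Polynomial.aeval η Q = 0) :
    ∃ b : k, algebraMap k K b = η := by
  have h1 : IsAlgebraic k η := ⟨Q, hQ, h⟩
  haveI : Algebra.IsIntegral k (Algebra.adjoin k {η}) := Algebra.IsIntegral.adjoin (by simpa using h1.isIntegral)
  obtain ⟨b, hb⟩ := (IsAlgClosed.algebraMap_bijective_of_isIntegral (k := k) (K := Algebra.adjoin k {η})).2
    ⟨η, Algebra.self_mem_adjoin_singleton k η⟩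
  exact ⟨b, congrArg Subtype.val hb⟩

lemma point_exists (hf : f = fexp p q r s c1 c2 c3 c4 c5 c6 c7 c8) (hp : p ≠ 0) (wf : WH f 9)
    (hirr : Irreducible f) (ℬ : ℕ → Submodule k (MvPolynomial (Fin 3) k ⧸ Ideal.span {f})) [GradedAlgebra ℬ]
    (hℬ : ∀ (i : ℕ) (r : MvPolynomial (Fin 3) k), r.IsWeightedHomogeneous w3 i →
      Ideal.Quotient.mk (Ideal.span {f}) r ∈ ℬ i)
    (P : Ideal (MvPolynomial (Fin 3) k ⧸ Ideal.span {f})) [P.IsPrime] (hP : P ≠ ⊥) (hhom : P.IsHomogeneous ℬ)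
    (hz : Ideal.Quotient.mk (Ideal.span {f}) (X 2) ∉ P) :
    ∃ a b : k, ∀ (N : ℕ) g, WH g (N : ℤ) → (Ideal.Quotient.mk (Ideal.span {f}) g ∈ P ↔ aeval ![a, b, 1] g = 0) := by
  classical
  obtain ⟨φ, hφ0, hφ⟩ := comap_ne p q r s c1 c2 c3 c4 c5 c6 c7 c8 hf hp hirr P hP
  have hwh : ∀ (N : ℕ) (φ : MvPolynomial (Fin 2) k), IsWeightedHomogeneous ![2, 1] φ N →
      WH (aeval ![X 1, X 2] φ : MvPolynomial (Fin 3) k) (N : ℤ) := by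
    intro N φ h
    rw [aeval_def, eval₂_eq']
    apply IsWeightedHomogeneous.sum
    intro d hd
    have hd' := h (MvPolynomial.mem_support_iff.1 hd)
    rw [Finsupp.weight_apply, Finsupp.sum_fintype _ _ (by simp)] at hd'
    simp at hd'
    simp only [Fin.prod_univ_two, MvPolynomial.algebraMap_eq]
    have h1 : WH (X 1 ^ d 0 * X 2 ^ d 1 : MvPolynomial (Fin 3) k) ((d 0 : ℤ) * 2 + (d 1 : ℤ) * 1) :=
      IsWeightedHomogeneous.mul (WH.pow' wh_X1 _) (WH.pow' wh_X2 _)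
    refine WH.cast (IsWeightedHomogeneous.C_mul h1 _) ?_
    rw [← hd']; push_cast; ring
  let ψ : MvPolynomial (Fin 2) k →ₐ[k] (MvPolynomial (Fin 3) k ⧸ Ideal.span {f}) :=
    (Ideal.Quotient.mkₐ k (Ideal.span {f})).comp (aeval ![X 1, X 2])
  have hψ : ∀ N r, IsWeightedHomogeneous ![2, 1] r N → ψ r ∈ ℬ N := by
    intro N r h
    exact hℬ _ _ (wh_of_nat.2 (hwh N r h))
  obtain ⟨N, hN⟩ : ∃ N, weightedHomogeneousComponent ![2, 1] N φ ≠ 0 := by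
    by_contra hc
    push Not at hc
    apply hφ0
    rw [← sum_weightedHomogeneousComponent ![2, 1] φ]
    simp [hc]
  set φN := weightedHomogeneousComponent ![2, 1] N φ with hφN
  have wφN : IsWeightedHomogeneous ![2, 1] φN N := weightedHomogeneousComponent_isWeightedHomogeneous (w := ![2,1]) N φ
  have hφP : ψ φN ∈ P := by
    rw [hφN, ← decomp_gen ℬ _ ψ hψ]
    exact hhom N hφ
  let K := FractionRing ((MvPolynomial (Fin 3) k ⧸ Ideal.span {f}) ⧸ P)
  let ρ : MvPolynomial (Fin 3) k →ₐ[k] K := (Algebra.algHom k ((MvPolynomial (Fin 3) k ⧸ Ideal.span {f}) ⧸ P) K).comp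
    ((Ideal.Quotient.mkₐ k P).comp (Ideal.Quotient.mkₐ k (Ideal.span {f})))
  have hρ : ∀ g, ρ g = 0 ↔ Ideal.Quotient.mk (Ideal.span {f}) g ∈ P := by
    intro g
    rw [← Ideal.Quotient.eq_zero_iff_mem]
    exact map_eq_zero_iff _ (IsFractionRing.injective ((MvPolynomial (Fin 3) k ⧸ Ideal.span {f}) ⧸ P) (FractionRing ((MvPolynomial (Fin 3) k ⧸ Ideal.span {f}) ⧸ P)))
  have hZ : ρ (X 2) ≠ 0 := by rw [Ne, hρ]; exact hz
  have hev : ∀ (N : ℕ) g, WH g (N : ℤ) → ρ g = ρ (X 2) ^ N * aeval ![ρ (X 0) / ρ (X 2) ^ 3, ρ (X 1) / ρ (X 2) ^ 2, 1] g := by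
    intro N g wg
    rw [← aeval_scale wg]
    have : ![ρ (X 0) / ρ (X 2) ^ 3 * ρ (X 2) ^ 3, ρ (X 1) / ρ (X 2) ^ 2 * ρ (X 2) ^ 2, 1 * ρ (X 2)] = fun i => ρ (X i) := by
      funext i
      fin_cases i
      · exact div_mul_cancel₀ _ (pow_ne_zero _ hZ)
      · exact div_mul_cancel₀ _ (pow_ne_zero _ hZ)
      · exact one_mul _
    rw [this]
    exact congrArg (fun h => h g) (MvPolynomial.aeval_unique ρ)
  obtain ⟨b, hb⟩ : ∃ b : k, algebraMap k K b = ρ (X 1) / ρ (X 2) ^ 2 := by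
    refine alg_mem _ (aeval ![0, Polynomial.X, 1] (aeval ![X 1, X 2] φN : MvPolynomial (Fin 3) k)) ?_ ?_
    · have h1 : φN * X 1 ≠ 0 := mul_ne_zero hN (X_ne_zero _)
      obtain ⟨v, hv⟩ : ∃ v, eval v (φN * X 1) ≠ 0 := by
        by_contra hc
        push Not at hc
        exact h1 (MvPolynomial.funext fun v => by rw [hc v, map_zero])
      rw [map_mul, eval_X] at hv
      intro h0
      have h2 := congrArg (Polynomial.eval (v 0 / v 1 ^ 2)) h0
      rw [← Polynomial.coe_aeval_eq_eval, ← AlgHom.comp_apply] at h2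
      have h3 : ((Polynomial.aeval (v 0 / v 1 ^ 2)).comp (aeval ![0, Polynomial.X, 1]) : MvPolynomial (Fin 3) k →ₐ[k] k)
          = aeval ![0, v 0 / v 1 ^ 2, 1] := by
        apply MvPolynomial.algHom_ext
        intro i; fin_cases i <;> simp
      rw [h3] at h2
      have h4 := aeval_scale (hwh N φN wφN) 0 (v 0 / v 1 ^ 2) 1 (v 1)
      rw [h2] at h4
      have hv1 := right_ne_zero_of_mul hv
      simp only [map_zero, mul_zero, div_mul_cancel₀ _ (pow_ne_zero 2 hv1), one_mul, zero_mul] at h4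
      rw [← AlgHom.comp_apply] at h4
      have h5 : ((aeval ![0, v 0, v 1] : MvPolynomial (Fin 3) k →ₐ[k] k).comp (aeval ![X 1, X 2])) = aeval v := by
        apply MvPolynomial.algHom_ext
        intro i; fin_cases i <;> simp
      rw [h5] at h4
      exact left_ne_zero_of_mul hv h4
    · rw [← AlgHom.comp_apply, ← AlgHom.comp_apply]
      have h1 := hev N _ (hwh N φN wφN)
      rw [(hρ (aeval ![X 1, X 2] φN)).2 hφP] at h1
      have h2 := (mul_eq_zero.1 h1.symm).resolve_left (pow_ne_zero _ hZ)
      rw [← AlgHom.comp_apply] at h2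
      rw [← h2]
      congr 1
      apply MvPolynomial.algHom_ext
      intro i; fin_cases i <;> simp
  obtain ⟨a, ha⟩ : ∃ a : k, algebraMap k K a = ρ (X 0) / ρ (X 2) ^ 3 := by
    refine alg_mem _ (aeval ![Polynomial.X, Polynomial.C b, 1] f) ?_ ?_
    · intro h
      have h1 := congrArg (fun Q => Polynomial.coeff Q 3) h
      rw [hf] at h1
      have h2 : (aeval ![Polynomial.X, Polynomial.C b, 1] (fexp p q r s c1 c2 c3 c4 c5 c6 c7 c8) : Polynomial k)
        = Polynomial.C p * Polynomial.X ^ 3 + Polynomial.C (r * b + c2) * Polynomial.X ^ 2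
          + Polynomial.C (q * b ^ 3 + c1 * b ^ 2 + c4 * b + c6) * Polynomial.X
          + Polynomial.C (s * b ^ 4 + c3 * b ^ 3 + c5 * b ^ 2 + c7 * b + c8) := by
        simp [fexp, ← Polynomial.C_eq_algebraMap]
        ring
      rw [h2] at h1
      have h3 : ∀ A B D : k, (Polynomial.C p * Polynomial.X ^ 3 + Polynomial.C A * Polynomial.X ^ 2
          + Polynomial.C B * Polynomial.X + Polynomial.C D).coeff 3 = p := by
        intro A B D
        simp [Polynomial.coeff_X, Polynomial.coeff_C]
      simp only [h3, Polynomial.coeff_zero] at h1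
      exact hp h1
    · have h1 := hev 9 f (by exact_mod_cast wf)
      rw [(hρ _).2 (by rw [Ideal.Quotient.eq_zero_iff_mem.2 (Ideal.mem_span_singleton_self f)]; exact P.zero_mem)] at h1
      have h2 := (mul_eq_zero.1 h1.symm).resolve_left (pow_ne_zero _ hZ)
      rw [← AlgHom.comp_apply, ← h2]
      congr 1
      apply MvPolynomial.algHom_ext
      intro i; fin_cases i <;> simp [hb]
  refine ⟨a, b, fun N g wg => ?_⟩
  rw [← hρ, hev N g wg, ← ha, ← hb, mul_eq_zero, or_iff_right (pow_ne_zero _ hZ)]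
  have : (aeval ![algebraMap k K a, algebraMap k K b, 1] g) = algebraMap k K (aeval ![a, b, 1] g) := by
    rw [← MvPolynomial.aeval_algebraMap_apply]
    congr 2
    funext i; fin_cases i <;> simp
  rw [this]
  exact (FaithfulSMul.algebraMap_eq_zero_iff k K)
end
end P8



section P9
variable {k : Type} [Field k]

lemma quot_rep {f : MvPolynomial (Fin 3) k} (ℬ : ℕ → Submodule k (MvPolynomial (Fin 3) k ⧸ Ideal.span {f})) [GradedAlgebra ℬ]
    (hℬ : ∀ (i : ℕ) (r : MvPolynomial (Fin 3) k), r.IsWeightedHomogeneous w3 i →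
      Ideal.Quotient.mk (Ideal.span {f}) r ∈ ℬ i) {N : ℕ} {b} (hb : b ∈ ℬ N) :
    ∃ g, WH g (N : ℤ) ∧ Ideal.Quotient.mk (Ideal.span {f}) g = b := by
  obtain ⟨r, rfl⟩ := Ideal.Quotient.mk_surjective b
  have h := decomp_gen ℬ w3 (Ideal.Quotient.mkₐ k (Ideal.span {f})) hℬ r N
  refine ⟨weightedHomogeneousComponent w3 N r, wh_of_nat.1 (weightedHomogeneousComponent_isWeightedHomogeneous (w := w3) N r), ?_⟩
  change _ = Ideal.Quotient.mk (Ideal.span {f}) (weightedHomogeneousComponent w3 N r) at h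
  rw [← h]
  exact DirectSum.decompose_of_mem_same ℬ hb

lemma expand3 {g : MvPolynomial (Fin 3) k} {N : ℕ} (wg : WH g (N : ℤ)) (a b : k) :
    ∃ G1 G2, g = C (aeval ![a, b, 1] g) * X 2 ^ N + (X 0 - C a * X 2 ^ 3) * G1 + (X 1 - C b * X 2 ^ 2) * G2 := by
  refine WH.induct (p := fun g => ∃ G1 G2, g = C (aeval ![a, b, 1] g) * X 2 ^ N + (X 0 - C a * X 2 ^ 3) * G1 + (X 1 - C b * X 2 ^ 2) * G2) wg ?_ ?_ ?_
  · exact ⟨0, 0, by simp⟩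
  · rintro g h ⟨G1, G2, hg⟩ ⟨H1, H2, hh⟩
    refine ⟨G1 + H1, G2 + H2, ?_⟩
    rw [map_add, map_add]
    linear_combination hg + hh
  · intro i j l c h
    subst h
    obtain ⟨U, hU⟩ := sub_dvd_pow_sub_pow (X 0 : MvPolynomial (Fin 3) k) (C a * X 2 ^ 3) i
    obtain ⟨V, hV⟩ := sub_dvd_pow_sub_pow (X 1 : MvPolynomial (Fin 3) k) (C b * X 2 ^ 2) j
    refine ⟨C c * U * X 1 ^ j * X 2 ^ l, C c * (C a * X 2 ^ 3) ^ i * V * X 2 ^ l, ?_⟩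
    simp
    linear_combination (C c * X 1 ^ j * X 2 ^ l) * hU + C c * (C a * X 2 ^ 3) ^ i * X 2 ^ l * hV

lemma even_expand {g : MvPolynomial (Fin 3) k} {N : ℕ} (wg : WH g ((2 * N : ℕ) : ℤ)) :
    ∃ c G1 G2 G3, g = C c * X 1 ^ N + X 0 ^ 2 * G1 + X 0 * X 2 * G2 + X 2 ^ 2 * G3 := by
  refine WH.induct (p := fun g => ∃ c G1 G2 G3, g = C c * X 1 ^ N + X 0 ^ 2 * G1 + X 0 * X 2 * G2 + X 2 ^ 2 * G3) wg ?_ ?_ ?_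
  · exact ⟨0, 0, 0, 0, by simp⟩
  · rintro g h ⟨c, G1, G2, G3, hg⟩ ⟨d, H1, H2, H3, hh⟩
    refine ⟨c + d, G1 + H1, G2 + H2, G3 + H3, ?_⟩
    rw [map_add]
    linear_combination hg + hh
  · intro i j l c h
    rcases i with _ | _ | i
    · rcases l with _ | _ | l
      · obtain rfl : j = N := by omega
        exact ⟨c, 0, 0, 0, by ring⟩
      · omega
      · exact ⟨0, 0, 0, C c * X 1 ^ j * X 2 ^ l, by simp; ring⟩
    · rcases l with _ | l
      · omega
      · exact ⟨0, 0, C c * X 1 ^ j * X 2 ^ l, 0, by simp; ring⟩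
    · exact ⟨0, C c * X 0 ^ i * X 1 ^ j * X 2 ^ l, 0, 0, by simp; ring⟩

lemma odd_no {g : MvPolynomial (Fin 3) k} {N : ℕ} (wg : WH g ((2 * N + 1 : ℕ) : ℤ)) :
    ∃ G1 G2, g = X 0 * G1 + X 2 * G2 := by
  refine WH.induct (p := fun g => ∃ G1 G2, g = X 0 * G1 + X 2 * G2) wg ?_ ?_ ?_
  · exact ⟨0, 0, by simp⟩
  · rintro g h ⟨G1, G2, hg⟩ ⟨H1, H2, hh⟩
    exact ⟨G1 + H1, G2 + H2, by linear_combination hg + hh⟩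
  · intro i j l c h
    rcases i with _ | i
    · rcases l with _ | l
      · omega
      · exact ⟨0, C c * X 1 ^ j * X 2 ^ l, by simp; ring⟩
    · exact ⟨C c * X 0 ^ i * X 1 ^ j * X 2 ^ l, 0, by simp; ring⟩

lemma cusp_expand {p q : k} (hp : p ≠ 0) {g : MvPolynomial (Fin 3) k} {N : ℕ} (wg : WH g (N : ℤ)) :
    ∃ c G1 G2 e j, g = C c * X 0 ^ e * X 1 ^ j + X 2 * G1 + (C p * X 0 ^ 2 + C q * X 1 ^ 3) * G2 := by
  have hpp : (C p⁻¹ : MvPolynomial (Fin 3) k) * C p = 1 := by rw [← C_mul, inv_mul_cancel₀ hp, C_1]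
  have key : ∃ e j : ℕ, ∃ c G1 G2, g = C c * X 0 ^ e * X 1 ^ j + X 2 * G1 + (C p * X 0 ^ 2 + C q * X 1 ^ 3) * G2 := by
    refine ⟨N % 2, (N - 3 * (N % 2)) / 2, ?_⟩
    refine WH.induct (p := fun g => ∃ c G1 G2, g = C c * X 0 ^ (N % 2) * X 1 ^ ((N - 3 * (N % 2)) / 2) + X 2 * G1 + (C p * X 0 ^ 2 + C q * X 1 ^ 3) * G2) wg ?_ ?_ ?_
    · exact ⟨0, 0, 0, by simp⟩
    · rintro g h ⟨c, G1, G2, hg⟩ ⟨d, H1, H2, hh⟩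
      exact ⟨c + d, G1 + H1, G2 + H2, by rw [map_add]; linear_combination hg + hh⟩
    · intro i
      induction i using Nat.strong_induction_on with
      | _ i ih =>
        intro j l c h
        rcases l with _ | l
        · by_cases hi : i < 2
          · refine ⟨c, 0, 0, ?_⟩
            have h1 : N % 2 = i := by omega
            have h2 : (N - 3 * (N % 2)) / 2 = j := by omega
            rw [h1] at h2 ⊢
            rw [h2]; ring
          · obtain ⟨i, rfl⟩ : ∃ i', i = i' + 2 := ⟨i - 2, by omega⟩
            obtain ⟨d, G1, G2, hG⟩ := ih i (by omega) (j + 3) 0 (- (p⁻¹ * q * c)) (by omega)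
            refine ⟨d, G1, G2 + C (p⁻¹ * c) * X 0 ^ i * X 1 ^ j, ?_⟩
            simp only [map_neg, map_mul] at hG ⊢
            linear_combination hG - C c * X 0 ^ (i + 2) * X 1 ^ j * hpp
        · exact ⟨0, C c * X 0 ^ i * X 1 ^ j * X 2 ^ l, 0, by simp; ring⟩
  obtain ⟨e, j, c, G1, G2, h⟩ := key
  exact ⟨c, G1, G2, e, j, h⟩

end P9



section P10
variable {k : Type} [Field k]
variable [IsAlgClosed k] [CharZero k] {f : MvPolynomial (Fin 3) k} (p q r s c1 c2 c3 c4 c5 c6 c7 c8 : k)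

lemma f_mk_zero (f : MvPolynomial (Fin 3) k) : Ideal.Quotient.mk (Ideal.span {f}) f = 0 :=
  Ideal.Quotient.eq_zero_iff_mem.2 (Ideal.mem_span_singleton_self f)

lemma sing_main (hf : f = fexp p q r s c1 c2 c3 c4 c5 c6 c7 c8) (hp : p ≠ 0) (hq : q ≠ 0) (wf : WH f 9)
    (hirr : Irreducible f) (ℬ : ℕ → Submodule k (MvPolynomial (Fin 3) k ⧸ Ideal.span {f})) [GradedAlgebra ℬ]
    (hℬ : ∀ (i : ℕ) (r : MvPolynomial (Fin 3) k), r.IsWeightedHomogeneous w3 i →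
      Ideal.Quotient.mk (Ideal.span {f}) r ∈ ℬ i)
    (P : Ideal (MvPolynomial (Fin 3) k ⧸ Ideal.span {f})) [P.IsPrime] (hhom : P.IsHomogeneous ℬ)
    (hirel : ∃ i, Ideal.Quotient.mk (Ideal.span {f}) (X i) ∉ P)
    (hns : ¬ IsRegLocalRing (HomogeneousLocalization.AtPrime ℬ P)) :
    ∃ a b : k, (∀ (N : ℕ) g, WH g (N : ℤ) → (Ideal.Quotient.mk (Ideal.span {f}) g ∈ P ↔ aeval ![a, b, 1] g = 0))
      ∧ aeval ![a, b, 1] f = 0 ∧ ∀ i : Fin 3, aeval ![a, b, 1] (pderiv i f) = 0 := by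
  haveI : (Ideal.span {f}).IsPrime := (Ideal.span_singleton_prime hirr.ne_zero).2 hirr.prime
  set π := Ideal.Quotient.mk (Ideal.span {f}) with hπ
  have hf0 : π f = 0 := f_mk_zero f
  have hfe : f = X 0 * (C p * X 0 ^ 2 + C q * X 1 ^ 3) + X 2 * X 1 * (C r * X 0 ^ 2 + C s * X 1 ^ 3)
    + X 2 ^ 2 * (C c1 * X 0 * X 1 ^ 2 + C c2 * X 0 ^ 2 * X 2 + C c3 * X 1 ^ 3 * X 2
    + C c4 * X 0 * X 1 * X 2 ^ 2 + C c5 * X 1 ^ 2 * X 2 ^ 3 + C c6 * X 0 * X 2 ^ 4 + C c7 * X 1 * X 2 ^ 5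
    + C c8 * X 2 ^ 7) := by rw [hf, fexp]; ring
  have wu : ∀ g (d : ℕ), WH g (d : ℤ) → d < 9 → g ≠ 0 → π g ≠ 0 := by
    intro g d wg hd hg h
    rw [hπ, Ideal.Quotient.eq_zero_iff_mem, Ideal.mem_span_singleton] at h
    exact not_dvd_of_lt wf wg hg (by exact_mod_cast hd) h
  have hmem : ∀ g (d : ℕ), WH g (d : ℤ) → π g ∈ ℬ d := fun g d wg => hℬ d g (wh_of_nat.2 wg)
  have hpm : ∀ g (n : ℕ), π g ∉ P → π (g ^ n) ∉ P := by
    intro g n hg h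
    rw [map_pow] at h
    exact hg (Ideal.IsPrime.mem_of_pow_mem inferInstance n h)
  have w2 : WH (X 2 ^ 2 : MvPolynomial (Fin 3) k) ((2 : ℕ) : ℤ) := WH.cast (WH.pow' wh_X2 2) (by norm_num)
  have w3' : WH (X 2 ^ 3 : MvPolynomial (Fin 3) k) ((3 : ℕ) : ℤ) := WH.cast (WH.pow' wh_X2 3) (by norm_num)
  have qr : ∀ {N : ℕ} {a : MvPolynomial (Fin 3) k ⧸ Ideal.span {f}}, a ∈ ℬ N → ∃ g, WH g (N : ℤ) ∧ π g = a := fun h => quot_rep ℬ hℬ h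
  by_cases hP : P = ⊥
  · exact absurd (hl_field ℬ P hP) hns
  by_cases hz : π (X 2) ∈ P
  · exfalso
    apply hns
    have h1 : π (X 0) * π (C p * X 0 ^ 2 + C q * X 1 ^ 3) ∈ P := by
      have h2 : X 0 * (C p * X 0 ^ 2 + C q * X 1 ^ 3) = f - X 2 * (X 1 * (C r * X 0 ^ 2 + C s * X 1 ^ 3)
        + X 2 * (C c1 * X 0 * X 1 ^ 2 + C c2 * X 0 ^ 2 * X 2 + C c3 * X 1 ^ 3 * X 2
        + C c4 * X 0 * X 1 * X 2 ^ 2 + C c5 * X 1 ^ 2 * X 2 ^ 3 + C c6 * X 0 * X 2 ^ 4 + C c7 * X 1 * X 2 ^ 5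
        + C c8 * X 2 ^ 7)) := by rw [hfe]; ring
      rw [← map_mul, h2, map_sub, hf0, map_mul]
      exact P.sub_mem P.zero_mem (P.mul_mem_right _ hz)
    by_cases hx : π (X 0) ∈ P
    · have hy : π (X 1) ∉ P := by
        intro hy
        obtain ⟨i, hi⟩ := hirel
        fin_cases i
        · exact hi hx
        · exact hi hy
        · exact hi hz
      refine hl_reg ℬ P (hmem _ 2 w2) (hmem _ 2 (by exact_mod_cast wh_X1)) (wu _ 2 w2 (by norm_num) (pow_ne_zero _ (X_ne_zero _)))
        (by rw [map_pow]; exact Ideal.pow_mem_of_mem _ hz _ (by norm_num)) hy ?_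
      rintro N a ha haP ⟨t, ht, htP⟩
      obtain ⟨g, wg, rfl⟩ := qr ha
      obtain ⟨t', wt, rfl⟩ := qr ht
      rcases Nat.even_or_odd' N with ⟨M, rfl | rfl⟩
      · obtain ⟨c, G1, G2, G3, hg⟩ := even_expand wg
        have hc : c = 0 := by
          by_contra hc
          rw [hg] at haP
          simp only [map_add, map_mul, map_pow] at haP
          have h2 : π (C c) * π (X 1) ^ M ∈ P := by
            have h3 : π (X 0) ^ 2 * π G1 + π (X 0) * π (X 2) * π G2 + π (X 2) ^ 2 * π G3 ∈ P := by
              refine P.add_mem (P.add_mem ?_ ?_) ?_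
              · exact P.mul_mem_right _ (Ideal.pow_mem_of_mem _ hx _ (by norm_num))
              · exact P.mul_mem_right _ (P.mul_mem_right _ hx)
              · exact P.mul_mem_right _ (Ideal.pow_mem_of_mem _ hz _ (by norm_num))
            have := P.sub_mem haP h3
            have e : π (C c) * π (X 1) ^ M = π (C c) * π (X 1) ^ M + π (X 0) ^ 2 * π G1 + π (X 0) * π (X 2) * π G2 + π (X 2) ^ 2 * π G3 - (π (X 0) ^ 2 * π G1 + π (X 0) * π (X 2) * π G2 + π (X 2) ^ 2 * π G3) := by ring
            rw [e]; exact this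
          have h4 : π (C c⁻¹) * (π (C c) * π (X 1) ^ M) ∈ P := P.mul_mem_left _ h2
          rw [← mul_assoc, ← map_mul, ← C_mul, inv_mul_cancel₀ hc] at h4
          simp only [C_1, map_one, one_mul] at h4
          exact hy (Ideal.IsPrime.mem_of_pow_mem inferInstance M h4)
        subst hc
        refine ⟨π ((C p * X 0 ^ 2 + C q * X 1 ^ 3) ^ 2), hpm _ _ ?_, ?_⟩
        · intro h
          rw [map_add] at h
          have h2 : π (C p * X 0 ^ 2) ∈ P := by
            rw [map_mul, map_pow]
            exact P.mul_mem_left _ (Ideal.pow_mem_of_mem _ hx _ (by norm_num))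
          have h3 := (P.add_mem_iff_right h2).1 h
          have h4 := P.mul_mem_left (π (C q⁻¹)) h3
          rw [← map_mul, ← mul_assoc, ← C_mul, inv_mul_cancel₀ hq] at h4
          simp only [C_1, one_mul] at h4
          exact hpm _ _ hy h4
        · rw [← map_mul]
          set H := (X 1 * (C r * X 0 ^ 2 + C s * X 1 ^ 3)
            + X 2 * (C c1 * X 0 * X 1 ^ 2 + C c2 * X 0 ^ 2 * X 2 + C c3 * X 1 ^ 3 * X 2
            + C c4 * X 0 * X 1 * X 2 ^ 2 + C c5 * X 1 ^ 2 * X 2 ^ 3 + C c6 * X 0 * X 2 ^ 4 + C c7 * X 1 * X 2 ^ 5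
            + C c8 * X 2 ^ 7) : MvPolynomial (Fin 3) k) with hH
          have hfH : f = X 0 * (C p * X 0 ^ 2 + C q * X 1 ^ 3) + X 2 * H := by rw [hfe, hH]; ring
          set S := (C p * X 0 ^ 2 + C q * X 1 ^ 3 : MvPolynomial (Fin 3) k)
          refine ⟨π (H ^ 2 * G1 - S * H * G2 + S ^ 2 * G3), ?_⟩
          rw [← map_mul]
          have : S ^ 2 * g = X 2 ^ 2 * (H ^ 2 * G1 - S * H * G2 + S ^ 2 * G3) +
            f * ((X 0 * S - X 2 * H) * G1 + S * X 2 * G2) := by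
            rw [hg, hfH]; simp; ring
          rw [this, map_add, map_mul π f, hf0]; simp
      · exfalso
        obtain ⟨G1, G2, hg⟩ := odd_no wt
        apply htP
        rw [hg, map_add, map_mul, map_mul]
        exact P.add_mem (P.mul_mem_right _ hx) (P.mul_mem_right _ hz)
    · have hg0 := (Ideal.IsPrime.mem_or_mem inferInstance h1).resolve_left hx
      have hy : π (X 1) ∉ P := by
        intro hy
        rw [map_add] at hg0
        have h2 : π (C q * X 1 ^ 3) ∈ P := by
          rw [map_mul, map_pow]
          exact P.mul_mem_left _ (Ideal.pow_mem_of_mem _ hy _ (by norm_num))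
        have h3 := (P.add_mem_iff_left h2).1 hg0
        have h4 := P.mul_mem_left (π (C p⁻¹)) h3
        rw [← map_mul, ← mul_assoc, ← C_mul, inv_mul_cancel₀ hp] at h4
        simp only [C_1, one_mul] at h4
        exact hpm _ _ hx h4
      have wzy : WH (X 2 * X 1 : MvPolynomial (Fin 3) k) ((3 : ℕ) : ℤ) :=
        WH.cast (IsWeightedHomogeneous.mul wh_X2 wh_X1) (by norm_num)
      refine hl_reg ℬ P (hmem _ 3 wzy) (hmem _ 3 (by exact_mod_cast wh_X0))
        (wu _ 3 wzy (by norm_num) (mul_ne_zero (X_ne_zero _) (X_ne_zero _)))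
        (by rw [map_mul]; exact P.mul_mem_right _ hz) hx ?_
      rintro N a ha haP -
      obtain ⟨g, wg, rfl⟩ := qr ha
      obtain ⟨c, G1, G2, e, j, hg⟩ := cusp_expand (p := p) (q := q) hp wg
      have hc : c = 0 := by
        by_contra hc
        rw [hg, map_add, map_add, map_mul, map_mul π (X 2), map_mul π (C p * X 0 ^ 2 + C q * X 1 ^ 3)] at haP
        rw [Ideal.add_mem_iff_left _ (P.mul_mem_right _ hg0), Ideal.add_mem_iff_left _ (P.mul_mem_right _ hz)] at haP
        rcases Ideal.IsPrime.mem_or_mem inferInstance haP with h | h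
        · have h4 := P.mul_mem_left (π (C c⁻¹)) h
          rw [← map_mul, ← mul_assoc, ← C_mul, inv_mul_cancel₀ hc] at h4
          simp only [C_1, one_mul] at h4
          exact hpm _ _ hx h4
        · exact hpm _ _ hy h
      subst hc
      refine ⟨π (X 0 * X 1), ?_, ?_⟩
      · rw [map_mul]
        intro h
        rcases Ideal.IsPrime.mem_or_mem inferInstance h with h | h
        · exact hx h
        · exact hy h
      · set H := (C c1 * X 0 * X 1 ^ 2 + C c2 * X 0 ^ 2 * X 2 + C c3 * X 1 ^ 3 * X 2
            + C c4 * X 0 * X 1 * X 2 ^ 2 + C c5 * X 1 ^ 2 * X 2 ^ 3 + C c6 * X 0 * X 2 ^ 4 + C c7 * X 1 * X 2 ^ 5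
            + C c8 * X 2 ^ 7 : MvPolynomial (Fin 3) k) with hH
        refine ⟨π (X 0 * G1 - (X 1 * (C r * X 0 ^ 2 + C s * X 1 ^ 3) + X 2 * H) * G2), ?_⟩
        rw [← map_mul, ← map_mul]
        have : X 0 * X 1 * g = X 2 * X 1 * (X 0 * G1 - (X 1 * (C r * X 0 ^ 2 + C s * X 1 ^ 3) + X 2 * H) * G2)
           + f * (X 1 * G2) := by
          rw [hg, hfe]; simp; ring
        rw [this, map_add, map_mul π f, hf0]; simp
  · obtain ⟨a, b, hab⟩ := point_exists p q r s c1 c2 c3 c4 c5 c6 c7 c8 hf hp wf hirr ℬ hℬ P hP hhom hz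
    have hfab : aeval ![a, b, 1] f = 0 := (hab 9 f (by exact_mod_cast wf)).1 (by rw [← hπ, hf0]; exact P.zero_mem)
    have hev : ∀ g, π g ∈ P → aeval ![a, b, 1] g = 0 := by
      intro g hg
      rw [← sum_weightedHomogeneousComponent w3 g]
      rw [← finsum_mem_univ]
      have : (aeval ![a, b, 1] : MvPolynomial (Fin 3) k →ₐ[k] k) (∑ᶠ (m : ℕ) , weightedHomogeneousComponent w3 m g) = 
         ∑ᶠ (m : ℕ) , (aeval ![a, b, 1] : MvPolynomial (Fin 3) k →ₐ[k] k) (weightedHomogeneousComponent w3 m g) :=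
        AddMonoidHom.map_finsum ((aeval ![a, b, 1] : MvPolynomial (Fin 3) k →ₐ[k] k) : MvPolynomial (Fin 3) k →+ k)
          (weightedHomogeneousComponent_finsupp g)
      rw [finsum_mem_univ, this]
      apply finsum_eq_zero_of_forall_eq_zero
      intro m
      refine (hab m _ (wh_of_nat.1 (weightedHomogeneousComponent_isWeightedHomogeneous (w := w3) m g))).1 ?_
      have h := decomp_gen ℬ w3 (Ideal.Quotient.mkₐ k (Ideal.span {f})) hℬ g m
      change _ = π (weightedHomogeneousComponent w3 m g) at h
      rw [← hπ, ← h]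
      exact hhom m hg
    obtain ⟨F1, F2, hF⟩ := expand3 (N := 9) (by exact_mod_cast wf) a b
    rw [hfab, C_0, zero_mul, zero_add] at hF
    have wy : WH (X 1 - C b * X 2 ^ 2 : MvPolynomial (Fin 3) k) ((2 : ℕ) : ℤ) :=
      IsWeightedHomogeneous.sub (by exact_mod_cast wh_X1) (IsWeightedHomogeneous.C_mul w2 _)
    have wx : WH (X 0 - C a * X 2 ^ 3 : MvPolynomial (Fin 3) k) ((3 : ℕ) : ℤ) :=
      IsWeightedHomogeneous.sub (by exact_mod_cast wh_X0) (IsWeightedHomogeneous.C_mul w3' _)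
    have hy0 : (X 1 - C b * X 2 ^ 2 : MvPolynomial (Fin 3) k) ≠ 0 := by
      intro h
      have := congrArg (aeval ![0, 1, 0] : MvPolynomial (Fin 3) k →ₐ[k] k) h
      simp at this
    have hx0 : (X 0 - C a * X 2 ^ 3 : MvPolynomial (Fin 3) k) ≠ 0 := by
      intro h
      have := congrArg (aeval ![1, 0, 0] : MvPolynomial (Fin 3) k →ₐ[k] k) h
      simp at this
    have hfx : aeval ![a, b, 1] (pderiv 0 f) = 0 := by
      by_contra hne
      apply hns
      have hF1 : π F1 ∉ P := by
        intro h
        have h1 := hev _ h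
        apply hne
        rw [hF]
        simp [pderiv_X, Pi.single_apply]
        simpa [aeval_eq_eval] using h1
      refine hl_reg ℬ P (hmem _ 2 wy) (hmem _ 2 w2) (wu _ 2 wy (by norm_num) hy0)
        ((hab 2 _ wy).2 (by simp)) (hpm _ _ hz) ?_
      rintro N t ht htP -
      obtain ⟨g, wg, rfl⟩ := qr ht
      obtain ⟨G1, G2, hg⟩ := expand3 wg a b
      rw [(hab N g wg).1 htP, C_0, zero_mul, zero_add] at hg
      refine ⟨π F1, hF1, π (F1 * G2 - F2 * G1), ?_⟩
      rw [← map_mul, ← map_mul]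
      have : F1 * g = (X 1 - C b * X 2 ^ 2) * (F1 * G2 - F2 * G1) + f * G1 := by
        rw [hg]; conv_rhs => rw [hF]
        ring
      rw [this, map_add, map_mul π f, hf0]; simp
    have hfy : aeval ![a, b, 1] (pderiv 1 f) = 0 := by
      by_contra hne
      apply hns
      have hF2 : π F2 ∉ P := by
        intro h
        have h1 := hev _ h
        apply hne
        rw [hF]
        simp [pderiv_X, Pi.single_apply]
        simpa [aeval_eq_eval] using h1
      refine hl_reg ℬ P (hmem _ 3 wx) (hmem _ 3 w3') (wu _ 3 wx (by norm_num) hx0)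
        ((hab 3 _ wx).2 (by simp)) (hpm _ _ hz) ?_
      rintro N t ht htP -
      obtain ⟨g, wg, rfl⟩ := qr ht
      obtain ⟨G1, G2, hg⟩ := expand3 wg a b
      rw [(hab N g wg).1 htP, C_0, zero_mul, zero_add] at hg
      refine ⟨π F2, hF2, π (F2 * G1 - F1 * G2), ?_⟩
      rw [← map_mul, ← map_mul]
      have : F2 * g = (X 0 - C a * X 2 ^ 3) * (F2 * G1 - F1 * G2) + f * G2 := by
        rw [hg]; conv_rhs => rw [hF]
        ring
      rw [this, map_add, map_mul π f, hf0]; simp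
    refine ⟨a, b, hab, hfab, ?_⟩
    intro i
    fin_cases i
    · exact hfx
    · exact hfy
    · rw [hf] at hfx hfy hfab
      simp [fexp, pderiv_X, Pi.single_apply] at hfx hfy hfab
      rw [hf]
      simp [fexp, pderiv_X, Pi.single_apply]
      linear_combination 9 * hfab - 3 * a * hfx - 2 * b * hfy

end P10




section P11
variable {k : Type} [Field k]
variable [IsAlgClosed k] [CharZero k] {f : MvPolynomial (Fin 3) k} (p q r s c1 c2 c3 c4 c5 c6 c7 c8 : k)

lemma sing_pt (hf : f = fexp p q r s c1 c2 c3 c4 c5 c6 c7 c8) (hp : p ≠ 0) (hq : q ≠ 0) (wf : WH f 9)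
    (hirr : Irreducible f) (ℬ : ℕ → Submodule k (MvPolynomial (Fin 3) k ⧸ Ideal.span {f})) [GradedAlgebra ℬ]
    (hℬ : ∀ (i : ℕ) (r : MvPolynomial (Fin 3) k), r.IsWeightedHomogeneous w3 i →
      Ideal.Quotient.mk (Ideal.span {f}) r ∈ ℬ i) (x : ProjectiveSpectrum ℬ)
    (hns : ¬ IsRegLocalRing (HomogeneousLocalization.AtPrime ℬ x.asHomogeneousIdeal.toIdeal)) :
    ∃ a b : k, (∀ (N : ℕ) g, WH g (N : ℤ) → (Ideal.Quotient.mk (Ideal.span {f}) g ∈ x.asHomogeneousIdeal.toIdeal ↔ aeval ![a, b, 1] g = 0))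
      ∧ aeval ![a, b, 1] f = 0 ∧ ∀ i : Fin 3, aeval ![a, b, 1] (pderiv i f) = 0 := by
  refine sing_main p q r s c1 c2 c3 c4 c5 c6 c7 c8 hf hp hq wf hirr ℬ hℬ _ x.asHomogeneousIdeal.isHomogeneous ?_ hns
  by_contra! hX
  apply x.not_irrelevant_le
  rw [HomogeneousIdeal.irrelevant_le]
  intro i hi b hb
  obtain ⟨g, wg, rfl⟩ := quot_rep ℬ hℬ hb
  change Ideal.Quotient.mk (Ideal.span {f}) g ∈ x.asHomogeneousIdeal.toIdeal
  refine WH.induct (p := fun g => Ideal.Quotient.mk (Ideal.span {f}) g ∈ x.asHomogeneousIdeal.toIdeal) wg ?_ ?_ ?_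
  · rw [map_zero]; exact Ideal.zero_mem _
  · intro a b ha hb
    rw [map_add]; exact Ideal.add_mem _ ha hb
  · intro a b c d h
    simp only [map_mul, map_pow]
    by_cases ha : a = 0
    · by_cases hb : b = 0
      · have hc : c ≠ 0 := by omega
        exact Ideal.mul_mem_left _ _ (Ideal.pow_mem_of_mem _ (hX 2) _ (Nat.pos_of_ne_zero hc))
      · exact Ideal.mul_mem_right _ _ (Ideal.mul_mem_left _ _ (Ideal.pow_mem_of_mem _ (hX 1) _ (Nat.pos_of_ne_zero hb)))
    · exact Ideal.mul_mem_right _ _ (Ideal.mul_mem_right _ _ (Ideal.mul_mem_left _ _ (Ideal.pow_mem_of_mem _ (hX 0) _ (Nat.pos_of_ne_zero ha))))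

lemma two_points (hf : f = fexp p q r s c1 c2 c3 c4 c5 c6 c7 c8) (hp : p ≠ 0) (hq : q ≠ 0) (wf : WH f 9)
    (hirr : Irreducible f) (hC : CondC2 k f) : ∃ a₁ b₁ a₂ b₂ : k, (a₁, b₁) ≠ (a₂, b₂) ∧
    aeval ![a₁, b₁, 1] f = 0 ∧ aeval ![a₂, b₂, 1] f = 0 ∧
    (∀ i : Fin 3, aeval ![a₁, b₁, 1] (pderiv i f) = 0) ∧
    (∀ i : Fin 3, aeval ![a₂, b₂, 1] (pderiv i f) = 0) := by
  obtain ⟨ℬ, inst, hℬ, x, y, hxy, hx, hy⟩ := hC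
  have tr : ∀ x : AlgebraicGeometry.Proj ℬ, ¬ IsRegLocalRing ((AlgebraicGeometry.Proj ℬ).presheaf.stalk x) →
     ¬ IsRegLocalRing (HomogeneousLocalization.AtPrime ℬ (show ProjectiveSpectrum ℬ from x).asHomogeneousIdeal.toIdeal) :=
    fun x h h' => h (reg_of_equiv (AlgebraicGeometry.Proj.stalkIso ℬ x).commRingCatIsoToRingEquiv.symm h')
  obtain ⟨a₁, b₁, h1, h2, h3⟩ := sing_pt p q r s c1 c2 c3 c4 c5 c6 c7 c8 hf hp hq wf hirr ℬ hℬ x (tr x hx)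
  obtain ⟨a₂, b₂, h1', h2', h3'⟩ := sing_pt p q r s c1 c2 c3 c4 c5 c6 c7 c8 hf hp hq wf hirr ℬ hℬ y (tr y hy)
  refine ⟨a₁, b₁, a₂, b₂, ?_, h2, h2', h3, h3'⟩
  intro he
  obtain ⟨rfl, rfl⟩ := Prod.mk.inj he
  apply hxy
  have hle : ∀ u v : ProjectiveSpectrum ℬ, (∀ (N : ℕ) g, WH g (N : ℤ) → Ideal.Quotient.mk (Ideal.span {f}) g ∈ u.asHomogeneousIdeal.toIdeal →
     Ideal.Quotient.mk (Ideal.span {f}) g ∈ v.asHomogeneousIdeal.toIdeal) → u.asHomogeneousIdeal ≤ v.asHomogeneousIdeal := by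
    classical
    intro u v h t ht
    change t ∈ v.asHomogeneousIdeal.toIdeal
    rw [← DirectSum.sum_support_decompose ℬ t]
    apply sum_mem
    intro N _
    obtain ⟨g, wg, hg⟩ := quot_rep ℬ hℬ (DirectSum.decompose ℬ t N).2
    rw [← hg]
    refine h N g wg ?_
    rw [hg]
    exact u.asHomogeneousIdeal.isHomogeneous N ht
  apply ProjectiveSpectrum.ext
  apply le_antisymm
  · exact hle _ _ fun N g wg hg => (h1' N g wg).2 ((h1 N g wg).1 hg)
  · exact hle _ _ fun N g wg hg => (h1 N g wg).2 ((h1' N g wg).1 hg)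

lemma fx_ne (hf : f = fexp p q r s c1 c2 c3 c4 c5 c6 c7 c8) (hp : p ≠ 0) : pderiv 0 f ≠ 0 := by
  intro h
  have := congrArg (aeval ![1, 0, 0] : MvPolynomial (Fin 3) k →ₐ[k] k) h
  rw [hf] at this
  simp [fexp, pderiv_X, Pi.single_apply] at this
  exact hp this

end P11




section P12
variable {k A : Type} [Field k] [CharZero k] [CommRing A] [Algebra k A]
variable (𝒜 : ℤ → Submodule k A) [GradedAlgebra 𝒜]

def cp (N : ℤ) : A →ₗ[k] A :=
  (𝒜 N).subtype ∘ₗ DirectSum.component k ℤ (fun i => 𝒜 i) N ∘ₗ (DirectSum.decomposeLinearEquiv 𝒜).toLinearMap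

lemma cp_apply (N : ℤ) (a : A) : cp 𝒜 N a = (DirectSum.decompose 𝒜 a N : A) := rfl

lemma cp_mem (N : ℤ) (a : A) : cp 𝒜 N a ∈ 𝒜 N := (DirectSum.decompose 𝒜 a N).2

lemma cp_same {N : ℤ} {a : A} (h : a ∈ 𝒜 N) : cp 𝒜 N a = a := DirectSum.decompose_of_mem_same 𝒜 h

lemma cp_ne {N M : ℤ} {a : A} (h : a ∈ 𝒜 N) (hne : N ≠ M) : cp 𝒜 M a = 0 := DirectSum.decompose_of_mem_ne 𝒜 h hne

lemma cp_mul_left {N : ℤ} {a : A} (h : a ∈ 𝒜 N) (b : A) (M : ℤ) : cp 𝒜 (N + M) (a * b) = a * cp 𝒜 M b :=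
  DirectSum.coe_decompose_mul_add_of_left_mem 𝒜 h

lemma hom_induct {p : A → Prop} (h0 : p 0) (hadd : ∀ a b, p a → p b → p (a + b))
    (hh : ∀ N a, a ∈ 𝒜 N → p a) (a : A) : p a := by
  classical
  rw [← DirectSum.sum_support_decompose 𝒜 a]
  exact Finset.sum_induction _ p hadd h0 fun i _ => hh i _ (DirectSum.decompose 𝒜 a i).2

lemma cp_fin (a : A) : ∃ s : Finset ℤ, (∀ N, N ∉ s → cp 𝒜 N a = 0) ∧ a = ∑ N ∈ s, cp 𝒜 N a := by
  classical
  refine ⟨(DirectSum.decompose 𝒜 a).support, ?_, ?_⟩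
  · intro N hN
    rw [DFinsupp.notMem_support_iff] at hN
    rw [cp_apply, hN]; rfl
  · exact (DirectSum.sum_support_decompose 𝒜 a).symm

lemma eq_of_cp {a b : A} (h : ∀ N, cp 𝒜 N a = cp 𝒜 N b) : a = b := by
  apply (DirectSum.decompose 𝒜).injective
  ext N
  exact h N

/-- linear map given on homogeneous pieces -/
def piece (L : ℤ → A →ₗ[k] A) : A →ₗ[k] A :=
  (DirectSum.toModule k ℤ A (fun N => L N ∘ₗ (𝒜 N).subtype)) ∘ₗ (DirectSum.decomposeLinearEquiv 𝒜).toLinearMap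

lemma piece_apply (L : ℤ → A →ₗ[k] A) {N : ℤ} {a : A} (h : a ∈ 𝒜 N) : piece 𝒜 L a = L N a := by
  simp only [piece, LinearMap.comp_apply, LinearEquiv.coe_coe, DirectSum.decomposeLinearEquiv_apply]
  rw [DirectSum.decompose_of_mem 𝒜 h]
  erw [DirectSum.toModule_lof]
  rfl

lemma piece_leib (L : ℤ → A →ₗ[k] A) (h : ∀ N M a b, a ∈ 𝒜 N → b ∈ 𝒜 M → L (N + M) (a * b) = a * L M b + b * L N a) :
    ∀ a b, piece 𝒜 L (a * b) = a • piece 𝒜 L b + b • piece 𝒜 L a := by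
  intro a b
  simp only [smul_eq_mul]
  refine hom_induct 𝒜 (p := fun a => piece 𝒜 L (a * b) = a * piece 𝒜 L b + b * piece 𝒜 L a) (by simp) ?_ ?_ a
  · intro a a' h1 h2
    rw [add_mul, map_add, map_add, h1, h2]; ring
  · intro N a ha
    refine hom_induct 𝒜 (p := fun b => piece 𝒜 L (a * b) = a * piece 𝒜 L b + b * piece 𝒜 L a) (by simp) ?_ ?_ b
    · intro a a' h1 h2
      rw [mul_add, map_add, map_add, h1, h2]; ring
    · intro M b hb
      rw [piece_apply 𝒜 L (SetLike.mul_mem_graded ha hb), piece_apply 𝒜 L ha, piece_apply 𝒜 L hb]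
      exact h N M a b ha hb

def euler : Derivation k A A := Derivation.mk' (piece 𝒜 (fun N => (N : k) • LinearMap.id)) (by
  apply piece_leib
  intro N M a b _ _
  simp only [LinearMap.smul_apply, LinearMap.id_apply, Int.cast_add, Algebra.mul_smul_comm]
  rw [mul_comm b a, add_smul, add_comm])

lemma euler_apply {N : ℤ} {a : A} (h : a ∈ 𝒜 N) : euler 𝒜 a = (N : k) • a := by
  change piece 𝒜 _ a = _
  rw [piece_apply 𝒜 _ h]; rfl

lemma mem_of_euler {N : ℤ} {a : A} (h : euler 𝒜 a = (N : k) • a) : a ∈ 𝒜 N := by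
  have h1 : ∀ M, cp 𝒜 M (euler 𝒜 a) = (M : k) • cp 𝒜 M a := by
    intro M
    refine hom_induct 𝒜 (p := fun a => cp 𝒜 M (euler 𝒜 a) = (M : k) • cp 𝒜 M a) (by simp) ?_ ?_ a
    · intro a b h1 h2
      rw [map_add, map_add, map_add, h1, h2, smul_add]
    · intro L a ha
      rw [euler_apply 𝒜 ha, map_smul]
      by_cases e : L = M
      · rw [e]
      · rw [cp_ne 𝒜 ha e]; simp
  have h2 : a = cp 𝒜 N a := by
    apply eq_of_cp 𝒜
    intro M
    by_cases e : N = M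
    · subst e; exact (cp_same 𝒜 (cp_mem 𝒜 _ _)).symm
    · rw [cp_ne 𝒜 (cp_mem 𝒜 N a) e]
      have := h1 M
      rw [h, map_smul, ← sub_eq_zero, ← sub_smul] at this
      rcases smul_eq_zero.1 this with h | h
      · exfalso; apply e; exact_mod_cast sub_eq_zero.1 h
      · exact h
  rw [h2]; exact cp_mem 𝒜 N a

def dcomp (D : Derivation k A A) (i : ℤ) : Derivation k A A :=
  Derivation.mk' (piece 𝒜 (fun N => cp 𝒜 (N + i) ∘ₗ (D : A →ₗ[k] A))) (by
  apply piece_leib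
  intro N M a b ha hb
  simp only [LinearMap.comp_apply, Derivation.coeFn_coe, Derivation.leibniz, smul_eq_mul, map_add]
  rw [add_assoc N M i, cp_mul_left 𝒜 ha, ← add_assoc, add_comm N M, add_assoc M N i, cp_mul_left 𝒜 hb])

lemma dcomp_apply (D : Derivation k A A) (i : ℤ) {N : ℤ} {a : A} (h : a ∈ 𝒜 N) :
    dcomp 𝒜 D i a = cp 𝒜 (N + i) (D a) := by
  change piece 𝒜 _ a = _
  rw [piece_apply 𝒜 _ h]; rfl

lemma dcomp_hom (D : Derivation k A A) (i : ℤ) {N : ℤ} {a : A} (h : a ∈ 𝒜 N) :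
    dcomp 𝒜 D i a ∈ 𝒜 (N + i) := by
  rw [dcomp_apply 𝒜 D i h]; exact cp_mem _ _ _

lemma dcomp_iter_hom (D : Derivation k A A) (i : ℤ) {N : ℤ} {a : A} (h : a ∈ 𝒜 N) (j : ℕ) :
    (dcomp 𝒜 D i)^[j] a ∈ 𝒜 (N + j * i) := by
  induction j with
  | zero => simpa using h
  | succ j ih =>
    rw [Function.iterate_succ_apply']
    have := dcomp_hom 𝒜 D i ih
    convert this using 1
    push_cast; congr 1; ring

lemma lnd_of_hom {D : Derivation k A A} (h : ∀ N a, a ∈ 𝒜 N → ∃ j, D^[j] a = 0) : IsLND D := by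
  intro a
  refine hom_induct 𝒜 (p := fun a => ∃ N, D^[N] a = 0) ⟨0, rfl⟩ ?_ h a
  rintro a b ⟨N, hN⟩ ⟨M, hM⟩
  refine ⟨max N M, ?_⟩
  rw [iter_add, iter_zero_of_le D hN (le_max_left N M), iter_zero_of_le D hM (le_max_right N M), add_zero]

theorem deg_preserve (hpos : ∀ N < 0, 𝒜 N = ⊥) (S : Finset A) (hS : Algebra.adjoin k (S : Set A) = ⊤)
    (hSh : ∀ s ∈ S, ∃ N, s ∈ 𝒜 N)
    (rigid : ∀ (m : ℤ) (D : Derivation k A A), IsLND D → (∀ N a, a ∈ 𝒜 N → D a ∈ 𝒜 (N + m)) → D = 0)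
    (D : Derivation k A A) (hB : ∀ a, ∃ B : ℤ, ∀ j, ∀ N > B, cp 𝒜 N (D^[j] a) = 0) {N : ℤ} {a : A} (ha : a ∈ 𝒜 N) :
    D a ∈ 𝒜 N := by
  have hneg : ∀ i < 0, dcomp 𝒜 D i = 0 := by
    intro i hi
    refine rigid i _ (lnd_of_hom 𝒜 ?_) fun N a h => dcomp_hom 𝒜 D i h
    intro N a h
    refine ⟨N.toNat + 1, ?_⟩
    have h1 := dcomp_iter_hom 𝒜 D i h (N.toNat + 1)
    rw [hpos _ (by push_cast; nlinarith [Int.self_le_toNat N, Int.toNat_of_nonneg (show 0 ≤ (N.toNat : ℤ) by positivity)])] at h1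
    simpa using h1
  have hbd : ∃ B : ℕ, ∀ i : ℤ, i > B → dcomp 𝒜 D i = 0 := by
    have h1 : ∀ s ∈ S, ∃ B : ℕ, ∀ i : ℤ, i > B → dcomp 𝒜 D i s = 0 := by
      intro s hs
      obtain ⟨N, hN⟩ := hSh s hs
      obtain ⟨T, hT, _⟩ := cp_fin 𝒜 (D s)
      obtain ⟨B, hB⟩ := T.bddAbove
      refine ⟨(B - N).toNat, fun i hi => ?_⟩
      rw [dcomp_apply 𝒜 D i hN]
      apply hT
      intro h
      have := hB h
      omega
    choose! B hB using h1
    refine ⟨S.sup B, fun i hi => ?_⟩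
    refine Derivation.ext_of_adjoin_eq_top _ hS ?_
    intro s hs
    simp only [Derivation.zero_apply]
    refine hB s hs i (lt_of_le_of_lt ?_ hi)
    exact_mod_cast Finset.le_sup (f := B) hs
  obtain ⟨B, hBd⟩ := hbd
  have hstep : ∀ m : ℤ, 0 < m → (∀ i > m, dcomp 𝒜 D i = 0) → dcomp 𝒜 D m = 0 := by
    intro m hm hi
    have hcp : ∀ b M, (∀ N > M, cp 𝒜 N b = 0) → (∀ N > M + m, cp 𝒜 N (D b) = 0) ∧
        cp 𝒜 (M + m) (D b) = dcomp 𝒜 D m (cp 𝒜 M b) := by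
      intro b M hb
      obtain ⟨T, hT, hsum⟩ := cp_fin 𝒜 b
      have hL : ∀ L, cp 𝒜 L (D b) = ∑ N ∈ T, dcomp 𝒜 D (L - N) (cp 𝒜 N b) := by
        intro L
        conv_lhs => rw [hsum, map_sum, map_sum]
        refine Finset.sum_congr rfl fun N _ => ?_
        rw [dcomp_apply 𝒜 D _ (cp_mem 𝒜 N b)]
        congr 1
        rw [add_sub_cancel]
      constructor
      · intro N hN
        rw [hL]
        apply Finset.sum_eq_zero
        intro L _
        by_cases h : L > M
        · rw [hb L h, map_zero]
        · rw [hi _ (by linarith), Derivation.zero_apply]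
      · rw [hL, Finset.sum_eq_single M]
        · rw [add_sub_cancel_left]
        · intro L _ hLM
          rcases lt_or_gt_of_ne hLM with h | h
          · rw [hi _ (by linarith), Derivation.zero_apply]
          · rw [hb L h, map_zero]
        · intro h
          rw [hT M h, map_zero]
    refine rigid m _ (lnd_of_hom 𝒜 ?_) fun N a h => dcomp_hom 𝒜 D m h
    intro N a h
    have hit : ∀ j : ℕ, (∀ L > N + j * m, cp 𝒜 L (D^[j] a) = 0) ∧ cp 𝒜 (N + j * m) (D^[j] a) = (dcomp 𝒜 D m)^[j] a := by
      intro j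
      induction j with
      | zero =>
        simp only [Nat.cast_zero, zero_mul, add_zero, Function.iterate_zero, id]
        exact ⟨fun L hL => cp_ne 𝒜 h (by omega), cp_same 𝒜 h⟩
      | succ j ih =>
        obtain ⟨h1, h2⟩ := hcp _ _ ih.1
        rw [Function.iterate_succ_apply', Function.iterate_succ_apply', ← ih.2, ← h2]
        have e : N + ((j + 1 : ℕ) : ℤ) * m = N + j * m + m := by push_cast; ring
        rw [e]
        exact ⟨h1, rfl⟩
    obtain ⟨B, hB⟩ := hB a
    refine ⟨(B - N).toNat + 1, ?_⟩
    rw [← (hit _).2]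
    apply hB
    have : B - N ≤ ((B - N).toNat : ℤ) := Int.self_le_toNat _
    push_cast
    nlinarith [Int.natCast_nonneg (B - N).toNat]
  have hpos' : ∀ d : ℕ, ∀ m : ℤ, 0 < m → (B : ℤ) < m + d → dcomp 𝒜 D m = 0 := by
    intro d
    induction d with
    | zero => intro m _ h; exact hBd m (by simpa using h)
    | succ d ih =>
      intro m hm h
      exact hstep m hm fun i hi => ih i (by omega) (by push_cast at h; omega)
  have h0 : D a = cp 𝒜 N (D a) := by
    apply eq_of_cp 𝒜
    intro M
    by_cases e : M = N
    · rw [e, cp_same 𝒜 (cp_mem 𝒜 _ _)]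
    · rw [cp_ne 𝒜 (cp_mem 𝒜 _ _) (Ne.symm e)]
      have : cp 𝒜 M (D a) = dcomp 𝒜 D (M - N) a := by
        rw [dcomp_apply 𝒜 D _ ha, add_sub_cancel]
      rw [this]
      rcases lt_or_gt_of_ne e with h | h
      · rw [hneg _ (by omega), Derivation.zero_apply]
      · rw [hpos' B _ (by omega) (by omega), Derivation.zero_apply]
  rw [h0]; exact cp_mem _ _ _

end P12




section P13
variable {k A : Type} [Field k] [CharZero k] [CommRing A] [Algebra k A]
variable (𝒜 : ℤ → Submodule k A) [GradedAlgebra 𝒜]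

def conjD (D : Derivation k A A) (α : A ≃ₐ[k] A) : Derivation k A A :=
  Derivation.mk' (α.toLinearMap ∘ₗ (D : A →ₗ[k] A) ∘ₗ α.symm.toLinearMap) (by
    intro a b
    simp [Derivation.leibniz])

lemma conjD_apply (D : Derivation k A A) (α : A ≃ₐ[k] A) (a : A) : conjD D α a = α (D (α.symm a)) := rfl

lemma conjD_iter (D : Derivation k A A) (α : A ≃ₐ[k] A) (a : A) (j : ℕ) : (conjD D α)^[j] a = α (D^[j] (α.symm a)) := by
  induction j with
  | zero => simp
  | succ j ih => rw [Function.iterate_succ_apply', ih, conjD_apply, Function.iterate_succ_apply', AlgEquiv.symm_apply_apply]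

lemma euler_iter {N : ℤ} {a : A} (h : a ∈ 𝒜 N) (j : ℕ) : (euler 𝒜)^[j] a = ((N : k) ^ j) • a := by
  induction j with
  | zero => simp
  | succ j ih => rw [Function.iterate_succ_apply', ih, Derivation.map_smul, euler_apply 𝒜 h, smul_smul, pow_succ]

lemma conj_bdd (α : A ≃ₐ[k] A) (a : A) : ∃ B : ℤ, ∀ j, ∀ N > B, cp 𝒜 N ((conjD (euler 𝒜) α)^[j] a) = 0 := by
  obtain ⟨b, rfl⟩ := α.surjective a
  refine hom_induct 𝒜 (p := fun b => ∃ B : ℤ, ∀ j, ∀ N > B, cp 𝒜 N ((conjD (euler 𝒜) α)^[j] (α b)) = 0) ?_ ?_ ?_ b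
  · refine ⟨0, fun j N _ => ?_⟩
    rw [map_zero, iter_zero, map_zero]
  · rintro a b ⟨B1, h1⟩ ⟨B2, h2⟩
    refine ⟨max B1 B2, fun j N h => ?_⟩
    rw [map_add, iter_add, map_add, h1 j N (lt_of_le_of_lt (le_max_left _ _) h), h2 j N (lt_of_le_of_lt (le_max_right _ _) h), add_zero]
  · intro M b hb
    obtain ⟨T, hT, _⟩ := cp_fin 𝒜 (α b)
    obtain ⟨B, hB⟩ := T.bddAbove
    refine ⟨B, fun j N hN => ?_⟩
    rw [conjD_iter, AlgEquiv.symm_apply_apply, euler_iter 𝒜 hb, map_smul, map_smul, hT N, smul_zero]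
    intro h
    exact absurd (hB h) (by omega)

theorem conj_torus (hpos : ∀ N < 0, 𝒜 N = ⊥) (S : Finset A) (hS : Algebra.adjoin k (S : Set A) = ⊤)
    (hSh : ∀ s ∈ S, ∃ N, s ∈ 𝒜 N)
    (rigid : ∀ (m : ℤ) (D : Derivation k A A), IsLND D → (∀ N a, a ∈ 𝒜 N → D a ∈ 𝒜 (N + m)) → D = 0)
    (α : A ≃ₐ[k] A) (φ : A →ₐ[k] A) (c : ℤ → k) (hφ : ∀ N a, a ∈ 𝒜 N → φ a = c N • a) {N : ℤ} {a : A} (ha : a ∈ 𝒜 N) :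
    α (φ (α.symm a)) ∈ 𝒜 N := by
  have h1 : ∀ M b, b ∈ 𝒜 M → α.symm (euler 𝒜 (α b)) ∈ 𝒜 M := by
    intro M b hb
    exact deg_preserve 𝒜 hpos S hS hSh rigid (conjD (euler 𝒜) α.symm) (conj_bdd 𝒜 α.symm) hb
  have h2 : ∀ b, φ (α.symm (euler 𝒜 (α b))) = α.symm (euler 𝒜 (α (φ b))) := by
    intro b
    refine hom_induct 𝒜 (p := fun b => φ (α.symm (euler 𝒜 (α b))) = α.symm (euler 𝒜 (α (φ b)))) (by simp) ?_ ?_ b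
    · intro a b ha hb
      simp only [map_add] at ha hb ⊢
      rw [ha, hb]
    · intro M b hb
      rw [hφ M _ (h1 M b hb), hφ M b hb]
      simp only [map_smul, Derivation.map_smul]
  apply mem_of_euler
  have h3 := h2 (α.symm a)
  rw [AlgEquiv.apply_symm_apply, euler_apply 𝒜 ha] at h3
  have h4 := congrArg α h3
  rw [AlgEquiv.apply_symm_apply] at h4
  rw [← h4]
  simp only [map_smul]

end P13




section P14
variable {k : Type} [Field k] (f : MvPolynomial (Fin 3) k) (n : ℕ)

def u4 (n : ℕ) : Fin 4 → ℤ := ![3 * n, 2 * n, n, 9]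

def gA (N : ℤ) : Submodule k (QuotRingPlus k f n) :=
  (weightedHomogeneousSubmodule k (u4 n) N).map (Ideal.Quotient.mkₐ k (relIdealPlus k f n)).toLinearMap

lemma mem_gA {N : ℤ} {a : QuotRingPlus k f n} :
    a ∈ gA f n N ↔ ∃ p, IsWeightedHomogeneous (u4 n) p N ∧ Ideal.Quotient.mk (relIdealPlus k f n) p = a := by
  rw [gA, Submodule.mem_map]
  rfl

instance gA_gm : SetLike.GradedMonoid (gA f n) where
  one_mem := (mem_gA f n).2 ⟨1, isWeightedHomogeneous_one k _, map_one _⟩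
  mul_mem := by
    intro i j a b ha hb
    obtain ⟨p, hp, rfl⟩ := (mem_gA f n).1 ha
    obtain ⟨q, hq, rfl⟩ := (mem_gA f n).1 hb
    exact (mem_gA f n).2 ⟨p * q, hp.mul hq, map_mul _ _ _⟩

lemma gen_mem (i : Fin 4) : genPlus k f n i ∈ gA f n (u4 n i) :=
  (mem_gA f n).2 ⟨X i, isWeightedHomogeneous_X k _ i, rfl⟩

lemma rename_wh {r : MvPolynomial (Fin 3) k} {N : ℤ} (h : WH r N) :
    IsWeightedHomogeneous (u4 n) (rename Fin.castSucc r) (n * N) := by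
  rw [r.as_sum, map_sum]
  apply IsWeightedHomogeneous.sum
  intro d hd
  have h1 := h (mem_support_iff.1 hd)
  rw [rename_monomial]
  apply isWeightedHomogeneous_monomial
  rw [weight_u3] at h1
  rw [Finsupp.weight_apply, Finsupp.sum_mapDomain_index (by simp) (by intros; rw [add_smul]), Finsupp.sum_fintype _ _ (by simp),
    Fin.sum_univ_three, ← h1]
  simp [u4]
  ring

lemma rel_wh (wf : WH f 9) : IsWeightedHomogeneous (u4 n) ((X 3 : MvPolynomial (Fin 4) k) ^ n + rename Fin.castSucc f) (n * 9) := by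
  apply IsWeightedHomogeneous.add
  · have := (isWeightedHomogeneous_X k (u4 n) 3).pow n
    simpa [u4] using this
  · exact rename_wh n wf

def ofGen (i : Fin 4) : DirectSum ℤ (fun i => gA f n i) := DirectSum.of (fun i => gA f n i) (u4 n i) ⟨genPlus k f n i, gen_mem f n i⟩

def QQ (p : MvPolynomial (Fin 4) k) (N : ℤ) : Prop :=
  ∃ h : Ideal.Quotient.mk (relIdealPlus k f n) p ∈ gA f n N, aeval (ofGen f n) p = DirectSum.of (fun i => gA f n i) N ⟨_, h⟩

lemma QQ_mul {p q : MvPolynomial (Fin 4) k} {N M : ℤ} (hp : QQ f n p N) (hq : QQ f n q M) : QQ f n (p * q) (N + M) := by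
  obtain ⟨h1, h2⟩ := hp
  obtain ⟨h3, h4⟩ := hq
  refine ⟨by rw [map_mul]; exact SetLike.mul_mem_graded h1 h3, ?_⟩
  rw [map_mul, h2, h4, DirectSum.of_mul_of]
  rfl

lemma QQ_add {p q : MvPolynomial (Fin 4) k} {N : ℤ} (hp : QQ f n p N) (hq : QQ f n q N) : QQ f n (p + q) N := by
  obtain ⟨h1, h2⟩ := hp
  obtain ⟨h3, h4⟩ := hq
  refine ⟨by rw [map_add]; exact Submodule.add_mem _ h1 h3, ?_⟩
  rw [map_add, h2, h4, ← map_add]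
  rfl

lemma QQ_zero {N : ℤ} : QQ f n 0 N := by
  refine ⟨by rw [map_zero]; exact Submodule.zero_mem _, ?_⟩
  rw [map_zero]
  exact (map_zero _).symm

lemma QQ_C (c : k) : QQ f n (C c) 0 := by
  refine ⟨(mem_gA f n).2 ⟨_, isWeightedHomogeneous_C _ c, rfl⟩, ?_⟩
  rw [aeval_C, DirectSum.algebraMap_apply]
  rfl

lemma QQ_X (i : Fin 4) : QQ f n (X i) (u4 n i) := by
  refine ⟨gen_mem f n i, ?_⟩
  rw [aeval_X]
  rfl

lemma QQ_pow {p : MvPolynomial (Fin 4) k} {N : ℤ} (hp : QQ f n p N) (j : ℕ) : QQ f n (p ^ j) (j * N) := by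
  induction j with
  | zero => simpa using QQ_C f n 1
  | succ j ih =>
    have := QQ_mul f n ih hp
    rw [pow_succ]
    convert this using 1
    push_cast; ring

lemma weight_u4 (d : Fin 4 →₀ ℕ) : Finsupp.weight (u4 n) d = d 0 * (3 * n) + d 1 * (2 * n) + d 2 * n + d 3 * 9 := by
  rw [Finsupp.weight_apply, Finsupp.sum_fintype _ _ (by simp), Fin.sum_univ_four]
  simp [u4]

lemma mono4 (d : Fin 4 →₀ ℕ) (c : k) : monomial d c = C c * X 0 ^ d 0 * X 1 ^ d 1 * X 2 ^ d 2 * X 3 ^ d 3 := by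
  rw [monomial_eq, Finsupp.prod_fintype _ _ (by simp), Fin.prod_univ_four]
  ring

lemma ofGen_monomial (d : Fin 4 →₀ ℕ) (c : k) : QQ f n (monomial d c) (Finsupp.weight (u4 n) d) := by
  have := QQ_mul f n (QQ_mul f n (QQ_mul f n (QQ_mul f n (QQ_C f n c) (QQ_pow f n (QQ_X f n 0) (d 0)))
    (QQ_pow f n (QQ_X f n 1) (d 1))) (QQ_pow f n (QQ_X f n 2) (d 2))) (QQ_pow f n (QQ_X f n 3) (d 3))
  rw [mono4]
  convert this using 1
  rw [weight_u4]
  simp [u4]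

lemma ofGen_wh' {p : MvPolynomial (Fin 4) k} {N : ℤ} (hp : IsWeightedHomogeneous (u4 n) p N) : QQ f n p N := by
  rw [p.as_sum]
  refine Finset.sum_induction _ (fun p => QQ f n p N) (fun a b => QQ_add f n) (QQ_zero f n) ?_
  intro d hd
  have := hp (mem_support_iff.1 hd)
  rw [← this]
  exact ofGen_monomial f n d _

lemma ofGen_wh {p : MvPolynomial (Fin 4) k} {N : ℤ} (hp : IsWeightedHomogeneous (u4 n) p N) :
    aeval (ofGen f n) p = DirectSum.of (fun i => gA f n i) N ⟨_, (mem_gA f n).2 ⟨p, hp, rfl⟩⟩ :=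
  (ofGen_wh' f n hp).2

def liftA {B : Type} [CommRing B] [Algebra k B] (b : Fin 4 → B) (h : aeval b ((X 3 : MvPolynomial (Fin 4) k) ^ n + rename Fin.castSucc f) = 0) :
    QuotRingPlus k f n →ₐ[k] B :=
  Ideal.Quotient.liftₐ (relIdealPlus k f n) (aeval b) (by
    intro a ha
    obtain ⟨c, rfl⟩ := Ideal.mem_span_singleton.1 ha
    rw [map_mul, h, zero_mul])

lemma liftA_mk {B : Type} [CommRing B] [Algebra k B] (b : Fin 4 → B) (h) (p) :
    liftA f n b h (Ideal.Quotient.mk (relIdealPlus k f n) p) = aeval b p := rfl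

lemma liftA_gen {B : Type} [CommRing B] [Algebra k B] (b : Fin 4 → B) (h) (i) :
    liftA f n b h (genPlus k f n i) = b i := by
  rw [genPlus, liftA_mk, aeval_X]

lemma algHom_extA {B : Type} [CommRing B] [Algebra k B] {φ ψ : QuotRingPlus k f n →ₐ[k] B}
   (h : ∀ i, φ (genPlus k f n i) = ψ (genPlus k f n i)) : φ = ψ := by
  apply Ideal.Quotient.algHom_ext
  apply MvPolynomial.algHom_ext
  intro i
  exact h i

@[reducible] def gradA (wf : WH f 9) : GradedAlgebra (gA f n) :=
  GradedAlgebra.ofAlgHom (gA f n) (liftA f n (ofGen f n) (by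
    rw [ofGen_wh f n (rel_wh f n wf)]
    refine (congrArg (DirectSum.of (fun i => gA f n i) ((n : ℤ) * 9)) (show _ = (0 : gA f n ((n : ℤ) * 9)) from Subtype.ext ?_)).trans (map_zero (DirectSum.of (fun i => gA f n i) ((n : ℤ) * 9)))
    refine Ideal.Quotient.eq_zero_iff_mem.2 ?_
    exact Ideal.mem_span_singleton_self _)) (by
    apply algHom_extA
    intro i
    rw [AlgHom.comp_apply, liftA_gen, ofGen, DirectSum.coeAlgHom_of]
    rfl) (by
    rintro N ⟨a, ha⟩
    obtain ⟨p, hp, rfl⟩ := (mem_gA f n).1 ha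
    exact ofGen_wh f n hp)

end P14




section P15
variable {k : Type} [Field k] (f : MvPolynomial (Fin 3) k) (n : ℕ)

def iA : MvPolynomial (Fin 3) k →ₐ[k] QuotRingPlus k f n :=
  (Ideal.Quotient.mkₐ k (relIdealPlus k f n)).comp (rename Fin.castSucc)

lemma iA_apply (r) : iA f n r = Ideal.Quotient.mk (relIdealPlus k f n) (rename Fin.castSucc r) := rfl

lemma iA_X (i : Fin 3) : iA f n (X i) = genPlus k f n i.castSucc := by
  rw [iA_apply, rename_X]; rfl

lemma wA_pow : (genPlus k f n 3) ^ n = - iA f n f := by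
  rw [eq_neg_iff_add_eq_zero, iA_apply, genPlus, ← map_pow, ← map_add, Ideal.Quotient.eq_zero_iff_mem]
  exact Ideal.mem_span_singleton_self _

lemma eis (hirr : Irreducible f) (hn : 0 < n) : Prime ((Polynomial.X ^ n + Polynomial.C f : Polynomial (MvPolynomial (Fin 3) k))) := by
  have hm : (Polynomial.X ^ n + Polynomial.C f : Polynomial (MvPolynomial (Fin 3) k)).Monic :=
    Polynomial.monic_X_pow_add_C f hn.ne'
  have hd : (Polynomial.X ^ n + Polynomial.C f : Polynomial (MvPolynomial (Fin 3) k)).degree = n :=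
    Polynomial.degree_X_pow_add_C hn f
  apply Irreducible.prime
  have hP : (Ideal.span {f}).IsPrime := (Ideal.span_singleton_prime hirr.ne_zero).2 hirr.prime
  refine Polynomial.irreducible_of_eisenstein_criterion hP ?_ ?_ ?_ ?_ hm.isPrimitive
  · rw [hm.leadingCoeff]
    intro h
    exact hP.ne_top ((Ideal.eq_top_iff_one _).2 h)
  · intro m hmn
    rw [hd] at hmn
    have hmn' : m < n := by exact_mod_cast hmn
    rw [Polynomial.coeff_add, Polynomial.coeff_X_pow, if_neg hmn'.ne, zero_add, Polynomial.coeff_C]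
    split_ifs
    · exact Ideal.mem_span_singleton_self f
    · exact Ideal.zero_mem _
  · rw [hd]; exact_mod_cast hn
  · rw [Polynomial.coeff_add, Polynomial.coeff_X_pow, if_neg hn.ne, zero_add, Polynomial.coeff_C_zero,
      Ideal.span_singleton_pow, Ideal.mem_span_singleton]
    rintro ⟨c, hc⟩
    have h1 : f * 1 = f * (f * c) := by rw [mul_one, ← mul_assoc, ← pow_two]; exact hc
    exact hirr.not_isUnit (IsUnit.of_mul_eq_one c (mul_left_cancel₀ hirr.ne_zero h1).symm)

abbrev gP : Polynomial (MvPolynomial (Fin 3) k) := Polynomial.X ^ n + Polynomial.C f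

lemma th_rename (r : MvPolynomial (Fin 3) k) :
   aeval (![AdjoinRoot.of (gP f n) (X 0), AdjoinRoot.of (gP f n) (X 1), AdjoinRoot.of (gP f n) (X 2), AdjoinRoot.root (gP f n)])
     (rename Fin.castSucc r) = AdjoinRoot.of (gP f n) r := by
  rw [aeval_rename]
  have : (aeval ((![AdjoinRoot.of (gP f n) (X 0), AdjoinRoot.of (gP f n) (X 1), AdjoinRoot.of (gP f n) (X 2), AdjoinRoot.root (gP f n)]) ∘ Fin.castSucc)
    : MvPolynomial (Fin 3) k →ₐ[k] AdjoinRoot (gP f n)) = (IsScalarTower.toAlgHom k (MvPolynomial (Fin 3) k) (AdjoinRoot (gP f n))) := by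
    apply MvPolynomial.algHom_ext
    intro i
    rw [aeval_X]
    fin_cases i <;> rfl
  rw [this]; rfl

def thA : QuotRingPlus k f n →ₐ[k] AdjoinRoot (gP f n) :=
  liftA f n (![AdjoinRoot.of (gP f n) (X 0), AdjoinRoot.of (gP f n) (X 1), AdjoinRoot.of (gP f n) (X 2), AdjoinRoot.root (gP f n)]) (by
    rw [map_add, map_pow, aeval_X, th_rename]
    have := AdjoinRoot.mk_self (f := gP f n)
    rw [map_add, map_pow, AdjoinRoot.mk_X, AdjoinRoot.mk_C] at this
    exact this)

lemma thA_iA (r) : thA f n (iA f n r) = AdjoinRoot.of (gP f n) r := by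
  rw [iA_apply, thA, liftA_mk, th_rename]

lemma thA_inj : Function.Injective (thA f n) := by
  let ψ : AdjoinRoot (gP f n) →+* QuotRingPlus k f n := AdjoinRoot.lift (iA f n : MvPolynomial (Fin 3) k →+* QuotRingPlus k f n) (genPlus k f n 3) (by
    rw [Polynomial.eval₂_add, Polynomial.eval₂_pow, Polynomial.eval₂_X, Polynomial.eval₂_C, wA_pow]
    exact neg_add_cancel _)
  have : ψ.comp (thA f n : QuotRingPlus k f n →+* AdjoinRoot (gP f n)) = RingHom.id _ := by
    apply Ideal.Quotient.ringHom_ext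
    apply MvPolynomial.ringHom_ext
    · intro c
      change ψ (thA f n (algebraMap k _ c)) = algebraMap k _ c
      rw [AlgHom.commutes]
      change AdjoinRoot.lift _ _ _ (AdjoinRoot.of _ (C c)) = _
      rw [AdjoinRoot.lift_of]
      exact (iA f n).commutes c
    · intro i
      change ψ (thA f n (genPlus k f n i)) = genPlus k f n i
      rw [thA, liftA_gen]
      fin_cases i
      · exact (AdjoinRoot.lift_of _).trans (iA_X f n 0)
      · exact (AdjoinRoot.lift_of _).trans (iA_X f n 1)
      · exact (AdjoinRoot.lift_of _).trans (iA_X f n 2)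
      · exact AdjoinRoot.lift_root _
  exact Function.LeftInverse.injective (g := ψ) fun a => congrArg (fun φ : QuotRingPlus k f n →+* QuotRingPlus k f n => φ a) this

lemma domA (hirr : Irreducible f) (hn : 0 < n) : IsDomain (QuotRingPlus k f n) := by
  haveI : IsDomain (AdjoinRoot (gP f n)) := AdjoinRoot.isDomain_of_prime (eis f n hirr hn)
  exact (thA_inj f n).isDomain (thA f n : QuotRingPlus k f n →+* AdjoinRoot (gP f n))

lemma iA_inj (hn : 0 < n) : Function.Injective (iA f n) := by
  rw [injective_iff_map_eq_zero]
  intro r hr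
  have h := thA_iA f n r
  rw [hr, map_zero] at h
  have h' : AdjoinRoot.mk (gP f n) (Polynomial.C r) = 0 := h.symm
  rw [AdjoinRoot.mk_eq_zero] at h'
  by_contra hne
  refine (Polynomial.monic_X_pow_add_C f hn.ne').not_dvd_of_degree_lt (Polynomial.C_ne_zero.2 hne) ?_ h'
  rw [Polynomial.degree_X_pow_add_C hn f, Polynomial.degree_C hne]
  exact_mod_cast hn

lemma F2 {n : ℕ} (hn3 : ¬ 3 ∣ n) (wf : WH f 9) {i : ℕ} (hi : i < n) {d : ℤ} {a : QuotRingPlus k f n} (ha : a ∈ gA f n (n * d + 9 * i)) :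
    ∃ r, WH r d ∧ a = iA f n r * (genPlus k f n 3) ^ i := by
  obtain ⟨p, hp, rfl⟩ := (mem_gA f n).1 ha
  have hnp : 0 < n := by omega
  have hcop : Nat.Coprime n 9 := by
    have : Nat.Coprime 3 n := (Nat.Prime.coprime_iff_not_dvd Nat.prime_three).2 hn3
    exact (Nat.Coprime.pow_left 2 this).symm
  rw [p.as_sum]
  refine Finset.sum_induction _ (fun p => ∃ r, WH r d ∧ Ideal.Quotient.mk (relIdealPlus k f n) p = iA f n r * (genPlus k f n 3) ^ i) ?_ ?_ ?_
  · rintro a b ⟨r, wr, hr⟩ ⟨s, ws, hs⟩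
    exact ⟨r + s, wr.add ws, by rw [map_add, hr, hs, map_add, add_mul]⟩
  · exact ⟨0, isWeightedHomogeneous_zero _ _ _, by simp⟩
  · intro e he
    have hw := hp (mem_support_iff.1 he)
    rw [weight_u4] at hw
    have hmod : e 3 % n = i := by
      have h1 : (n : ℤ) ∣ 9 * ((e 3 : ℤ) - i) := ⟨d - (e 0 * 3 + e 1 * 2 + e 2), by linear_combination hw⟩
      have h2 : (n : ℤ) ∣ (e 3 : ℤ) - i := by
        refine IsCoprime.dvd_of_dvd_mul_left ?_ h1
        exact_mod_cast Nat.isCoprime_iff_coprime.2 hcop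
      have h3 : e 3 ≡ i [MOD n] := ((Nat.modEq_iff_dvd).2 h2).symm
      rw [← Nat.mod_eq_of_lt hi]; exact h3
    obtain ⟨t, ht⟩ : ∃ t, e 3 = n * t + i := ⟨e 3 / n, by rw [← hmod, Nat.div_add_mod]⟩
    have hn0 : (n : ℤ) ≠ 0 := by exact_mod_cast hnp.ne'
    refine ⟨C (coeff e p) * X 0 ^ e 0 * X 1 ^ e 1 * X 2 ^ e 2 * (C ((-1) ^ t) * f ^ t), ?_, ?_⟩
    · have w1 := IsWeightedHomogeneous.mul (IsWeightedHomogeneous.mul (IsWeightedHomogeneous.mul (IsWeightedHomogeneous.C_mul (WH.pow' (wh_X0 (k := k)) (e 0)) (coeff e p)) (WH.pow' wh_X1 (e 1))) (WH.pow' wh_X2 (e 2))) (IsWeightedHomogeneous.C_mul (WH.pow' wf t) ((-1)^t))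
      refine WH.cast w1 ?_
      apply mul_left_cancel₀ hn0
      rw [ht] at hw
      push_cast at hw
      linear_combination hw
    · rw [mono4, ht]
      simp only [map_mul, map_pow]
      have hC : ∀ c, Ideal.Quotient.mk (relIdealPlus k f n) (C c) = iA f n (C c) := by
        intro c; rw [iA_apply, rename_C]
      have hw : (genPlus k f n 3) ^ (n * t + i) = (iA f n (C ((-1) ^ t)) * iA f n f ^ t) * genPlus k f n 3 ^ i := by
        rw [pow_add, pow_mul, wA_pow]
        simp only [map_pow, map_neg, map_one]
        rw [neg_pow (iA f n f) t]
      rw [iA_X, iA_X, iA_X, hC]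
      change _ * genPlus k f n 0 ^ _ * genPlus k f n 1 ^ _ * genPlus k f n 2 ^ _ * genPlus k f n 3 ^ _ = _
      rw [hw]
      change _ = iA f n (C _) * genPlus k f n 0 ^ _ * genPlus k f n 1 ^ _ * genPlus k f n 2 ^ _ * _ * _
      rw [map_pow C, map_pow (iA f n)]
      ring

end P15




section P16
variable {k : Type} [Field k] [CharZero k] (f : MvPolynomial (Fin 3) k) {n : ℕ}

lemma w_ne (hf : f ≠ 0) (hn : 0 < n) : genPlus k f n 3 ≠ 0 := by
  intro h
  have := wA_pow f n
  rw [h, zero_pow hn.ne'] at this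
  exact hf (iA_inj f n hn (by rw [map_zero, ← neg_eq_zero]; exact this.symm))

lemma cop9 (hn3 : ¬ 3 ∣ n) : IsCoprime (n : ℤ) 9 := by
  have : Nat.Coprime 3 n := (Nat.Prime.coprime_iff_not_dvd Nat.prime_three).2 hn3
  have h2 : Nat.Coprime n 9 := (Nat.Coprime.pow_left 2 this).symm
  exact_mod_cast Nat.isCoprime_iff_coprime.2 h2

lemma split_deg (hn3 : ¬ 3 ∣ n) (hn : 0 < n) (m : ℤ) : ∃ (i : ℕ) (e : ℤ), i < n ∧ m = n * e + 9 * i := by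
  obtain ⟨u, v, huv⟩ := cop9 hn3
  have hn' : (0:ℤ) < n := by exact_mod_cast hn
  have h0 := Int.emod_nonneg (v * m) hn'.ne'
  have h1 := Int.emod_lt_of_pos (v * m) hn'
  have h2 := Int.emod_add_mul_ediv (v * m) n
  obtain ⟨i, hi⟩ := Int.eq_ofNat_of_zero_le h0
  refine ⟨i, u * m + 9 * ((v * m) / n), ?_, ?_⟩
  · rw [hi] at h1; exact_mod_cast h1
  · rw [← hi]; linear_combination (-m) * huv - 9 * h2

lemma der_iA (D : Derivation k (QuotRingPlus k f n) (QuotRingPlus k f n)) (i : ℕ)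
    (δ : Derivation k (MvPolynomial (Fin 3) k) (MvPolynomial (Fin 3) k))
    (h : ∀ j, D (iA f n (X j)) = iA f n (δ (X j)) * genPlus k f n 3 ^ i) (r) :
    D (iA f n r) = iA f n (δ r) * genPlus k f n 3 ^ i := by
  induction r using MvPolynomial.induction_on with
  | C c =>
    have : iA f n (C c) = algebraMap k _ c := (iA f n).commutes c
    rw [this, Derivation.map_algebraMap]
    have h2 : δ (C c) = 0 := Derivation.map_algebraMap δ c
    rw [h2, map_zero, zero_mul]
  | add p q hp hq => rw [map_add, map_add, map_add, map_add, hp, hq, add_mul]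
  | mul_X p j hp =>
    rw [map_mul, Derivation.leibniz, Derivation.leibniz, hp, h]
    simp only [smul_eq_mul, map_add, map_mul]
    ring

lemma adjA : Algebra.adjoin k (Set.range (genPlus k f n)) = ⊤ := by
  rw [eq_top_iff]
  rintro a -
  obtain ⟨p, rfl⟩ := Ideal.Quotient.mk_surjective a
  have : Ideal.Quotient.mk (relIdealPlus k f n) p = aeval (genPlus k f n) p := by
    have : (Ideal.Quotient.mkₐ k (relIdealPlus k f n)) = aeval (genPlus k f n) := by
      apply MvPolynomial.algHom_ext
      intro i
      rw [aeval_X]; rfl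
    exact congrArg (fun φ : MvPolynomial (Fin 4) k →ₐ[k] QuotRingPlus k f n => φ p) this
  rw [this, Algebra.adjoin_range_eq_range_aeval]
  exact ⟨p, rfl⟩

lemma der_extA (D : Derivation k (QuotRingPlus k f n) (QuotRingPlus k f n)) (h : ∀ i, D (genPlus k f n i) = 0) : D = 0 := by
  apply Derivation.ext_of_adjoin_eq_top _ (adjA f)
  rintro _ ⟨i, rfl⟩
  rw [h i]; rfl

lemma gA_neg (N : ℤ) (hN : N < 0) : gA f n N = ⊥ := by
  rw [eq_bot_iff]
  intro a ha
  obtain ⟨p, hp, rfl⟩ := (mem_gA f n).1 ha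
  have : p = 0 := by
    by_contra hr
    obtain ⟨d, hd⟩ := MvPolynomial.ne_zero_iff.1 hr
    have := hp hd
    rw [weight_u4] at this
    have : (0:ℤ) ≤ d 0 * (3 * n) + d 1 * (2 * n) + d 2 * n + d 3 * 9 := by positivity
    omega
  rw [this, map_zero]; exact Submodule.zero_mem _

theorem rigidA (hirr : Irreducible f) (wf : WH f 9) (hn2 : 2 ≤ n) (hn3 : ¬ 3 ∣ n)
    (no : ∀ (δ : Derivation k (MvPolynomial (Fin 3) k) (MvPolynomial (Fin 3) k)) (e : ℤ), IsLND δ → HomDer δ e → δ (δ f) = 0 → δ = 0)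
    (m : ℤ) (D : Derivation k (QuotRingPlus k f n) (QuotRingPlus k f n)) (hD : IsLND D)
    (hom : ∀ N a, a ∈ gA f n N → D a ∈ gA f n (N + m)) : D = 0 := by
  have hn : 0 < n := by omega
  haveI := domA f n hirr hn
  have hw := w_ne f hirr.ne_zero hn
  obtain ⟨i, e, hi, hm⟩ := split_deg hn3 hn m
  have hs : ∀ j : Fin 3, ∃ r, WH r (u3 j + e) ∧ D (iA f n (X j)) = iA f n r * genPlus k f n 3 ^ i := by
    intro j
    apply F2 f hn3 wf hi
    rw [iA_X]
    have := hom _ _ (gen_mem f n j.castSucc)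
    convert this using 2
    rw [hm]
    fin_cases j <;> simp [u3, u4] <;> ring
  choose s hs1 hs2 using hs
  set δ : Derivation k (MvPolynomial (Fin 3) k) (MvPolynomial (Fin 3) k) := mkDerivation k s with hδ
  have hδX : ∀ j, δ (X j) = s j := fun j => mkDerivation_X k s j
  have hDi := der_iA f D i δ (fun j => by rw [hδX]; exact hs2 j)
  have homδ : HomDer δ e := by
    intro N r wr
    rw [der_eq_sum]
    apply IsWeightedHomogeneous.sum
    intro j _
    rw [hδX]
    exact WH.cast (IsWeightedHomogeneous.mul (WH.pderiv' wr j) (hs1 j)) (by ring)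
  have hwi : genPlus k f n 3 ^ i ≠ 0 := pow_ne_zero _ hw
  have hLND : IsLND δ := by
    have : ∀ (d : ℕ) (r : MvPolynomial (Fin 3) k), ldeg D hD (iA f n r) < d → ∃ N : ℕ, δ^[N] r = 0 := by
      intro d
      induction d with
      | zero => intro r h; omega
      | succ d ih =>
        intro r h
        by_cases h0 : δ r = 0
        · exact ⟨1, h0⟩
        · have h1 : iA f n (δ r) ≠ 0 := fun h => h0 (iA_inj f n hn (by rw [h, map_zero]))
          have h2 : D (iA f n r) ≠ 0 := by rw [hDi]; exact mul_ne_zero h1 hwi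
          have h3 := ldeg_apply D hD _ h2
          rw [hDi, ldeg_mul D hD h1 hwi] at h3
          obtain ⟨N, hN⟩ := ih (δ r) (by omega)
          exact ⟨N + 1, hN⟩
    intro r
    exact this _ r (Nat.lt_succ_self _)
  have hwn : D (genPlus k f n 3 ^ n) = - (iA f n (δ f) * genPlus k f n 3 ^ i) := by
    rw [wA_pow, map_neg, hDi]
  rw [Derivation.leibniz_pow] at hwn
  have hDw := hom _ _ (gen_mem f n 3)
  have key : δ (δ f) = 0 ∧ (δ = 0 → D (genPlus k f n 3) = 0) := by
    rcases lt_or_ge (i + 1) n with hlt | hge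
    · obtain ⟨g, wg, hg⟩ := F2 (d := e) f hn3 wf hlt (a := D (genPlus k f n 3)) (by
        convert hDw using 2
        rw [hm]; simp [u4]; ring)
      have : D (genPlus k f n 3) = 0 := ker_of_dvd_self D hD (by
        rw [hg, pow_succ, ← mul_assoc]; exact dvd_mul_left _ _)
      refine ⟨?_, fun _ => this⟩
      rw [this, smul_zero, smul_zero, eq_comm, neg_eq_zero] at hwn
      have h2 := (mul_eq_zero.1 hwn).resolve_right hwi
      have h3 : δ f = 0 := iA_inj f n hn (by rw [h2, map_zero])
      rw [h3, map_zero]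
    · obtain rfl : n = i + 1 := by omega
      obtain ⟨g, wg, hg⟩ := F2 (d := e + 9) (i := 0) f hn3 wf hn (a := D (genPlus k f (i+1) 3)) (by
        convert hDw using 2
        rw [hm]; simp [u4]; ring)
      rw [pow_zero, mul_one] at hg
      rw [hg] at hwn
      have h1 : δ f = - ((i + 1 : ℕ) : MvPolynomial (Fin 3) k) * g := by
        apply iA_inj f (i+1) hn
        apply mul_right_cancel₀ hwi
        rw [map_mul, map_neg, map_natCast, eq_comm, ← neg_inj, ← hwn]
        simp only [nsmul_eq_mul, smul_eq_mul, Nat.add_sub_cancel]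
        ring
      have h2 : δ g = 0 := by
        by_contra h0
        have h1 : iA f (i+1) (δ g) ≠ 0 := fun h => h0 (iA_inj f (i+1) hn (by rw [h, map_zero]))
        have h2 : D (iA f (i+1) g) ≠ 0 := by rw [hDi]; exact mul_ne_zero h1 hwi
        have h3 : D (genPlus k f (i+1) 3) ≠ 0 := by
          intro h; rw [h] at hg; rw [← hg, map_zero] at h2; exact h2 rfl
        have h4 := ldeg_apply D hD _ h3
        rw [hg, ldeg_apply D hD _ h2, hDi, ldeg_mul D hD h1 hwi, ldeg_pow] at h4
        have : 1 ≤ i := by omega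
        nlinarith [Nat.zero_le (ldeg D hD (iA f (i+1) (δ g))), Nat.zero_le (ldeg D hD (genPlus k f (i+1) 3))]
      refine ⟨?_, ?_⟩
      · rw [h1, Derivation.leibniz, h2]
        simp
      · intro h0
        have h3 : g = 0 := by
          rw [h0] at h1
          have : ((i + 1 : ℕ) : MvPolynomial (Fin 3) k) ≠ 0 := by exact_mod_cast Nat.succ_ne_zero i
          have h1' : - ((i + 1 : ℕ) : MvPolynomial (Fin 3) k) * g = 0 := h1.symm
          rcases mul_eq_zero.1 h1' with h | h
          · exact absurd (neg_eq_zero.1 h) this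
          · exact h
        rw [hg, h3, map_zero]
  have hδ0 := no δ e hLND homδ key.1
  apply der_extA
  intro j
  have hX : ∀ j : Fin 3, D (genPlus k f n j.castSucc) = 0 := by
    intro j
    rw [← iA_X, hDi, hδ0]
    simp
  fin_cases j
  · exact hX 0
  · exact hX 1
  · exact hX 2
  · exact key.2 hδ0

end P16




section P17
variable {k : Type} [Field k] [CharZero k]

lemma van10 (a0 a1 a2 a3 a4 a5 a6 a7 a8 a9 : k)
    (h : ∀ z : k, a0 + a1 * z + a2 * z ^ 2 + a3 * z ^ 3 + a4 * z ^ 4 + a5 * z ^ 5 + a6 * z ^ 6 + a7 * z ^ 7 + a8 * z ^ 8 + a9 * z ^ 9 = 0) :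
    a0 = 0 ∧ a1 = 0 ∧ a2 = 0 ∧ a3 = 0 := by
  open Polynomial in
  have hp : (Polynomial.C a0 + Polynomial.C a1 * Polynomial.X + Polynomial.C a2 * Polynomial.X ^ 2 + Polynomial.C a3 * Polynomial.X ^ 3
    + Polynomial.C a4 * Polynomial.X ^ 4 + Polynomial.C a5 * Polynomial.X ^ 5 + Polynomial.C a6 * Polynomial.X ^ 6
    + Polynomial.C a7 * Polynomial.X ^ 7 + Polynomial.C a8 * Polynomial.X ^ 8 + Polynomial.C a9 * Polynomial.X ^ 9 : Polynomial k) = 0 := by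
    apply Polynomial.funext
    intro z
    simpa using h z
  refine ⟨?_, ?_, ?_, ?_⟩
  · simpa [Polynomial.coeff_X, Polynomial.coeff_C, Polynomial.coeff_X_pow] using congrArg (fun p => Polynomial.coeff p 0) hp
  · simpa [Polynomial.coeff_X, Polynomial.coeff_C, Polynomial.coeff_X_pow] using congrArg (fun p => Polynomial.coeff p 1) hp
  · simpa [Polynomial.coeff_X, Polynomial.coeff_C, Polynomial.coeff_X_pow] using congrArg (fun p => Polynomial.coeff p 2) hp
  · simpa [Polynomial.coeff_X, Polynomial.coeff_C, Polynomial.coeff_X_pow] using congrArg (fun p => Polynomial.coeff p 3) hp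

lemma coefs (p q r s c1 c2 c3 c4 c5 c6 c7 c8 g3 g2 g a b B O : k) 
    (h : aeval (![C g3 * X 0 + C a * X 1 * X 2 + C b * X 2 ^ 3, C g2 * X 1 + C B * X 2 ^ 2, C g * X 2] : Fin 3 → MvPolynomial (Fin 3) k) (fexp p q r s c1 c2 c3 c4 c5 c6 c7 c8)
      = C O * fexp p q r s c1 c2 c3 c4 c5 c6 c7 c8) (x y : k) :
    ((1)*x^3*g3^3*p + (1)*x*y^3*g3*g2^3*q + (-1)*x^3*O*p + (-1)*x*y^3*O*q = 0) ∧ ((3)*x^2*y*g3^2*a*p + (1)*y^4*g2^3*a*q + (1)*x^2*y*g3^2*g2*g*r + (1)*y^4*g2^4*g*s + (-1)*x^2*y*O*r + (-1)*y^4*O*s = 0) ∧ ((3)*x*y^2*g3*a^2*p + (3)*x*y^2*g3*g2^2*B*q + (2)*x*y^2*g3*g2*g*a*r + (1)*x*y^2*g3*g2^2*g^2*c1 + (-1)*x*y^2*O*c1 = 0) ∧ ((3)*x^2*g3^2*b*p + (1)*y^3*a^3*p + (3)*y^3*g2^2*a*B*q + (1)*y^3*g2^3*b*q + (1)*x^2*g3^2*g*B*r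 + (1)*y^3*g2*g*a^2*r + (4)*y^3*g2^3*g*B*s + (1)*y^3*g2^2*g^2*a*c1 + (1)*x^2*g3^2*g^3*c2 + (1)*y^3*g2^3*g^3*c3 + (-1)*x^2*O*c2 + (-1)*y^3*O*c3 = 0) := by
  refine van10 
      ((1)*x^3*g3^3*p + (1)*x*y^3*g3*g2^3*q + (-1)*x^3*O*p + (-1)*x*y^3*O*q)
      ((3)*x^2*y*g3^2*a*p + (1)*y^4*g2^3*a*q + (1)*x^2*y*g3^2*g2*g*r + (1)*y^4*g2^4*g*s + (-1)*x^2*y*O*r + (-1)*y^4*O*s)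
      ((3)*x*y^2*g3*a^2*p + (3)*x*y^2*g3*g2^2*B*q + (2)*x*y^2*g3*g2*g*a*r + (1)*x*y^2*g3*g2^2*g^2*c1 + (-1)*x*y^2*O*c1)
      ((3)*x^2*g3^2*b*p + (1)*y^3*a^3*p + (3)*y^3*g2^2*a*B*q + (1)*y^3*g2^3*b*q + (1)*x^2*g3^2*g*B*r + (1)*y^3*g2*g*a^2*r + (4)*y^3*g2^3*g*B*s + (1)*y^3*g2^2*g^2*a*c1 + (1)*x^2*g3^2*g^3*c2 + (1)*y^3*g2^3*g^3*c3 + (-1)*x^2*O*c2 + (-1)*y^3*O*c3)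
      ((6)*x*y*g3*a*b*p + (3)*x*y*g3*g2*B^2*q + (2)*x*y*g3*g*a*B*r + (2)*x*y*g3*g2*g*b*r + (2)*x*y*g3*g2*g^2*B*c1 + (2)*x*y*g3*g^3*a*c2 + (1)*x*y*g3*g2*g^4*c4 + (-1)*x*y*O*c4)
      ((3)*y^2*a^2*b*p + (3)*y^2*g2*a*B^2*q + (3)*y^2*g2^2*b*B*q + (1)*y^2*g*a^2*B*r + (2)*y^2*g2*g*a*b*r + (6)*y^2*g2^2*g*B^2*s + (2)*y^2*g2*g^2*a*B*c1 + (1)*y^2*g2^2*g^2*b*c1 + (1)*y^2*g^3*a^2*c2 + (3)*y^2*g2^2*g^3*B*c3 + (1)*y^2*g2*g^4*a*c4 + (1)*y^2*g2^2*g^5*c5 + (-1)*y^2*O*c5)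
      ((3)*x*g3*b^2*p + (1)*x*g3*B^3*q + (2)*x*g3*g*b*B*r + (1)*x*g3*g^2*B^2*c1 + (2)*x*g3*g^3*b*c2 + (1)*x*g3*g^4*B*c4 + (1)*x*g3*g^6*c6 + (-1)*x*O*c6)
      ((3)*y*a*b^2*p + (1)*y*a*B^3*q + (3)*y*g2*b*B^2*q + (2)*y*g*a*b*B*r + (1)*y*g2*g*b^2*r + (4)*y*g2*g*B^3*s + (1)*y*g^2*a*B^2*c1 + (2)*y*g2*g^2*b*B*c1 + (2)*y*g^3*a*b*c2 + (3)*y*g2*g^3*B^2*c3 + (1)*y*g^4*a*B*c4 + (1)*y*g2*g^4*b*c4 + (2)*y*g2*g^5*B*c5 + (1)*y*g^6*a*c6 + (1)*y*g2*g^7*c7 + (-1)*y*O*c7)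
      (0)
      ((1)*b^3*p + (1)*b*B^3*q + (1)*g*b^2*B*r + (1)*g*B^4*s + (1)*g^2*b*B^2*c1 + (1)*g^3*b^2*c2 + (1)*g^3*B^3*c3 + (1)*g^4*b*B*c4 + (1)*g^5*B^2*c5 + (1)*g^6*b*c6 + (1)*g^7*B*c7 + (1)*g^9*c8 + (-1)*O*c8) ?_
  intro z
  have h1 := congrArg (aeval ![x, y, z]) h
  simp [fexp] at h1
  linear_combination h1

lemma solve (p q r s c1 c2 c3 c4 c5 c6 c7 c8 g3 g2 g a b B O : k) (hO : O ≠ 0) (hp : p ≠ 0) (hq : q ≠ 0) (hd : 3 * p * s - q * r ≠ 0)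
    (h : aeval (![C g3 * X 0 + C a * X 1 * X 2 + C b * X 2 ^ 3, C g2 * X 1 + C B * X 2 ^ 2, C g * X 2] : Fin 3 → MvPolynomial (Fin 3) k) (fexp p q r s c1 c2 c3 c4 c5 c6 c7 c8)
      = C O * fexp p q r s c1 c2 c3 c4 c5 c6 c7 c8) : 
    g ≠ 0 ∧ g2 = g ^ 2 ∧ g3 = g ^ 3 ∧ O = g ^ 9 ∧ a = 0 ∧ b = 0 ∧ B = 0 := by
  have e10 := coefs p q r s c1 c2 c3 c4 c5 c6 c7 c8 g3 g2 g a b B O h 1 0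
  have e01 := coefs p q r s c1 c2 c3 c4 c5 c6 c7 c8 g3 g2 g a b B O h 0 1
  have e11 := coefs p q r s c1 c2 c3 c4 c5 c6 c7 c8 g3 g2 g a b B O h 1 1
  obtain ⟨A0, -, -, A3⟩ := e10
  obtain ⟨-, B1, -, -⟩ := e01
  obtain ⟨D0, D1, D2, -⟩ := e11
  have h1 : g3 ^ 3 = O := mul_left_cancel₀ hp (by linear_combination A0)
  have h2 : g3 * g2 ^ 3 = O := mul_left_cancel₀ hq (by linear_combination D0 - A0)
  have hg3 : g3 ≠ 0 := by rintro rfl; apply hO; rw [← h1]; ring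
  have hg2 : g2 ≠ 0 := by rintro rfl; apply hO; rw [← h2]; ring
  have h3 : g3 ^ 2 = g2 ^ 3 := mul_left_cancel₀ hg3 (by linear_combination h1 - h2)
  have h4 : 3 * p * a = r * (g3 - g * g2) := mul_left_cancel₀ (pow_ne_zero 2 hg3) (by linear_combination D1 - B1 - r * h1)
  have h5 : q * a = s * (g3 - g * g2) := mul_left_cancel₀ (pow_ne_zero 3 hg2) (by linear_combination B1 - s * h2)
  have h6 : g3 - g * g2 = 0 := by
    apply (mul_eq_zero.1 (show (3 * p * s - q * r) * (g3 - g * g2) = 0 by linear_combination q * h4 - 3 * p * h5)).resolve_left hd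
  have ha : a = 0 := by
    rw [h6, mul_zero] at h5
    exact (mul_eq_zero.1 h5).resolve_left hq
  have hg2' : g2 = g ^ 2 := mul_left_cancel₀ (pow_ne_zero 2 hg2) (by linear_combination (g3 + g * g2) * h6 - h3)
  have hg3' : g3 = g ^ 3 := by rw [hg2'] at h6; linear_combination h6
  have hg : g ≠ 0 := by rintro rfl; apply hg2; rw [hg2']; ring
  have hOO : O = g ^ 9 := by rw [← h1, hg3']; ring
  subst ha hg2' hg3' hOO
  have hB : B = 0 := by
    have : (3 * q * g ^ 7) * B = 0 := by linear_combination D2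
    refine (mul_eq_zero.1 this).resolve_left ?_
    have : (3:k) ≠ 0 := by norm_num
    positivity
  subst hB
  have hb : b = 0 := by
    have : (3 * p * g ^ 6) * b = 0 := by linear_combination A3
    refine (mul_eq_zero.1 this).resolve_left ?_
    have : (3:k) ≠ 0 := by norm_num
    positivity
  exact ⟨hg, rfl, rfl, rfl, rfl, hb, rfl⟩

lemma form1 {r : MvPolynomial (Fin 3) k} (h : WH r 1) : ∃ c, r = C c * X 2 := by
  refine WH.induct (p := fun r => ∃ c, r = C c * X 2) (N := 1) h ⟨0, by simp⟩ ?_ ?_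
  · rintro _ _ ⟨c, rfl⟩ ⟨d, rfl⟩
    exact ⟨c + d, by rw [map_add]; ring⟩
  · intro i j l c h
    obtain rfl : i = 0 := by omega
    obtain rfl : j = 0 := by omega
    obtain rfl : l = 1 := by omega
    exact ⟨c, by ring⟩

lemma form2 {r : MvPolynomial (Fin 3) k} (h : WH r 2) : ∃ c b, r = C c * X 1 + C b * X 2 ^ 2 := by
  refine WH.induct (p := fun r => ∃ c b, r = C c * X 1 + C b * X 2 ^ 2) (N := 2) h ⟨0, 0, by simp⟩ ?_ ?_
  · rintro _ _ ⟨c, b, rfl⟩ ⟨d, b', rfl⟩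
    exact ⟨c + d, b + b', by rw [map_add, map_add]; ring⟩
  · intro i j l c h
    obtain rfl : i = 0 := by omega
    have : j ≤ 1 := by omega
    interval_cases j
    · obtain rfl : l = 2 := by omega
      exact ⟨0, c, by simp⟩
    · obtain rfl : l = 0 := by omega
      exact ⟨c, 0, by simp⟩

lemma form3 {r : MvPolynomial (Fin 3) k} (h : WH r 3) : ∃ c a b, r = C c * X 0 + C a * X 1 * X 2 + C b * X 2 ^ 3 := by
  refine WH.induct (p := fun r => ∃ c a b, r = C c * X 0 + C a * X 1 * X 2 + C b * X 2 ^ 3) (N := 3) h ⟨0, 0, 0, by simp⟩ ?_ ?_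
  · rintro _ _ ⟨c, a, b, rfl⟩ ⟨d, a', b', rfl⟩
    exact ⟨c + d, a + a', b + b', by rw [map_add, map_add, map_add]; ring⟩
  · intro i j l c h
    have : i ≤ 1 := by omega
    have : j ≤ 1 := by omega
    interval_cases i <;> interval_cases j <;> try omega
    · obtain rfl : l = 3 := by omega
      exact ⟨0, 0, c, by simp⟩
    · obtain rfl : l = 1 := by omega
      exact ⟨0, c, 0, by simp⟩
    · obtain rfl : l = 0 := by omega
      exact ⟨c, 0, 0, by simp⟩

lemma root_t {n : ℕ} (hn3 : ¬ 3 ∣ n) (g w : kˣ) (h : w ^ n = g ^ 9) : ∃ t : kˣ, t ^ n = g ∧ t ^ 9 = w := by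
  obtain ⟨u, v, huv⟩ := cop9 hn3
  have h' : w ^ (n : ℤ) = g ^ (9 : ℤ) := by exact_mod_cast h
  refine ⟨g ^ u * w ^ v, ?_, ?_⟩
  · rw [← zpow_natCast, mul_zpow, ← zpow_mul, ← zpow_mul, mul_comm v, zpow_mul w, h', ← zpow_mul, ← zpow_add, mul_comm 9 v, huv, zpow_one]
  · rw [← zpow_natCast, mul_zpow, ← zpow_mul, ← zpow_mul, mul_comm u, Nat.cast_ofNat, zpow_mul g, ← h', ← zpow_mul, ← zpow_add, mul_comm (n:ℤ), huv, zpow_one]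

theorem lemmaS (f : MvPolynomial (Fin 3) k) {n : ℕ} (hirr : Irreducible f) (wf : WH f 9) (hn2 : 2 ≤ n) (hn3 : ¬ 3 ∣ n)
    (hC : CondC3C4 k f) (β : QuotRingPlus k f n ≃ₐ[k] QuotRingPlus k f n) (hβ : ∀ N a, a ∈ gA f n N → β a ∈ gA f n N) : 
    InTorusPlus k f n β := by
  have hn : 0 < n := by omega
  haveI := domA f n hirr hn
  have hw := w_ne f hirr.ne_zero hn
  have hj : ∀ j : Fin 3, ∃ r, WH r (u3 j) ∧ β (iA f n (X j)) = iA f n r := by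
    intro j
    have := F2 f hn3 wf (i := 0) hn (d := u3 j) (a := β (iA f n (X j))) (by
      rw [iA_X]
      have := hβ _ _ (gen_mem f n j.castSucc)
      convert this using 2
      fin_cases j <;> simp [u3, u4] <;> ring)
    simpa using this
  obtain ⟨r0, wr0, hr0⟩ := hj 0
  obtain ⟨r1, wr1, hr1⟩ := hj 1
  obtain ⟨r2, wr2, hr2⟩ := hj 2
  obtain ⟨g3, a, b, rfl⟩ := form3 wr0
  obtain ⟨g2, B, rfl⟩ := form2 wr1
  obtain ⟨g, rfl⟩ := form1 wr2
  obtain ⟨r3, wr3, hr3⟩ := F2 f hn3 wf (i := 1) (by omega) (d := 0) (a := β (genPlus k f n 3)) (by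
      have := hβ _ _ (gen_mem f n 3)
      convert this using 2
      simp [u4])
  obtain ⟨w, rfl⟩ := wr3.exists_C
  rw [pow_one] at hr3
  have hCs : ∀ (c : k) (a : QuotRingPlus k f n), iA f n (C c) * a = c • a := by
    intro c a
    have : iA f n (C c) = algebraMap k _ c := (iA f n).commutes c
    rw [this]; exact (Algebra.smul_def c a).symm
  have hw0 : w ≠ 0 := by
    rintro rfl
    rw [map_zero, map_zero, zero_mul] at hr3
    exact hw (β.injective (by rw [hr3, map_zero]))
  have hβi : ∀ r, β (iA f n r) = iA f n (aeval (![C g3 * X 0 + C a * X 1 * X 2 + C b * X 2 ^ 3, C g2 * X 1 + C B * X 2 ^ 2, C g * X 2] : Fin 3 → MvPolynomial (Fin 3) k) r) := by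
    have : (β : QuotRingPlus k f n →ₐ[k] QuotRingPlus k f n).comp (iA f n) = (iA f n).comp (aeval (![C g3 * X 0 + C a * X 1 * X 2 + C b * X 2 ^ 3, C g2 * X 1 + C B * X 2 ^ 2, C g * X 2] : Fin 3 → MvPolynomial (Fin 3) k)) := by
      apply MvPolynomial.algHom_ext
      intro i
      rw [AlgHom.comp_apply, AlgHom.comp_apply, aeval_X]
      fin_cases i
      · exact hr0
      · exact hr1
      · exact hr2
    intro r
    exact congrArg (fun φ : MvPolynomial (Fin 3) k →ₐ[k] QuotRingPlus k f n => φ r) this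
  have hff : aeval (![C g3 * X 0 + C a * X 1 * X 2 + C b * X 2 ^ 3, C g2 * X 1 + C B * X 2 ^ 2, C g * X 2] : Fin 3 → MvPolynomial (Fin 3) k) f = C (w ^ n) * f := by
    apply iA_inj f n hn
    rw [← hβi, map_mul, map_pow, map_pow]
    have h1 := congrArg β (wA_pow f n)
    rw [map_pow, hr3, mul_pow, wA_pow, map_neg] at h1
    linear_combination h1
  obtain ⟨p, q, r, s, c1, c2, c3, c4, c5, c6, c7, c8, hf, hp, hq, hd⟩ := f_form wf hC
  rw [hf] at hff
  obtain ⟨hg, e2, e3, eO, ea, eb, eB⟩ := solve p q r s c1 c2 c3 c4 c5 c6 c7 c8 g3 g2 g a b B (w ^ n) (pow_ne_zero _ hw0) hp hq hd hff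
  subst e2 e3 ea eb eB
  obtain ⟨t, ht1, ht2⟩ := root_t hn3 (Units.mk0 g hg) (Units.mk0 w hw0) (by ext; simpa using eO)
  have ht1' : (t : k) ^ n = g := by simpa using congrArg Units.val ht1
  have ht2' : (t : k) ^ 9 = w := by simpa using congrArg Units.val ht2
  simp only [map_zero, zero_mul, add_zero, map_mul, hCs, iA_X] at hr0 hr1 hr2 hr3
  refine ⟨t, ?_, ?_, ?_, ?_⟩
  · rw [mul_comm 3 n, pow_mul, ht1']; exact hr0
  · rw [mul_comm 2 n, pow_mul, ht1']; exact hr1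
  · rw [ht1']; exact hr2
  · rw [ht2']; exact hr3

end P17




section P18
variable {k : Type} [Field k] [CharZero k] (f : MvPolynomial (Fin 3) k) (n : ℕ)

def bT (t : kˣ) (i : Fin 4) : QuotRingPlus k f n := algebraMap k _ ((t ^ (u4 n i) : kˣ) : k) * genPlus k f n i

lemma aevalT (t : kˣ) {p : MvPolynomial (Fin 4) k} {N : ℤ} (hp : IsWeightedHomogeneous (u4 n) p N) :
    aeval (bT f n t) p = algebraMap k (QuotRingPlus k f n) ((t ^ N : kˣ) : k) * Ideal.Quotient.mk (relIdealPlus k f n) p := by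
  rw [p.as_sum]
  refine Finset.sum_induction _ (fun p => aeval (bT f n t) p = algebraMap k (QuotRingPlus k f n) ((t ^ N : kˣ) : k) * Ideal.Quotient.mk (relIdealPlus k f n) p) ?_ ?_ ?_
  · intro a b ha hb
    rw [map_add, ha, hb, map_add, mul_add]
  · simp
  · intro d hd
    have := hp (mem_support_iff.1 hd)
    rw [weight_u4] at this
    have hC : Ideal.Quotient.mk (relIdealPlus k f n) (C (coeff d p)) = algebraMap k _ (coeff d p) := rfl
    have hX : ∀ i, Ideal.Quotient.mk (relIdealPlus k f n) (X i) = genPlus k f n i := fun i => rfl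
    have ht : ((t ^ N : kˣ) : k) = ((t ^ (u4 n 0) : kˣ) : k) ^ d 0 * ((t ^ (u4 n 1) : kˣ) : k) ^ d 1 * ((t ^ (u4 n 2) : kˣ) : k) ^ d 2 * ((t ^ (u4 n 3) : kˣ) : k) ^ d 3 := by
      rw [← this]
      simp only [← Units.val_pow_eq_pow_val, ← Units.val_mul]
      congr 1
      rw [← zpow_natCast, ← zpow_natCast, ← zpow_natCast, ← zpow_natCast, ← zpow_mul, ← zpow_mul, ← zpow_mul, ← zpow_mul,
        ← zpow_add, ← zpow_add, ← zpow_add]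
      congr 1
      simp [u4]; ring
    rw [mono4]
    simp only [map_mul, map_pow, aeval_X, aeval_C, hC, hX, bT, mul_pow, ht]
    ring

def torHom (wf : WH f 9) (t : kˣ) : QuotRingPlus k f n →ₐ[k] QuotRingPlus k f n :=
  liftA f n (bT f n t) (by
    rw [aevalT f n t (rel_wh f n wf)]
    have : Ideal.Quotient.mk (relIdealPlus k f n) (X 3 ^ n + rename Fin.castSucc f) = 0 :=
      Ideal.Quotient.eq_zero_iff_mem.2 (Ideal.mem_span_singleton_self _)
    rw [this, mul_zero])

lemma tor_mem (wf : WH f 9) (t : kˣ) {N : ℤ} {a : QuotRingPlus k f n} (h : a ∈ gA f n N) :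
    torHom f n wf t a = algebraMap k (QuotRingPlus k f n) ((t ^ N : kˣ) : k) * a := by
  obtain ⟨p, hp, rfl⟩ := (mem_gA f n).1 h
  exact aevalT f n t hp

lemma tor_mul (wf : WH f 9) (t s : kˣ) : (torHom f n wf t).comp (torHom f n wf s) = torHom f n wf (t * s) := by
  apply algHom_extA
  intro i
  rw [AlgHom.comp_apply, tor_mem f n wf s (gen_mem f n i), tor_mem f n wf (t * s) (gen_mem f n i), map_mul, AlgHom.commutes,
    tor_mem f n wf t (gen_mem f n i), mul_zpow, Units.val_mul, map_mul]
  ring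

lemma tor_one (wf : WH f 9) : torHom f n wf 1 = AlgHom.id k _ := by
  apply algHom_extA
  intro i
  rw [tor_mem f n wf 1 (gen_mem f n i), one_zpow, Units.val_one, map_one, one_mul]; rfl

def torEq (wf : WH f 9) (t : kˣ) : QuotRingPlus k f n ≃ₐ[k] QuotRingPlus k f n :=
  AlgEquiv.ofAlgHom (torHom f n wf t) (torHom f n wf t⁻¹) (by rw [tor_mul, mul_inv_cancel, tor_one])
    (by rw [tor_mul, inv_mul_cancel, tor_one])

def Phi (wf : WH f 9) : kˣ →* (QuotRingPlus k f n ≃ₐ[k] QuotRingPlus k f n) :=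
  MonoidHom.mk' (torEq f n wf) (by
    intro t s
    apply AlgEquiv.ext
    intro a
    exact congrArg (fun φ : QuotRingPlus k f n →ₐ[k] QuotRingPlus k f n => φ a) (tor_mul f n wf t s).symm)

lemma Phi_mem (wf : WH f 9) (t : kˣ) {N : ℤ} {a : QuotRingPlus k f n} (h : a ∈ gA f n N) :
    Phi f n wf t a = ((t ^ N : kˣ) : k) • a := (tor_mem f n wf t h).trans (Algebra.smul_def _ a).symm

lemma Phi_gen (wf : WH f 9) (t : kˣ) (i) : Phi f n wf t (genPlus k f n i) = ((t ^ u4 n i : kˣ) : k) • genPlus k f n i :=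
  Phi_mem f n wf t (gen_mem f n i)

lemma Phi_inTorus (wf : WH f 9) (t : kˣ) : InTorusPlus k f n (Phi f n wf t) := by
  have hz : ∀ (m : ℕ), ((t ^ (m : ℤ) : kˣ) : k) = (t : k) ^ m := by
    intro m; rw [zpow_natCast, Units.val_pow_eq_pow_val]
  refine ⟨t, ?_, ?_, ?_, ?_⟩
  · rw [Phi_gen, ← hz]; rfl
  · rw [Phi_gen, ← hz]; rfl
  · rw [Phi_gen, ← hz]; rfl
  · rw [Phi_gen, ← hz]; rfl

lemma inTorus_eq (wf : WH f 9) (α : QuotRingPlus k f n ≃ₐ[k] QuotRingPlus k f n) (h : InTorusPlus k f n α) : ∃ t, α = Phi f n wf t := by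
  obtain ⟨t, h0, h1, h2, h3⟩ := h
  obtain ⟨t', g0, g1, g2, g3⟩ := Phi_inTorus f n wf t
  have hz : ∀ (m : ℕ), ((t ^ (m : ℤ) : kˣ) : k) = (t : k) ^ m := by
    intro m; rw [zpow_natCast, Units.val_pow_eq_pow_val]
  refine ⟨t, ?_⟩
  have : (α : QuotRingPlus k f n →ₐ[k] QuotRingPlus k f n) = (Phi f n wf t : QuotRingPlus k f n →ₐ[k] QuotRingPlus k f n) := by
    apply algHom_extA
    intro i
    change α _ = Phi f n wf t _
    rw [Phi_gen]
    fin_cases i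
    · refine h0.trans ?_; rw [← hz]; rfl
    · refine h1.trans ?_; rw [← hz]; rfl
    · refine h2.trans ?_; rw [← hz]; rfl
    · refine h3.trans ?_; rw [← hz]; rfl
  apply AlgEquiv.ext
  intro a
  exact congrArg (fun φ : QuotRingPlus k f n →ₐ[k] QuotRingPlus k f n => φ a) this

variable {n}

lemma gen_ne (hf : f ≠ 0) (hn : 0 < n) (i : Fin 4) : genPlus k f n i ≠ 0 := by
  have hX : ∀ j : Fin 3, genPlus k f n j.castSucc ≠ 0 := by
    intro j h
    rw [← iA_X] at h
    exact X_ne_zero (R := k) j (iA_inj f n hn (by rw [h, map_zero]))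
  fin_cases i
  · exact hX 0
  · exact hX 1
  · exact hX 2
  · exact w_ne f hf hn

lemma t_of_pow (hn3 : ¬ 3 ∣ n) {t s : kˣ} (h1 : t ^ (n : ℤ) = s ^ (n : ℤ)) (h2 : t ^ (9 : ℤ) = s ^ (9 : ℤ)) : t = s := by
  obtain ⟨u, v, huv⟩ := cop9 hn3
  have : ∀ t : kˣ, t = (t ^ (n : ℤ)) ^ u * (t ^ (9 : ℤ)) ^ v := by
    intro t
    rw [← zpow_mul, ← zpow_mul, ← zpow_add, mul_comm (n : ℤ), mul_comm 9, huv, zpow_one]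
  rw [this t, h1, h2, ← this s]

lemma smulA_inj [IsDomain (QuotRingPlus k f n)] {c d : k} {a : QuotRingPlus k f n} (ha : a ≠ 0) (h : c • a = d • a) : c = d := by
  have h' : algebraMap k (QuotRingPlus k f n) c * a = algebraMap k (QuotRingPlus k f n) d * a :=
    ((Algebra.smul_def c a).symm.trans h).trans (Algebra.smul_def d a)
  exact (algebraMap k (QuotRingPlus k f n)).injective (mul_right_cancel₀ ha h')

lemma Phi_inj (hirr : Irreducible f) (wf : WH f 9) (hn : 0 < n) (hn3 : ¬ 3 ∣ n) : Function.Injective (Phi f n wf) := by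
  haveI := domA f n hirr hn
  intro t s h
  have key : ∀ i, t ^ u4 n i = s ^ u4 n i := by
    intro i
    have h1 := congrArg (fun φ : QuotRingPlus k f n ≃ₐ[k] QuotRingPlus k f n => φ (genPlus k f n i)) h
    simp only [Phi_gen] at h1
    exact Units.ext (smulA_inj f (gen_ne f hirr.ne_zero hn i) h1)
  exact t_of_pow hn3 (key 2) (key 3)

def t2 (k : Type) [Field k] [CharZero k] : kˣ := Units.mk0 2 two_ne_zero

lemma t2_inj : Function.Injective (fun m : ℤ => (t2 k) ^ m) := by
  rw [injective_zpow_iff_not_isOfFinOrder, isOfFinOrder_iff_pow_eq_one]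
  rintro ⟨j, hj, h⟩
  have h1 : (2 : k) ^ j = 1 := by simpa [t2] using congrArg Units.val h
  have h2 : (2 : ℕ) ^ j = 1 := by exact_mod_cast h1
  have := Nat.one_lt_two_pow hj.ne'
  omega

lemma eigen (hirr : Irreducible f) (wf : WH f 9) (hn : 0 < n) {a : QuotRingPlus k f n} (ha : a ≠ 0) (c : kˣ)
    (h : Phi f n wf (t2 k) a = (c : k) • a) : ∃ N : ℤ, 0 ≤ N ∧ c = t2 k ^ N ∧ a ∈ gA f n N := by
  haveI := domA f n hirr hn
  letI := gradA f n wf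
  have h1 : ∀ N b, cp (gA f n) N (Phi f n wf (t2 k) b) = ((t2 k ^ N : kˣ) : k) • cp (gA f n) N b := by
    intro N b
    refine hom_induct (gA f n) (p := fun b => cp (gA f n) N (Phi f n wf (t2 k) b) = ((t2 k ^ N : kˣ) : k) • cp (gA f n) N b) ?_ ?_ ?_ b
    · simp only [map_zero, smul_zero]
    · intro a b ha hb
      simp only [map_add, ha, hb, smul_add]
    · intro M a ha
      rw [Phi_mem f n wf _ ha, LinearMap.map_smul]
      by_cases hMN : M = N
      · subst hMN; rfl
      · rw [cp_ne _ ha hMN, smul_zero, smul_zero]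
  have h2 : ∀ N, cp (gA f n) N a ≠ 0 → c = t2 k ^ N := by
    intro N hN
    have := h1 N a
    rw [h, LinearMap.map_smul] at this
    exact Units.ext (smulA_inj f hN this)
  obtain ⟨N, hN⟩ : ∃ N, cp (gA f n) N a ≠ 0 := by
    by_contra hcon
    push Not at hcon
    exact ha (eq_of_cp (gA f n) (fun N => by rw [hcon N, map_zero]))
  have hmem : a = cp (gA f n) N a := by
    apply eq_of_cp (gA f n)
    intro M
    by_cases hMN : N = M
    · subst hMN; rw [cp_same (gA f n) (cp_mem (gA f n) N a)]
    · rw [cp_ne (gA f n) (cp_mem (gA f n) N a) hMN]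
      by_contra h0
      exact hMN (t2_inj ((h2 N hN).symm.trans (h2 M h0)))
  have hm : a ∈ gA f n N := by rw [hmem]; exact cp_mem (gA f n) N a
  refine ⟨N, ?_, h2 N hN, hm⟩
  by_contra hneg
  rw [gA_neg f N (by omega)] at hm
  exact ha hm

theorem mainA (hirr : Irreducible f) (wf : WH f 9) (hn2 : 2 ≤ n) (hn3 : ¬ 3 ∣ n) (hC : CondC3C4 k f)
    (no : ∀ (δ : Derivation k (MvPolynomial (Fin 3) k) (MvPolynomial (Fin 3) k)) (e : ℤ), IsLND δ → HomDer δ e → δ (δ f) = 0 → δ = 0)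
    (α : QuotRingPlus k f n ≃ₐ[k] QuotRingPlus k f n) : InTorusPlus k f n α := by
  have hn : 0 < n := by omega
  haveI := domA f n hirr hn
  letI := gradA f n wf
  classical
  have hstep : ∀ α : QuotRingPlus k f n ≃ₐ[k] QuotRingPlus k f n, ∃ l : ℕ, α * Phi f n wf (t2 k) * α⁻¹ = Phi f n wf (t2 k) ^ l := by
    intro α
    have hS := lemmaS f hirr wf hn2 hn3 hC (α * Phi f n wf (t2 k) * α⁻¹) (by
      intro N a ha
      refine conj_torus (gA f n) (gA_neg f) (Finset.univ.image (genPlus k f n)) ?_ ?_ (rigidA f hirr wf hn2 hn3 no) α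
        (torHom f n wf (t2 k)) (fun N => ((t2 k ^ N : kˣ) : k)) (fun N a ha => Phi_mem f n wf (t2 k) ha) ha
      · rw [Finset.coe_image, Finset.coe_univ, Set.image_univ]; exact adjA f
      · intro s hs
        obtain ⟨i, -, rfl⟩ := Finset.mem_image.1 hs
        exact ⟨_, gen_mem f n i⟩)
    obtain ⟨τ, hτ⟩ := inTorus_eq f n wf _ hS
    have hcomm : ∀ a, Phi f n wf (t2 k) (α.symm a) = α.symm (Phi f n wf τ a) := by
      intro a
      rw [← hτ]
      exact (α.symm_apply_apply _).symm
    have hev : ∀ i, ∃ N : ℤ, 0 ≤ N ∧ τ ^ u4 n i = t2 k ^ N := by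
      intro i
      obtain ⟨N, hN, h1, -⟩ := eigen f hirr wf hn (a := α.symm (genPlus k f n i)) (by
        intro h; exact gen_ne f hirr.ne_zero hn i (α.symm.injective (by rw [h, map_zero]))) (τ ^ u4 n i) (by
        rw [hcomm, Phi_gen]; exact map_smul α.symm _ _)
      exact ⟨N, hN, h1⟩
    obtain ⟨N1, hN1, h1⟩ := hev 2
    obtain ⟨N2, hN2, h2⟩ := hev 3
    have h1' : τ ^ (n : ℤ) = t2 k ^ N1 := h1
    have h2' : τ ^ (9 : ℤ) = t2 k ^ N2 := h2
    obtain ⟨u, v, huv⟩ := cop9 hn3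
    have hτl : τ = t2 k ^ (N1 * u + N2 * v) := by
      rw [zpow_add, zpow_mul, zpow_mul, ← h1', ← h2', ← zpow_mul, ← zpow_mul, ← zpow_add, mul_comm (n : ℤ), mul_comm 9, huv, zpow_one]
    have hl : (N1 * u + N2 * v) * n = N1 := by
      apply t2_inj (k := k)
      change t2 k ^ _ = t2 k ^ _
      rw [zpow_mul, ← hτl, h1']
    have hl0 : 0 ≤ N1 * u + N2 * v := by
      have : (0:ℤ) < n := by exact_mod_cast hn
      by_contra hneg
      push Not at hneg
      nlinarith
    obtain ⟨l, hl'⟩ := Int.eq_ofNat_of_zero_le hl0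
    refine ⟨l, ?_⟩
    rw [hτ, hτl, hl', ← map_pow, zpow_natCast]
  obtain ⟨l, hl⟩ := hstep α
  obtain ⟨l', hl'⟩ := hstep α⁻¹
  have h1 : Phi f n wf (t2 k) = Phi f n wf (t2 k) ^ (l * l') := by
    rw [pow_mul, ← hl, conj_pow, ← hl']
    group
  have h2 : l * l' = 1 := by
    rw [← map_pow] at h1
    have h3 := Phi_inj f hirr wf hn hn3 h1
    have : ((l * l' : ℕ) : ℤ) = 1 := by
      apply t2_inj (k := k)
      change t2 k ^ _ = t2 k ^ _
      rw [zpow_natCast, zpow_one, ← h3]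
    exact_mod_cast this
  obtain rfl : l = 1 := Nat.eq_one_of_mul_eq_one_right h2
  have hcomm : ∀ a, Phi f n wf (t2 k) (α a) = α (Phi f n wf (t2 k) a) := by
    intro a
    have : α * Phi f n wf (t2 k) = Phi f n wf (t2 k) * α := by
      rw [pow_one] at hl
      exact mul_inv_eq_iff_eq_mul.1 hl
    exact (congrArg (fun φ : QuotRingPlus k f n ≃ₐ[k] QuotRingPlus k f n => φ a) this).symm
  apply lemmaS f hirr wf hn2 hn3 hC
  intro N a ha
  by_cases h0 : α a = 0
  · rw [h0]; exact Submodule.zero_mem _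
  · obtain ⟨M, -, h3, h4⟩ := eigen f hirr wf hn h0 (t2 k ^ N) (by
      rw [hcomm, Phi_mem f n wf _ ha]; exact map_smul α _ _)
    have : N = M := t2_inj h3
    rw [this]; exact h4

end P18



/-- Theorem 1.3 (main3): if `f ∈ R₉` satisfies (C1)-(C4) and `A = R[W]/(Wⁿ + f)` with
`n ≥ 2`, `n ∉ 3ℤ`, then `Aut_k(A) = T(𝔊)` and this group is isomorphic to `k*`. -/
theorem statement_2 (k : Type) [Field k] [IsAlgClosed k] [CharZero k]
    (f : MvPolynomial (Fin 3) k)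
    (hf9 : f.IsWeightedHomogeneous w3 9)
    (hC1 : Irreducible f)
    (hC2 : CondC2 k f)
    (hC34 : CondC3C4 k f)
    (n : ℕ) (hn2 : 2 ≤ n) (hn3 : ¬ (3 ∣ n)) :
    (∀ α : QuotRingPlus k f n ≃ₐ[k] QuotRingPlus k f n, InTorusPlus k f n α) ∧
    ∃ Φ : kˣ →* (QuotRingPlus k f n ≃ₐ[k] QuotRingPlus k f n),
      Function.Injective Φ ∧ (∀ t : kˣ, InTorusPlus k f n (Φ t)) ∧
      ∀ α : QuotRingPlus k f n ≃ₐ[k] QuotRingPlus k f n, ∃ t : kˣ, α = Φ t := by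

  have wf : WH f 9 := by exact_mod_cast wh_of_nat.1 hf9
  obtain ⟨p, q, r, s, c1, c2, c3, c4, c5, c6, c7, c8, hf, hp, hq, hd⟩ := f_form wf hC34
  have hfx := fx_ne p q r s c1 c2 c3 c4 c5 c6 c7 c8 hf hp
  obtain ⟨a₁, b₁, a₂, b₂, hne, hf1, hf2, hp1, hp2⟩ := two_points p q r s c1 c2 c3 c4 c5 c6 c7 c8 hf hp hq wf hC1 hC2
  have no : ∀ (δ : Derivation k (MvPolynomial (Fin 3) k) (MvPolynomial (Fin 3) k)) (e : ℤ), IsLND δ → HomDer δ e → δ (δ f) = 0 → δ = 0 := by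
    intro δ e h1 h2 h3
    exact noLND hC1 wf hfx a₁ b₁ a₂ b₂ hne hf1 hf2 hp1 hp2 ((e + 4).toNat) δ e (by omega) h1 h2 h3
  have hall := mainA f hC1 wf hn2 hn3 hC34 no
  exact ⟨hall, Phi f n wf, Phi_inj f hC1 wf (by omega) hn3, Phi_inTorus f n wf, fun α => inTorus_eq f n wf α (hall α)⟩
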